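/- There exist constants c, C ∈ (0,∞) such that for every even integer n ≥ 2 the following holds. Let T_n = (ℤ/nℤ)² be the n×n torus, fix the base vertex x₀ = (0,0), and let φ_{T_n} be the uniform probability measure on the finite nonempty set of functions h : T_n → ℤ such that |h(u) − h(v)| = 1 whenever u and v are adjacent in T_n and h(x₀) = 0. Then for all u, v ∈ T_n with ‖u − v‖₁ ≥ 2, one has c·log‖u − v‖₁ ≤ φ_{T_n}[(h_u − h_v)²] ≤ C·log‖u − v‖₁, where ‖u − v‖₁ denotes the graph (L¹) distance between u and v in T_n. -/

import Mathlib

namespace SquareIceTorus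

/-- Expectation of `f` under the uniform measure on the finite set `S`. -/
noncomputable def expec {α : Type*} (S : Set α) (f : α → ℝ) : ℝ :=
  (∑ᶠ x ∈ S, f x) / (Nat.card S : ℝ)

/-- Nearest-neighbour adjacency on the torus `(ℤ/nℤ)²`. -/
def TAdj (n : ℕ) (u v : ZMod n × ZMod n) : Prop :=
  (u.1 = v.1 ∧ (u.2 = v.2 + 1 ∨ v.2 = u.2 + 1)) ∨
  (u.2 = v.2 ∧ (u.1 = v.1 + 1 ∨ v.1 = u.1 + 1))

/-- Height functions on the torus, normalised to vanish at the origin. -/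
def THom (n : ℕ) : Set (ZMod n × ZMod n → ℤ) :=
  {h | (∀ u v, TAdj n u v → |h u - h v| = 1) ∧ h (0, 0) = 0}

/-- Graph distance on `ℤ/nℤ`. -/
def zdist (n : ℕ) (x y : ZMod n) : ℕ := min (x - y).val (y - x).val

/-- `L¹` (graph) distance on the torus `(ℤ/nℤ)²`. -/
def torusDist (n : ℕ) (u v : ZMod n × ZMod n) : ℕ :=
  zdist n u.1 v.1 + zdist n u.2 v.2


/-! ### Setup -/

abbrev Vt (n : ℕ) := ZMod n × ZMod n
abbrev Cfg (n : ℕ) := Vt n → ℤ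

def IsHom {n : ℕ} (h : Cfg n) : Prop := ∀ u v, TAdj n u v → |h u - h v| = 1

lemma tadj_symm {n : ℕ} {u v : Vt n} (h : TAdj n u v) : TAdj n v u := by
  unfold TAdj at *; grind

/-- A pair of a lattice direction and a perpendicular one. -/
structure Frame (n : ℕ) (d q : Vt n) : Prop where
  adjd : ∀ x : Vt n, TAdj n x (x + d)
  adjq : ∀ x : Vt n, TAdj n x (x + q)
  nbr : ∀ x y : Vt n, TAdj n x y → y = x + d ∨ y = x - d ∨ y = x + q ∨ y = x - q
  indep : ∀ i j : ℤ, i • d + j • q = 0 → (n : ℤ) ∣ i ∧ (n : ℤ) ∣ j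

abbrev Dir := Bool × Bool

def ax (n : ℕ) (a : Bool) : Vt n := if a then (1, 0) else (0, 1)
def dv (n : ℕ) (d : Dir) : Vt n := if d.2 then ax n d.1 else - ax n d.1
def qv (n : ℕ) (d : Dir) : Vt n := ax n (!d.1)
def dneg (d : Dir) : Dir := (d.1, !d.2)

lemma dneg_dneg (d : Dir) : dneg (dneg d) = d := by
  rcases d with ⟨a, s⟩; simp [dneg]
lemma dv_dneg (n : ℕ) (d : Dir) : dv n (dneg d) = - dv n d := by
  rcases d with ⟨a, s⟩; cases s <;> simp [dneg, dv]
lemma qv_dneg (n : ℕ) (d : Dir) : qv n (dneg d) = qv n d := by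
  rcases d with ⟨a, s⟩; simp [dneg, qv]

lemma frame_dir (n : ℕ) (d : Dir) : Frame n (dv n d) (qv n d) := by
  rcases d with ⟨a, s⟩
  refine ⟨?_, ?_, ?_, ?_⟩
  · rintro ⟨x, y⟩
    cases a <;> cases s <;> simp [dv, ax, TAdj]
  · rintro ⟨x, y⟩
    cases a <;> cases s <;> simp [qv, ax, TAdj]
  · rintro ⟨x, y⟩ ⟨x', y'⟩ h
    simp only [TAdj] at h
    cases a <;> cases s <;> simp [dv, qv, ax, Prod.ext_iff] <;>
    · rcases h with ⟨rfl, rfl | rfl⟩ | ⟨rfl, rfl | rfl⟩ <;> simp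
  · intro i j h
    rw [← ZMod.intCast_zmod_eq_zero_iff_dvd, ← ZMod.intCast_zmod_eq_zero_iff_dvd]
    cases a <;> cases s <;> simp [dv, qv, ax, Prod.ext_iff] at h <;> tauto

lemma IsHom.abs_step {n : ℕ} {h : Cfg n} (hh : IsHom h) {d q : Vt n} (fr : Frame n d q) (x : Vt n) :
    h (x + d) = h x + 1 ∨ h (x + d) = h x - 1 := by
  have := hh _ _ (fr.adjd x)
  rcases abs_eq (by norm_num : (0:ℤ) ≤ 1) |>.1 this with h1 | h1 <;> omega

lemma Frame.neg {n : ℕ} {d q : Vt n} (fr : Frame n d q) : Frame n (-d) q := by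
  refine ⟨?_, fr.adjq, ?_, ?_⟩
  · intro x; have := tadj_symm (fr.adjd (x - d)); simpa [sub_eq_add_neg] using this
  · intro x y h; have := fr.nbr x y h
    simp only [sub_neg_eq_add, ← sub_eq_add_neg]; tauto
  · intro i j h
    have := fr.indep (-i) j (by simpa using h)
    simpa using this

lemma Frame.swap {n : ℕ} {d q : Vt n} (fr : Frame n d q) : Frame n q d := by
  refine ⟨fr.adjq, fr.adjd, ?_, ?_⟩
  · intro x y h; have := fr.nbr x y h; tauto
  · intro i j h
    have := fr.indep j i (by rw [add_comm]; exact h)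
    tauto

lemma Frame.negq {n : ℕ} {d q : Vt n} (fr : Frame n d q) : Frame n d (-q) := fr.swap.neg.swap

lemma isHom_neg {n : ℕ} {h : Cfg n} (hh : IsHom h) : IsHom (-h) := by
  intro u v huv
  have := hh u v huv
  simp only [Pi.neg_apply]
  rw [← this, ← abs_neg]; congr 1; ring

lemma isHom_add_const {n : ℕ} {h : Cfg n} (hh : IsHom h) (c : ℤ) : IsHom (fun x => h x + c) := by
  intro u v huv
  have := hh u v huv
  simpa using this

/-- renormalisation -/
def nrm {n : ℕ} (h : Cfg n) : Cfg n := fun x => h x + - h (0, 0)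

lemma mem_THom {n : ℕ} {h : Cfg n} : h ∈ THom n ↔ IsHom h ∧ h (0, 0) = 0 := Iff.rfl

lemma nrm_mem {n : ℕ} {h : Cfg n} (hh : IsHom h) : nrm h ∈ THom n := by
  refine ⟨?_, by simp [nrm]⟩
  exact isHom_add_const hh (- h (0,0))

lemma isHom_nat {n : ℕ} {h : Cfg n} (hh : IsHom h) (a b : ℕ) :
    |h ((a : ZMod n), (b : ZMod n)) - h (0, 0)| ≤ a + b ∧
      (2 : ℤ) ∣ h ((a : ZMod n), (b : ZMod n)) - h (0, 0) - a - b := by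
  induction a with
  | zero =>
    induction b with
    | zero => simp
    | succ b ih =>
      have h1 := hh.abs_step (frame_dir n (false, true)) ((0 : ℕ), (b : ZMod n))
      simp [dv, ax] at h1
      push_cast at *
      rw [abs_le] at *
      constructor
      · rcases h1 with h1 | h1 <;> rw [h1] <;> constructor <;> omega
      · rcases h1 with h1 | h1 <;> rw [h1] <;> omega
  | succ a ih =>
      have h1 := hh.abs_step (frame_dir n (true, true)) ((a : ZMod n), (b : ZMod n))
      simp [dv, ax] at h1
      push_cast at *
      rw [abs_le] at *
      constructor
      · rcases h1 with h1 | h1 <;> rw [h1] <;> constructor <;> omega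
      · rcases h1 with h1 | h1 <;> rw [h1] <;> omega

lemma finite_THom (n : ℕ) [NeZero n] : (THom n).Finite := by
  apply (Set.finite_Icc (fun _ : Vt n => -(2 * n : ℤ)) (fun _ => (2 * n : ℤ))).subset
  intro h hh
  have key : ∀ x : Vt n, |h x| ≤ 2 * n := by
    rintro ⟨x, y⟩
    have := (isHom_nat (mem_THom.1 hh).1 x.val y.val).1
    rw [(mem_THom.1 hh).2] at this
    rw [ZMod.natCast_zmod_val, ZMod.natCast_zmod_val, sub_zero] at this
    have h1 := ZMod.val_lt x
    have h2 := ZMod.val_lt y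
    have h1' : (x.val : ℤ) < n := by exact_mod_cast h1
    have h2' : (y.val : ℤ) < n := by exact_mod_cast h2
    linarith
  constructor <;> intro x <;> have := abs_le.1 (key x)
  · exact this.1
  · exact this.2

noncomputable def Om (n : ℕ) [NeZero n] : Finset (Cfg n) := (finite_THom n).toFinset

lemma mem_Om {n : ℕ} [NeZero n] {h : Cfg n} : h ∈ Om n ↔ IsHom h ∧ h (0, 0) = 0 := by
  simp [Om, mem_THom]

lemma nrm_mem_Om {n : ℕ} [NeZero n] {h : Cfg n} (hh : IsHom h) : nrm h ∈ Om n := by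
  simpa [Om] using nrm_mem hh

/-- unnormalised expectation -/
noncomputable def Sm {n : ℕ} [NeZero n] (F : Cfg n → ℝ) : ℝ := ∑ h ∈ Om n, F h

noncomputable def Nn (n : ℕ) [NeZero n] : ℝ := (Om n).card

def ShInv {n : ℕ} (F : Cfg n → ℝ) : Prop := ∀ (h : Cfg n) (c : ℤ), F (fun x => h x + c) = F h

lemma ShInv.nrm {n : ℕ} {F : Cfg n → ℝ} (hF : ShInv F) (h : Cfg n) : F (nrm h) = F h := by
  exact hF h (- h (0,0))

lemma ShInv.mul {n : ℕ} {F G : Cfg n → ℝ} (hF : ShInv F) (hG : ShInv G) :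
    ShInv (fun h => F h * G h) := fun h c => by simp only [hF h c, hG h c]

lemma ShInv.sub {n : ℕ} {F G : Cfg n → ℝ} (hF : ShInv F) (hG : ShInv G) :
    ShInv (fun h => F h - G h) := fun h c => by simp only [hF h c, hG h c]

lemma ShInv.add {n : ℕ} {F G : Cfg n → ℝ} (hF : ShInv F) (hG : ShInv G) :
    ShInv (fun h => F h + G h) := fun h c => by simp only [hF h c, hG h c]

lemma ShInv.const {n : ℕ} (a : ℝ) : ShInv (fun _ : Cfg n => a) := fun _ _ => rfl

lemma ShInv.comp {n : ℕ} {F : Cfg n → ℝ} (hF : ShInv F) (f : ℝ → ℝ) :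
    ShInv (fun h => f (F h)) := fun h c => by simp only [hF h c]

lemma ShInv.sum {n : ℕ} {ι : Type*} {s : Finset ι} {F : ι → Cfg n → ℝ} (hF : ∀ i ∈ s, ShInv (F i)) :
    ShInv (fun h => ∑ i ∈ s, F i h) := fun h c => Finset.sum_congr rfl fun i hi => hF i hi h c

lemma ShInv.addc {n : ℕ} {F : Cfg n → ℝ} (hF : ShInv F) (a : Cfg n) :
    ShInv (fun h => F (h + a)) := fun h c => by
  have := hF (h + a) c
  show F _ = F _
  rw [← this]; congr 1; funext x; simp [Pi.add_apply]; ring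

section lin
variable {n : ℕ} [NeZero n]
lemma Sm_add (F G : Cfg n → ℝ) : Sm (fun h => F h + G h) = Sm F + Sm G := Finset.sum_add_distrib
lemma Sm_sub (F G : Cfg n → ℝ) : Sm (fun h => F h - G h) = Sm F - Sm G :=
  Finset.sum_sub_distrib _ _
lemma Sm_mul_left (a : ℝ) (F : Cfg n → ℝ) : Sm (fun h => a * F h) = a * Sm F :=
  (Finset.mul_sum _ _ _).symm
lemma Sm_neg (F : Cfg n → ℝ) : Sm (fun h => - F h) = - Sm F := Finset.sum_neg_distrib _
lemma Sm_sum {ι : Type*} (s : Finset ι) (F : ι → Cfg n → ℝ) :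
    Sm (fun h => ∑ i ∈ s, F i h) = ∑ i ∈ s, Sm (F i) := Finset.sum_comm
lemma Sm_mono {F G : Cfg n → ℝ} (H : ∀ h ∈ Om n, F h ≤ G h) : Sm F ≤ Sm G := Finset.sum_le_sum H
lemma Sm_congr {F G : Cfg n → ℝ} (H : ∀ h ∈ Om n, F h = G h) : Sm F = Sm G := Finset.sum_congr rfl H
lemma Sm_nonneg {F : Cfg n → ℝ} (H : ∀ h ∈ Om n, 0 ≤ F h) : 0 ≤ Sm F := Finset.sum_nonneg H
lemma Sm_const (a : ℝ) : Sm (fun _ : Cfg n => a) = Nn n * a := by simp [Sm, Nn]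
lemma Sm_cs (F G : Cfg n → ℝ) :
    (Sm fun h => F h * G h) ^ 2 ≤ (Sm fun h => F h ^ 2) * Sm fun h => G h ^ 2 :=
  Finset.sum_mul_sq_le_sq_mul_sq _ _ _

/-- transformation by a bijection of configurations, up to renormalisation -/
lemma Sm_bij (Φ Ψ : Cfg n → Cfg n)
    (h1 : ∀ h, IsHom h → IsHom (Φ h)) (h2 : ∀ h, IsHom h → IsHom (Ψ h))
    (hΨΦ : ∀ h ∈ Om n, nrm (Ψ (nrm (Φ h))) = h) (hΦΨ : ∀ h ∈ Om n, nrm (Φ (nrm (Ψ h))) = h)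
    (F : Cfg n → ℝ) (hF : ShInv F) : Sm (fun h => F (Φ h)) = Sm F := by
  unfold Sm
  refine Finset.sum_nbij' (fun h => nrm (Φ h)) (fun h => nrm (Ψ h)) ?_ ?_ hΨΦ hΦΨ ?_
  · intro h hh; exact nrm_mem_Om (h1 h (mem_Om.1 hh).1)
  · intro h hh; exact nrm_mem_Om (h2 h (mem_Om.1 hh).1)
  · intro h _; exact (hF.nrm _).symm

lemma Sm_neg_cfg (F : Cfg n → ℝ) : Sm (fun h => F (-h)) = Sm F := by
  unfold Sm
  have hm : ∀ h ∈ Om n, -h ∈ Om n := by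
    intro h hh; rw [mem_Om] at *; exact ⟨isHom_neg hh.1, by simp [hh.2]⟩
  exact Finset.sum_nbij' (fun h => -h) (fun h => -h) hm hm (fun _ _ => neg_neg _)
    (fun _ _ => neg_neg _) (fun _ _ => rfl)

/-- invariance under graph automorphisms -/
lemma Sm_aut (σ : Vt n ≃ Vt n) (hσ : ∀ u v, TAdj n u v → TAdj n (σ u) (σ v))
    (hσ' : ∀ u v, TAdj n u v → TAdj n (σ.symm u) (σ.symm v))
    (F : Cfg n → ℝ) (hF : ShInv F) : Sm (fun h => F (h ∘ σ)) = Sm F := by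
  refine Sm_bij (fun h => h ∘ σ) (fun h => h ∘ σ.symm) ?_ ?_ ?_ ?_ F hF
  · intro h hh u v huv; exact hh _ _ (hσ u v huv)
  · intro h hh u v huv; exact hh _ _ (hσ' u v huv)
  · intro h hh; funext x; simp [nrm, (mem_Om.1 hh).2]
  · intro h hh; funext x; simp [nrm, (mem_Om.1 hh).2]

lemma Sm_trans (a : Vt n) (F : Cfg n → ℝ) (hF : ShInv F) :
    Sm (fun h => F (fun x => h (x + a))) = Sm F := by
  refine Sm_aut (Equiv.addRight a) ?_ ?_ F hF
  · intro u v; simp only [TAdj, Equiv.coe_addRight, Prod.fst_add, Prod.snd_add]; grind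
  · intro u v; simp only [TAdj, Equiv.addRight_symm, Equiv.coe_addRight, Prod.fst_add, Prod.snd_add]
    grind

def rfx {n : ℕ} (x : Vt n) : Vt n := (-x.1, x.2)
def swp {n : ℕ} (x : Vt n) : Vt n := (x.2, x.1)

lemma rfx_rfx (x : Vt n) : rfx (rfx x) = x := by simp [rfx]
lemma swp_swp (x : Vt n) : swp (swp x) = x := by simp [swp]

lemma tadj_rfx (u v : Vt n) (h : TAdj n u v) : TAdj n (rfx u) (rfx v) := by
  simp only [TAdj, rfx] at *; grind
lemma tadj_swp (u v : Vt n) (h : TAdj n u v) : TAdj n (swp u) (swp v) := by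
  simp only [TAdj, swp] at *; grind

lemma Sm_rfx (F : Cfg n → ℝ) (hF : ShInv F) : Sm (fun h => F (fun x => h (rfx x))) = Sm F :=
  Sm_aut ⟨rfx, rfx, rfx_rfx, rfx_rfx⟩ tadj_rfx tadj_rfx F hF
lemma Sm_swp (F : Cfg n → ℝ) (hF : ShInv F) : Sm (fun h => F (fun x => h (swp x))) = Sm F :=
  Sm_aut ⟨swp, swp, swp_swp, swp_swp⟩ tadj_swp tadj_swp F hF
end lin

/-- indicator -/
noncomputable def ind (P : Prop) : ℝ := open Classical in if P then 1 else 0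
lemma ind_true {P : Prop} (h : P) : ind P = 1 := by simp [ind, h]
lemma ind_false {P : Prop} (h : ¬ P) : ind P = 0 := by simp [ind, h]
lemma ind_nonneg (P : Prop) : 0 ≤ ind P := by unfold ind; split_ifs <;> norm_num
lemma ind_le_one (P : Prop) : ind P ≤ 1 := by unfold ind; split_ifs <;> norm_num
lemma ind_mono {P Q : Prop} (h : P → Q) : ind P ≤ ind Q := by
  unfold ind; split_ifs <;> first | (norm_num; done) | tauto
lemma ind_congr {P Q : Prop} (h : P ↔ Q) : ind P = ind Q := by rw [propext h]
lemma ind_sq (P : Prop) : ind P ^ 2 = ind P := by unfold ind; split_ifs <;> norm_num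
lemma ind_mul (P Q : Prop) : ind P * ind Q = ind (P ∧ Q) := by
  unfold ind; split_ifs <;> simp_all

/-- change of variables on events by adding a fixed function -/
lemma Sm_flip {n : ℕ} [NeZero n] (a : Cfg n) (P Q : Cfg n → Prop)
    (hP : ∀ h (c : ℤ), P (fun x => h x + c) ↔ P h) (hQ : ∀ h (c : ℤ), Q (fun x => h x + c) ↔ Q h)
    (h1 : ∀ h, IsHom h → P h → IsHom (h + a) ∧ Q (h + a))
    (h2 : ∀ h, IsHom h → Q h → IsHom (h - a) ∧ P (h - a))
    (F : Cfg n → ℝ) (hF : ShInv F) :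
    Sm (fun h => F h * ind (Q h)) = Sm (fun h => F (h + a) * ind (P h)) := by
  classical
  unfold Sm ind
  simp only [mul_ite, mul_one, mul_zero]
  rw [← Finset.sum_filter, ← Finset.sum_filter]
  have hPn : ∀ h, P (nrm h) ↔ P h := fun h => by
    exact hP h (- h (0,0))
  have hQn : ∀ h, Q (nrm h) ↔ Q h := fun h => by
    exact hQ h (- h (0,0))
  refine Finset.sum_nbij' (fun h => nrm (h - a)) (fun h => nrm (h + a)) ?_ ?_ ?_ ?_ ?_
  · intro h hh
    rw [Finset.mem_filter] at *
    have := h2 h (mem_Om.1 hh.1).1 hh.2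
    exact ⟨nrm_mem_Om this.1, (hPn _).2 this.2⟩
  · intro h hh
    rw [Finset.mem_filter] at *
    have := h1 h (mem_Om.1 hh.1).1 hh.2
    exact ⟨nrm_mem_Om this.1, (hQn _).2 this.2⟩
  · intro h hh
    rw [Finset.mem_filter] at hh
    funext x; simp [nrm, (mem_Om.1 hh.1).2]; ring
  · intro h hh
    rw [Finset.mem_filter] at hh
    funext x; simp [nrm, (mem_Om.1 hh.1).2]; ring
  · intro h hh
    have := hF h ((-(h - a) (0,0)))
    rw [← this]; congr 1; funext x; simp [nrm]; ring

/-! ### Patterns -/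

def Pat {n : ℕ} (h : Cfg n) (p d q : Vt n) (k : ℕ) : Prop :=
  (∀ i : ℕ, i ≤ k + 1 → h (p + i • d) = h p + i) ∧
  (∀ i : ℕ, 1 ≤ i → i ≤ k → h (p + i • d + q) = h p + i + 1 ∧ h (p + i • d - q) = h p + i + 1)

def Mn {n : ℕ} (h : Cfg n) (z : Vt n) : Prop := ∀ y, TAdj n z y → h y = h z + 1

def Up {n : ℕ} (h : Cfg n) (z d q : Vt n) (k : ℕ) : Prop := Mn h z ∧ Pat h z d q k

lemma IsHom.step_lr {n : ℕ} {h : Cfg n} (hh : IsHom h) {d q : Vt n} (fr : Frame n d q) (x : Vt n) :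
    h (x - d) = h x + 1 ∨ h (x - d) = h x - 1 := by
  have := hh.abs_step fr.neg x
  simpa [sub_eq_add_neg] using this

lemma mn_iff {n : ℕ} {h : Cfg n} {d q : Vt n} (fr : Frame n d q) (z : Vt n) :
    Mn h z ↔ h (z + d) = h z + 1 ∧ h (z - d) = h z + 1 ∧ h (z + q) = h z + 1 ∧
      h (z - q) = h z + 1 := by
  constructor
  · intro H
    refine ⟨H _ (fr.adjd z), H _ ?_, H _ (fr.adjq z), H _ ?_⟩
    · simpa [sub_eq_add_neg] using fr.neg.adjd z
    · simpa [sub_eq_add_neg] using fr.swap.neg.adjd z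
  · rintro ⟨h1, h2, h3, h4⟩ y hy
    rcases fr.nbr z y hy with rfl | rfl | rfl | rfl <;> assumption

lemma pat_shift {n : ℕ} {h : Cfg n} {d q : Vt n} (p : Vt n) (k : ℕ)
    (H : Pat h (p - d) d q (k + 1)) : Pat h p d q k := by
  obtain ⟨h1, h2⟩ := H
  have h0 := h1 1 (by omega)
  simp only [one_smul, sub_add_cancel] at h0
  have e : ∀ i : ℕ, p - d + (i + 1) • d = p + i • d := by
    intro i; rw [add_smul, one_smul]; abel
  constructor
  · intro i hi
    have := h1 (i + 1) (by omega)
    rw [e] at this; rw [this, h0]; push_cast; ring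
  · intro i hi hi'
    have := h2 (i + 1) (by omega) (by omega)
    rw [e] at this; rw [this.1, this.2, h0]; push_cast; constructor <;> ring

lemma pat_mono {n : ℕ} {h : Cfg n} {d q : Vt n} {p : Vt n} {k k' : ℕ} (hk : k' ≤ k)
    (H : Pat h p d q k) : Pat h p d q k' :=
  ⟨fun i hi => H.1 i (by omega), fun i hi hi' => H.2 i hi (by omega)⟩

lemma pat_chain {n : ℕ} {h : Cfg n} (hh : IsHom h) {d q : Vt n} (fr : Frame n d q) (p : Vt n)
    (k : ℕ) (hk : 1 ≤ k) (H : Pat h p d q k) (hM : ¬ Mn h p) : Pat h (p - d) d q (k + 1) := by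
  obtain ⟨h1, h2⟩ := H
  have hd := h1 1 (by omega)
  obtain ⟨hq1, hq2⟩ := h2 1 le_rfl hk
  simp only [one_smul, Nat.cast_one] at hd hq1 hq2
  have a1 := hh.abs_step fr (p + q)
  have a2 := hh.abs_step fr (p - q)
  rw [show p + q + d = p + d + q by abel] at a1
  rw [show p - q + d = p + d - q by abel] at a2
  have a3 := hh.abs_step fr.swap p
  have a4 := hh.step_lr fr.swap p
  have e1 : h (p + q) = h p + 1 := by omega
  have e2 : h (p - q) = h p + 1 := by omega
  have e3 : h (p - d) = h p - 1 := by
    rcases hh.step_lr fr p with h3 | h3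
    · exact absurd ((mn_iff fr p).2 ⟨hd, h3, e1, e2⟩) hM
    · exact h3
  have e : ∀ i : ℕ, p - d + (i + 1) • d = p + i • d := by
    intro i; rw [add_smul, one_smul]; abel
  constructor
  · intro i hi
    rcases i with _ | i
    · simp
    · rw [e, h1 i (by omega), e3]; push_cast; ring
  · intro i hi hi'
    obtain ⟨i, rfl⟩ : ∃ j, i = j + 1 := ⟨i - 1, by omega⟩
    rw [e, e3]
    rcases Nat.eq_zero_or_pos i with rfl | hi0
    · simp only [zero_smul, add_zero, e1, e2]; constructor <;> (push_cast; ring)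
    · obtain ⟨f1, f2⟩ := h2 i hi0 (by omega)
      rw [f1, f2]; constructor <;> (push_cast; ring)

lemma ind_pat_chain {n : ℕ} {h : Cfg n} (hh : IsHom h) {d q : Vt n} (fr : Frame n d q) (p : Vt n)
    (k : ℕ) (hk : 1 ≤ k) :
    ind (Pat h p d q k) = ind (Up h p d q k) + ind (Pat h (p - d) d q (k + 1)) := by
  by_cases hP : Pat h p d q k
  · by_cases hM : Mn h p
    · have : ¬ Pat h (p - d) d q (k + 1) := by
        intro H
        have h0 := H.1 1 (by omega)
        have := ((mn_iff fr p).1 hM).2.1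
        simp at h0; omega
      rw [ind_true hP, ind_true ⟨hM, hP⟩, ind_false this]; norm_num
    · rw [ind_true hP, ind_true (pat_chain hh fr p k hk hP hM), ind_false (fun H => hM H.1)]
      norm_num
  · rw [ind_false hP, ind_false (fun H => hP H.2), ind_false (fun H => hP (pat_shift p k H))]
    norm_num

lemma pat_large {n : ℕ} [NeZero n] {h : Cfg n} {p d q : Vt n} {k : ℕ} (hk : n ≤ k + 1) :
    ¬ Pat h p d q k := by
  intro H
  have := H.1 n hk
  have e : (n : ℕ) • d = 0 := by
    ext <;> simp
  rw [e, add_zero] at this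
  have := NeZero.ne n
  omega

section dirs
variable {n : ℕ}

noncomputable def Cc (h : Cfg n) (p : Vt n) (δ : Dir) (k : ℕ) : ℝ :=
  ind (Pat h p (dv n δ) (qv n δ) k) - ind (Pat (-h) p (dv n δ) (qv n δ) k)

noncomputable def Uu (h : Cfg n) (z : Vt n) (δ : Dir) (k : ℕ) : ℝ :=
  ind (Up h z (dv n δ) (qv n δ) k)

lemma Uu_chain {h : Cfg n} (hh : IsHom h) (z : Vt n) (δ : Dir) (k : ℕ) (hk : 1 ≤ k) :
    Uu h z δ k - Uu (-h) z δ k = Cc h z δ k - Cc h (z - dv n δ) δ (k + 1) := by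
  have h1 := ind_pat_chain hh (frame_dir n δ) z k hk
  have h2 := ind_pat_chain (isHom_neg hh) (frame_dir n δ) z k hk
  unfold Uu Cc
  linarith

lemma Cc_large [NeZero n] {h : Cfg n} {p : Vt n} {δ : Dir} {k : ℕ} (hk : n ≤ k + 1) :
    Cc h p δ k = 0 := by
  unfold Cc; rw [ind_false (pat_large hk), ind_false (pat_large hk)]; norm_num

lemma Uu_large [NeZero n] {h : Cfg n} {p : Vt n} {δ : Dir} {k : ℕ} (hk : n ≤ k + 1) :
    Uu h p δ k = 0 := by
  unfold Uu; rw [ind_false (fun H => pat_large hk H.2)]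

lemma Uu_zero (h : Cfg n) (z : Vt n) (δ : Dir) : Uu h z δ 0 = ind (Mn h z) := by
  unfold Uu
  refine ind_congr ⟨fun H => H.1, fun H => ⟨H, ?_, ?_⟩⟩
  · intro i hi
    have : i = 0 ∨ i = 1 := by omega
    rcases this with rfl | rfl
    · simp
    · simpa using H _ ((frame_dir n δ).adjd z)
  · intro i hi hi'; omega

noncomputable def Lap (φ : Vt n → ℝ) (x : Vt n) : ℝ := ∑ δ : Dir, (φ (x + dv n δ) - φ x)

lemma sum_dir {M : Type*} [AddCommMonoid M] (f : Dir → M) : ∑ δ : Dir, f δ =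
    (f (true, true) + f (true, false)) + (f (false, true) + f (false, false)) := by
  rw [Fintype.sum_prod_type]; simp

lemma lap_local {h : Cfg n} (hh : IsHom h) (x : Vt n) :
    Lap (fun y => (h y : ℝ)) x = 4 * (ind (Mn h x) - ind (Mn (-h) x)) +
      2 * ∑ δ : Dir, Cc h (x - dv n δ) δ 1 := by
  have f := frame_dir n (true, true)
  set e1 := dv n (true, true) with he1
  set e2 := qv n (true, true) with he2
  have ed1 : dv n (true, false) = - e1 := by simp [dv, he1]
  have ed2 : dv n (false, true) = e2 := by simp [dv, he2, qv]
  have ed3 : dv n (false, false) = - e2 := by simp [dv, he2, qv]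
  have eq1 : qv n (true, false) = e2 := rfl
  have eq2 : qv n (false, true) = e1 := by simp [dv, he1, qv]
  have eq3 : qv n (false, false) = e1 := by simp [dv, he1, qv]
  have P1 : ∀ (g : Cfg n) (d q : Vt n), Pat g (x - d) d q 1 ↔
      (g x = g (x - d) + 1 ∧ g (x + d) = g (x - d) + 2 ∧ g (x + q) = g (x - d) + 2 ∧
        g (x - q) = g (x - d) + 2) := by
    intro g d q
    constructor
    · intro H
      have h1 := H.1 1 (by omega)
      have h2 := H.1 2 (by omega)
      obtain ⟨h3, h4⟩ := H.2 1 le_rfl le_rfl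
      simp only [one_smul, two_smul, sub_add_cancel] at h1 h2 h3 h4
      rw [show x - d + (d + d) = x + d by abel] at h2
      push_cast at *
      exact ⟨h1, h2, by rw [h3]; ring, by rw [h4]; ring⟩
    · rintro ⟨h1, h2, h3, h4⟩
      constructor
      · intro i hi
        have : i = 0 ∨ i = 1 ∨ i = 2 := by omega
        rcases this with rfl | rfl | rfl
        · simp
        · simpa using h1
        · rw [two_smul, show x - d + (d + d) = x + d by abel, h2]; rfl
      · intro i hi hi'
        obtain rfl : i = 1 := by omega
        simp only [one_smul, sub_add_cancel, h3, h4]; push_cast; constructor <;> ring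
  have s1 := hh.abs_step f x
  have s2 := hh.step_lr f x
  have s3 := hh.abs_step f.swap x
  have s4 := hh.step_lr f.swap x
  unfold Lap Cc
  rw [sum_dir, sum_dir]
  simp only [ed1, ed2, ed3, eq1, eq2, eq3, ← he1, ← he2]
  simp only [P1, mn_iff f, Pi.neg_apply]
  simp only [sub_neg_eq_add, ← sub_eq_add_neg]
  have Q1 : ∀ c a b e f : ℤ, (c = a + 1 ∧ b = a + 2 ∧ e = a + 2 ∧ f = a + 2) ↔
      (a - c = -1 ∧ b - c = 1 ∧ e - c = 1 ∧ f - c = 1) := by intros; omega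
  have Q2 : ∀ c a b e f : ℤ, (-c = -a + 1 ∧ -b = -a + 2 ∧ -e = -a + 2 ∧ -f = -a + 2) ↔
      (a - c = 1 ∧ b - c = -1 ∧ e - c = -1 ∧ f - c = -1) := by intros; omega
  have Q3 : ∀ c a b e f : ℤ, (a = c + 1 ∧ b = c + 1 ∧ e = c + 1 ∧ f = c + 1) ↔
      (a - c = 1 ∧ b - c = 1 ∧ e - c = 1 ∧ f - c = 1) := by intros; omega
  have Q4 : ∀ c a b e f : ℤ, (-a = -c + 1 ∧ -b = -c + 1 ∧ -e = -c + 1 ∧ -f = -c + 1) ↔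
      (a - c = -1 ∧ b - c = -1 ∧ e - c = -1 ∧ f - c = -1) := by intros; omega
  simp only [Q2, Q4]
  simp only [Q1, Q3]
  have T : ∀ a c : ℤ, (a = c + 1 ∨ a = c - 1) → (a - c = 1 ∨ a - c = -1) := by intros; omega
  replace s1 := T _ _ s1
  replace s2 := T _ _ s2
  replace s3 := T _ _ s3
  replace s4 := T _ _ s4
  simp only [← Int.cast_sub]
  generalize h (x + e1) - h x = t1 at *
  generalize h (x - e1) - h x = t2 at *
  generalize h (x + e2) - h x = t3 at *
  generalize h (x - e2) - h x = t4 at *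
  clear P1 Q1 Q2 Q3 Q4 T
  rcases s1 with rfl | rfl <;> rcases s2 with rfl | rfl <;> rcases s3 with rfl | rfl <;>
    rcases s4 with rfl | rfl <;> norm_num [ind]
end dirs

/-! ### Towers, flips and integration by parts -/
section ibp
variable {n : ℕ}

def wt (k : ℕ) : ℝ := if k = 0 then 1 else 2

/-- twice the indicator of the tower -/
noncomputable def Tw (z : Vt n) (δ : Dir) (k : ℕ) : Cfg n :=
  open Classical in fun x => if ∃ i : ℕ, i ≤ k ∧ x = z + i • dv n δ then 2 else 0

noncomputable def Yy (ψ : Vt n → Dir → ℕ → ℝ) [NeZero n] (h : Cfg n) : ℝ :=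
  ∑ k ∈ Finset.range (n + 1), ∑ z : Vt n, ∑ δ : Dir,
    wt k * ψ z δ k * (Uu h z δ k - Uu (-h) z δ k)

lemma Yy_eq [NeZero n] (ψ : Vt n → Dir → ℕ → ℝ) (g : Vt n → ℝ) (hg : ∀ z δ, ψ z δ 0 = g z)
    {h : Cfg n} (hh : IsHom h) :
    Yy ψ h = ∑ x, g x * Lap (fun y => (h y : ℝ)) x +
      2 * ∑ k ∈ Finset.range n, ∑ z : Vt n, ∑ δ : Dir,
        (ψ z δ (k + 1) - ψ (z + dv n δ) δ k) * Cc h z δ (k + 1) := by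
  unfold Yy
  rw [Finset.sum_range_succ']
  have e0 : ∑ z : Vt n, ∑ δ : Dir, wt 0 * ψ z δ 0 * (Uu h z δ 0 - Uu (-h) z δ 0) =
      ∑ x, g x * Lap (fun y => (h y : ℝ)) x -
        2 * ∑ z : Vt n, ∑ δ : Dir, g (z + dv n δ) * Cc h z δ 1 := by
    have : ∑ z : Vt n, ∑ δ : Dir, g (z + dv n δ) * Cc h z δ 1 =
        ∑ z : Vt n, ∑ δ : Dir, g z * Cc h (z - dv n δ) δ 1 := by
      rw [Finset.sum_comm, Finset.sum_comm (γ := Vt n)]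
      refine Finset.sum_congr rfl fun δ _ => ?_
      refine Fintype.sum_equiv (Equiv.addRight (dv n δ)) _ _ fun z => ?_
      simp
    rw [this, Finset.mul_sum, ← Finset.sum_sub_distrib]
    refine Finset.sum_congr rfl fun z _ => ?_
    rw [lap_local hh]
    simp only [Uu_zero, hg, wt, if_true, one_mul, ← Finset.mul_sum]
    simp
    ring
  have e1 : ∀ k : ℕ, ∑ z : Vt n, ∑ δ : Dir,
      wt (k + 1) * ψ z δ (k + 1) * (Uu h z δ (k + 1) - Uu (-h) z δ (k + 1)) =
      2 * (∑ z : Vt n, ∑ δ : Dir, ψ z δ (k + 1) * Cc h z δ (k + 1) -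
        ∑ z : Vt n, ∑ δ : Dir, ψ (z + dv n δ) δ (k + 1) * Cc h z δ (k + 2)) := by
    intro k
    have : ∑ z : Vt n, ∑ δ : Dir, ψ (z + dv n δ) δ (k + 1) * Cc h z δ (k + 2) =
        ∑ z : Vt n, ∑ δ : Dir, ψ z δ (k + 1) * Cc h (z - dv n δ) δ (k + 2) := by
      rw [Finset.sum_comm, Finset.sum_comm (γ := Vt n)]
      refine Finset.sum_congr rfl fun δ _ => ?_
      refine Fintype.sum_equiv (Equiv.addRight (dv n δ)) _ _ fun z => ?_
      simp
    rw [this, ← Finset.sum_sub_distrib, Finset.mul_sum]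
    refine Finset.sum_congr rfl fun z _ => ?_
    rw [← Finset.sum_sub_distrib, Finset.mul_sum]
    refine Finset.sum_congr rfl fun δ _ => ?_
    rw [Uu_chain hh z δ (k + 1) (by omega)]
    simp [wt]; ring
  rw [e0, Finset.sum_congr rfl (fun k _ => e1 k), ← Finset.mul_sum, Finset.sum_sub_distrib]
  have e2 : ∑ k ∈ Finset.range n, ∑ z : Vt n, ∑ δ : Dir,
        ψ (z + dv n δ) δ k * Cc h z δ (k + 1) =
      ∑ k ∈ Finset.range n, ∑ z : Vt n, ∑ δ : Dir, ψ (z + dv n δ) δ (k + 1) * Cc h z δ (k + 2) +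
      ∑ z : Vt n, ∑ δ : Dir, g (z + dv n δ) * Cc h z δ 1 := by
    have h3 := Finset.sum_range_succ' (fun k => ∑ z : Vt n, ∑ δ : Dir,
        ψ (z + dv n δ) δ k * Cc h z δ (k + 1)) n
    rw [Finset.sum_range_succ] at h3
    have h4 : ∑ z : Vt n, ∑ δ : Dir, ψ (z + dv n δ) δ n * Cc h z δ (n + 1) = 0 := by
      refine Finset.sum_eq_zero fun z _ => Finset.sum_eq_zero fun δ _ => ?_
      rw [Cc_large (by omega), mul_zero]
    rw [h4, add_zero] at h3
    rw [h3]; simp only [hg]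
  have e3 : ∑ k ∈ Finset.range n, ∑ z : Vt n, ∑ δ : Dir,
        (ψ z δ (k + 1) - ψ (z + dv n δ) δ k) * Cc h z δ (k + 1) =
      ∑ k ∈ Finset.range n, ∑ z : Vt n, ∑ δ : Dir, ψ z δ (k + 1) * Cc h z δ (k + 1) -
      ∑ k ∈ Finset.range n, ∑ z : Vt n, ∑ δ : Dir, ψ (z + dv n δ) δ k * Cc h z δ (k + 1) := by
    simp only [sub_mul, Finset.sum_sub_distrib]
  rw [e3, e2]; ring

lemma pat_addc (h : Cfg n) (p d q : Vt n) (k : ℕ) (c : ℤ) :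
    Pat (fun x => h x + c) p d q k ↔ Pat h p d q k := by
  unfold Pat
  constructor <;> rintro ⟨h1, h2⟩ <;> refine ⟨fun i hi => ?_, fun i hi hi' => ?_⟩
  · have := h1 i hi; linarith
  · have := h2 i hi hi'; constructor <;> linarith [this.1, this.2]
  · have := h1 i hi; linarith
  · have := h2 i hi hi'; constructor <;> linarith [this.1, this.2]

lemma mn_addc (h : Cfg n) (p : Vt n) (c : ℤ) : Mn (fun x => h x + c) p ↔ Mn h p := by
  unfold Mn
  constructor <;> intro H y hy <;> have := H y hy <;> linarith

lemma up_addc (h : Cfg n) (p d q : Vt n) (k : ℕ) (c : ℤ) :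
    Up (fun x => h x + c) p d q k ↔ Up h p d q k := by
  unfold Up; rw [pat_addc, mn_addc]

lemma neg_addc (h : Cfg n) (c : ℤ) : -(fun x => h x + c) = fun x => (-h) x + (-c) := by
  funext x; simp; ring

lemma shInv_ind_pat (p d q : Vt n) (k : ℕ) : ShInv (fun h => ind (Pat h p d q k)) :=
  fun h c => ind_congr (pat_addc h p d q k c)
lemma shInv_ind_pat_neg (p d q : Vt n) (k : ℕ) : ShInv (fun h => ind (Pat (-h) p d q k)) :=
  fun h c => by simp only [neg_addc]; exact ind_congr (pat_addc _ p d q k _)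
lemma shInv_Cc (p : Vt n) (δ : Dir) (k : ℕ) : ShInv (fun h => Cc h p δ k) :=
  (shInv_ind_pat _ _ _ _).sub (shInv_ind_pat_neg _ _ _ _)
lemma shInv_Uu (p : Vt n) (δ : Dir) (k : ℕ) : ShInv (fun h => Uu h p δ k) :=
  fun h c => ind_congr (up_addc _ _ _ _ _ _)
lemma shInv_Uu_neg (p : Vt n) (δ : Dir) (k : ℕ) : ShInv (fun h => Uu (-h) p δ k) :=
  fun h c => by simp only [neg_addc]; exact ind_congr (up_addc _ _ _ _ _ _)
lemma shInv_Mn (p : Vt n) : ShInv (fun h => ind (Mn h p)) := fun h c => ind_congr (mn_addc _ _ _)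

lemma Frame.ne_along {d q : Vt n} (fr : Frame n d q) {i j : ℕ} (hij : i < j) (hj : j < i + n)
    (z : Vt n) : z + i • d ≠ z + j • d := by
  intro H
  have := (fr.indep ((j : ℤ) - i) 0 (by
    have H' : i • d = j • d := add_left_cancel H
    rw [sub_smul, natCast_zsmul, natCast_zsmul, H']; simp)).1
  have := Int.le_of_dvd (by omega) this
  omega

lemma Frame.ne_flank {d q : Vt n} (fr : Frame n d q) (hn : 2 ≤ n) (i j : ℕ)
    (z : Vt n) : z + i • d + q ≠ z + j • d := by
  intro H
  have := (fr.indep ((i : ℤ) - j) 1 (by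
    have H' : i • d + q = j • d := by rw [add_assoc] at H; exact add_left_cancel H
    rw [sub_smul, natCast_zsmul, natCast_zsmul, ← H']; simp)).2
  have := Int.le_of_dvd (by omega) this
  omega

/-- flipping a tower (abstract frame) -/
lemma flip_aux {h : Cfg n} (hh : IsHom h) {d q : Vt n} (fr : Frame n d q) (z : Vt n) (k : ℕ)
    (hn : 2 ≤ n) (hk : k + 2 ≤ n) (H : Up h z d q k) (a : Cfg n)
    (ha1 : ∀ i : ℕ, i ≤ k → a (z + i • d) = 2)
    (ha2 : ∀ x, (∀ i : ℕ, i ≤ k → x ≠ z + i • d) → a x = 0) :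
    IsHom (h + a) ∧ Up (-(h + a)) (z + k • d) (-d) q k := by
  obtain ⟨hM, hP⟩ := H
  have hM' := (mn_iff fr z).1 hM
  -- values
  have v0 : ∀ i : ℕ, i ≤ k + 1 → h (z + i • d) = h z + i := hP.1
  have v1 : ∀ i : ℕ, i ≤ k → h (z + i • d + q) = h z + i + 1 ∧ h (z + i • d - q) = h z + i + 1 := by
    intro i hi
    rcases Nat.eq_zero_or_pos i with rfl | hi0
    · simp [hM'.2.2.1, hM'.2.2.2]
    · exact hP.2 i hi0 hi
  have v2 : h (z - d) = h z + 1 := hM'.2.1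
  -- memberships
  have a1 : ∀ i : ℕ, i ≤ k → a (z + i • d + q) = 0 := fun i hi =>
    ha2 _ fun j _ => fr.ne_flank hn i j z
  have a2 : ∀ i : ℕ, i ≤ k → a (z + i • d - q) = 0 := fun i hi =>
    ha2 _ fun j _ => by rw [sub_eq_add_neg]; exact fr.negq.ne_flank hn i j z
  have a3 : a (z - d) = 0 := ha2 _ fun j hj => by
    intro H
    refine fr.ne_along (i := 0) (j := j + 1) (by omega) (by omega) (z - d) ?_
    rw [zero_smul, add_zero, add_smul, one_smul, H, ]
    rw [← H]
    have : z - d + (j • d + d) = z + j • d := by abel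
    rw [this, H]
  have a4 : a (z + (k + 1) • d) = 0 := ha2 _ fun j hj =>
    (fr.ne_along (by omega) (by omega) z).symm
  have out : ∀ i : ℕ, i ≤ k → ∀ y, TAdj n (z + i • d) y → (a y = 2) ∨
      (a y = 0 ∧ h y = h (z + i • d) + 1) := by
    intro i hi y hy
    rcases fr.nbr _ _ hy with rfl | rfl | rfl | rfl
    · have e : z + i • d + d = z + (i + 1) • d := by rw [add_smul, one_smul, add_assoc]
      rw [e]
      rcases Nat.lt_or_ge i k with h1 | h1
      · left; exact ha1 _ (by omega)
      · right
        obtain rfl : i = k := by omega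
        refine ⟨a4, ?_⟩
        rw [v0 _ (by omega), v0 _ (by omega)]; push_cast; ring
    · rcases Nat.eq_zero_or_pos i with rfl | h1
      · right; simp only [zero_smul, add_zero]; exact ⟨a3, v2⟩
      · left
        obtain ⟨j, rfl⟩ : ∃ j, i = j + 1 := ⟨i - 1, by omega⟩
        have e : z + (j + 1) • d - d = z + j • d := by rw [add_smul, one_smul]; abel
        rw [e]; exact ha1 _ (by omega)
    · right; exact ⟨a1 i hi, by rw [(v1 i hi).1, v0 i (by omega)]⟩
    · right; exact ⟨a2 i hi, by rw [(v1 i hi).2, v0 i (by omega)]⟩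
  constructor
  · intro x y hxy
    have base := hh x y hxy
    simp only [Pi.add_apply]
    by_cases hx : ∃ i : ℕ, i ≤ k ∧ x = z + i • d
    · obtain ⟨i, hi, rfl⟩ := hx
      rw [ha1 i hi]
      rcases out i hi y hxy with h1 | ⟨h1, h2⟩
      · rw [h1]; rw [← base]; congr 1; ring
      · rw [h1, h2]; norm_num
    · by_cases hy : ∃ i : ℕ, i ≤ k ∧ y = z + i • d
      · obtain ⟨i, hi, rfl⟩ := hy
        rw [ha1 i hi]
        rcases out i hi x (tadj_symm hxy) with h1 | ⟨h1, h2⟩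
        · rw [h1]; rw [← base]; congr 1; ring
        · rw [h1, h2]
          have : h (z + i • d) + 1 + 0 - (h (z + i • d) + 2) = -1 := by ring
          rw [this]; norm_num
      · push Not at hx hy
        rw [ha2 x hx, ha2 y hy]; simpa using base
  · have w0 : ∀ i : ℕ, i ≤ k → h (z + i • d) + a (z + i • d) = h z + i + 2 := fun i hi => by
      rw [v0 i (by omega), ha1 i hi]
    constructor
    · intro y hy
      simp only [Pi.neg_apply, Pi.add_apply]
      rw [w0 k le_rfl]
      rcases fr.nbr _ _ hy with rfl | rfl | rfl | rfl
      · have e : z + k • d + d = z + (k + 1) • d := by rw [add_smul, one_smul, add_assoc]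
        rw [e, a4, v0 _ (by omega)]; push_cast; ring
      · rcases k with _ | k
        · simp only [zero_smul, add_zero]; rw [a3, v2]; push_cast; ring
        · have e : z + (k + 1) • d - d = z + k • d := by rw [add_smul, one_smul]; abel
          rw [e, w0 k (by omega)]; push_cast; ring
      · rw [a1 k le_rfl, (v1 k le_rfl).1]; push_cast; ring
      · rw [a2 k le_rfl, (v1 k le_rfl).2]; push_cast; ring
    · have e : ∀ i : ℕ, i ≤ k → z + k • d + i • (-d) = z + (k - i) • d := by
        intro i hi
        obtain ⟨j, rfl⟩ := Nat.exists_eq_add_of_le hi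
        rw [Nat.add_sub_cancel_left, add_smul, smul_neg]; abel
      constructor
      · intro i hi
        simp only [Pi.neg_apply, Pi.add_apply]
        rw [w0 k le_rfl]
        rcases Nat.lt_or_ge k i with h1 | h1
        · obtain rfl : i = k + 1 := by omega
          have e' : z + k • d + (k + 1) • (-d) = z - d := by
            rw [add_smul, one_smul, smul_neg]; abel
          rw [e', a3, v2]; push_cast; ring
        · rw [e i h1, w0 _ (by omega)]; push_cast [h1]; ring
      · intro i hi hi'
        simp only [Pi.neg_apply, Pi.add_apply]
        rw [w0 k le_rfl, e i hi', a1 _ (by omega), a2 _ (by omega), (v1 (k - i) (by omega)).1,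
          (v1 (k - i) (by omega)).2]
        push_cast [hi']; constructor <;> ring

lemma Tw_mem (z : Vt n) (δ : Dir) (k i : ℕ) (hi : i ≤ k) : Tw z δ k (z + i • dv n δ) = 2 := by
  unfold Tw; rw [if_pos ⟨i, hi, rfl⟩]
lemma Tw_not_mem (z : Vt n) (δ : Dir) (k : ℕ) (x : Vt n) (h : ∀ i : ℕ, i ≤ k → x ≠ z + i • dv n δ) :
    Tw z δ k x = 0 := by
  unfold Tw; rw [if_neg]; push Not; exact h

lemma Sm_tower [NeZero n] (hn : 2 ≤ n) (z : Vt n) (δ : Dir) (k : ℕ) (F : Cfg n → ℝ) (hF : ShInv F) :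
    Sm (fun h => F h * Uu (-h) (z + k • dv n δ) (dneg δ) k) =
      Sm (fun h => F (h + Tw z δ k) * Uu h z δ k) := by
  rcases Nat.lt_or_ge n (k + 2) with hk | hk
  · simp only [Uu_large (show n ≤ k + 1 by omega)]; simp
  unfold Uu
  rw [dv_dneg, qv_dneg]
  refine Sm_flip (Tw z δ k) (fun h => Up h z (dv n δ) (qv n δ) k)
    (fun h => Up (-h) (z + k • dv n δ) (-dv n δ) (qv n δ) k) ?_ ?_ ?_ ?_ F hF
  · intro h c; exact up_addc _ _ _ _ _ _
  · intro h c; rw [neg_addc]; exact up_addc _ _ _ _ _ _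
  · intro h hh H
    exact flip_aux hh (frame_dir n δ) z k hn hk H _ (fun i hi => Tw_mem z δ k i hi)
      (fun x hx => Tw_not_mem z δ k x hx)
  · intro h hh H
    have e : ∀ i : ℕ, i ≤ k → z + k • dv n δ + i • (-dv n δ) = z + (k - i) • dv n δ := by
      intro i hi
      obtain ⟨j, rfl⟩ := Nat.exists_eq_add_of_le hi
      rw [Nat.add_sub_cancel_left, add_smul, smul_neg]; abel
    have := flip_aux (isHom_neg hh) (frame_dir n δ).neg (z + k • dv n δ) k hn hk H (Tw z δ k)
      (fun i hi => by rw [e i hi]; exact Tw_mem z δ k _ (by omega))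
      (fun x hx => Tw_not_mem z δ k x (fun i hi => by
        have := hx (k - i) (by omega)
        rw [e (k - i) (by omega)] at this
        rwa [show k - (k - i) = i by omega] at this))
    have e2 : -(-h + Tw z δ k) = h - Tw z δ k := by abel
    rw [e2] at this
    refine ⟨?_, ?_⟩
    · rw [← e2]; exact isHom_neg this.1
    · have h2 := this.2
      rwa [neg_neg, smul_neg, add_neg_cancel_right] at h2

/-- integration by parts -/
lemma Sm_ibp [NeZero n] (hn : 2 ≤ n) (ψ : Vt n → Dir → ℕ → ℝ)
    (hψ : ∀ z δ k, ψ (z + k • dv n δ) (dneg δ) k = ψ z δ k) (F : Cfg n → ℝ) (hF : ShInv F) :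
    Sm (fun h => F h * Yy ψ h) = - ∑ k ∈ Finset.range (n + 1), ∑ z : Vt n, ∑ δ : Dir,
      wt k * ψ z δ k * Sm (fun h => (F (h + Tw z δ k) - F h) * Uu h z δ k) := by
  have e1 : Sm (fun h => F h * Yy ψ h) = ∑ k ∈ Finset.range (n + 1), ∑ z : Vt n, ∑ δ : Dir,
      wt k * ψ z δ k * (Sm (fun h => F h * Uu h z δ k) - Sm (fun h => F h * Uu (-h) z δ k)) := by
    unfold Yy
    simp only [Finset.mul_sum]
    rw [Sm_sum]
    refine Finset.sum_congr rfl fun k _ => ?_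
    rw [Sm_sum]
    refine Finset.sum_congr rfl fun z _ => ?_
    rw [Sm_sum]
    refine Finset.sum_congr rfl fun δ _ => ?_
    rw [← Sm_sub, ← Sm_mul_left]
    refine Sm_congr fun h _ => ?_
    ring
  have e2 : ∀ k, ∑ z : Vt n, ∑ δ : Dir, wt k * ψ z δ k * Sm (fun h => F h * Uu (-h) z δ k) =
      ∑ z : Vt n, ∑ δ : Dir, wt k * ψ z δ k * Sm (fun h => F (h + Tw z δ k) * Uu h z δ k) := by
    intro k
    rw [← Fintype.sum_prod_type', ← Fintype.sum_prod_type']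
    symm
    let eqv : (Vt n × Dir) ≃ (Vt n × Dir) :=
      ⟨fun p => (p.1 + k • dv n p.2, dneg p.2), fun p => (p.1 + k • dv n p.2, dneg p.2),
        fun p => by simp [dv_dneg, dneg_dneg], fun p => by simp [dv_dneg, dneg_dneg]⟩
    refine Fintype.sum_equiv eqv _ _ ?_
    rintro ⟨z, δ⟩
    show _ = wt k * ψ (z + k • dv n δ) (dneg δ) k * _
    rw [hψ, ← Sm_tower hn z δ k F hF]
    rfl
  rw [e1, ← Finset.sum_neg_distrib]
  refine Finset.sum_congr rfl fun k _ => ?_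
  simp only [mul_sub, Finset.sum_sub_distrib, sub_mul, Sm_sub]
  rw [e2 k]; ring
end ibp

/-! ### Lower bound on the density of local minima -/
section dens
variable {n : ℕ} [NeZero n]

lemma sum_dir_shift (f : Vt n → Dir → ℝ) :
    ∑ x : Vt n, ∑ δ : Dir, f (x + dv n δ) (dneg δ) = ∑ x : Vt n, ∑ δ : Dir, f x δ := by
  rw [← Fintype.sum_prod_type', ← Fintype.sum_prod_type']
  let eqv : (Vt n × Dir) ≃ (Vt n × Dir) :=
    ⟨fun p => (p.1 + dv n p.2, dneg p.2), fun p => (p.1 + dv n p.2, dneg p.2),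
      fun p => by simp [dv_dneg, dneg_dneg], fun p => by simp [dv_dneg, dneg_dneg]⟩
  exact Fintype.sum_equiv eqv _ _ (fun _ => rfl)

lemma sum_mul_Lap (φ χ : Vt n → ℝ) :
    ∑ x, φ x * Lap χ x = -(1 / 2) * ∑ x : Vt n, ∑ δ : Dir,
      (φ (x + dv n δ) - φ x) * (χ (x + dv n δ) - χ x) := by
  have h1 := sum_dir_shift (fun x δ => φ x * (χ (x + dv n δ) - χ x))
  simp only [dv_dneg, add_neg_cancel_right] at h1
  have h2 : ∑ x : Vt n, ∑ δ : Dir, (φ (x + dv n δ) - φ x) * (χ (x + dv n δ) - χ x) =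
      - ∑ x : Vt n, ∑ δ : Dir, φ (x + dv n δ) * (χ x - χ (x + dv n δ)) -
      ∑ x : Vt n, ∑ δ : Dir, φ x * (χ (x + dv n δ) - χ x) := by
    rw [← Finset.sum_neg_distrib, ← Finset.sum_sub_distrib]
    refine Finset.sum_congr rfl fun x _ => ?_
    rw [← Finset.sum_neg_distrib, ← Finset.sum_sub_distrib]
    refine Finset.sum_congr rfl fun δ _ => ?_
    ring
  rw [h2, h1]
  unfold Lap
  simp only [Finset.mul_sum]
  ring_nf

lemma sum_Lap (χ : Vt n → ℝ) : ∑ x, Lap χ x = 0 := by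
  have := sum_mul_Lap (fun _ => 1) χ
  simpa using this

lemma Lap_eq_Yy {h : Cfg n} (hh : IsHom h) (x : Vt n) :
    Lap (fun y => (h y : ℝ)) x = Yy (fun z δ k => if z + k • dv n δ = x then 1 else 0) h := by
  rw [Yy_eq _ (fun z => if z = x then 1 else 0) (by simp) hh]
  have : ∀ (z : Vt n) (δ : Dir) (k : ℕ), z + (k + 1) • dv n δ = z + dv n δ + k • dv n δ := by
    intro z δ k; rw [add_smul, one_smul]; abel
  simp only [this, sub_self, zero_mul, Finset.sum_const_zero, mul_zero, add_zero]
  simp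

lemma hom_step_sq {h : Cfg n} (hh : IsHom h) (x : Vt n) (δ : Dir) :
    ((h (x + dv n δ) : ℝ) - h x) * ((h (x + dv n δ) : ℝ) - h x) = 1 := by
  rcases hh.abs_step (frame_dir n δ) x with h1 | h1 <;> rw [h1] <;> push_cast <;> ring

lemma card_Vt : (Fintype.card (Vt n) : ℝ) = (n : ℝ) ^ 2 := by
  simp [ZMod.card]; ring

lemma sum_h_Lap {h : Cfg n} (hh : IsHom h) :
    ∑ x, (h x : ℝ) * Lap (fun y => (h y : ℝ)) x = -2 * (n : ℝ) ^ 2 := by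
  rw [sum_mul_Lap]
  simp only [hom_step_sq hh, Finset.sum_const, Finset.card_univ, nsmul_eq_mul, card_Vt]
  simp [ZMod.card]; ring

lemma sum_h_Lap' {h : Cfg n} (hh : h ∈ Om n) :
    ∑ k ∈ Finset.range (n + 1), ∑ z : Vt n, ∑ δ : Dir, wt k *
      (((h (z + k • dv n δ) : ℝ) - h (0, 0)) * Uu h z δ k -
        ((h (z + k • dv n δ) : ℝ) - h (0, 0)) * Uu (-h) z δ k) = -2 * (n : ℝ) ^ 2 := by
  rw [← sum_h_Lap (mem_Om.1 hh).1]
  simp only [Lap_eq_Yy (mem_Om.1 hh).1, Yy, Finset.mul_sum]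
  symm
  refine Finset.sum_comm.trans (Finset.sum_congr rfl fun k _ => ?_)
  refine Finset.sum_comm.trans (Finset.sum_congr rfl fun z _ => ?_)
  refine Finset.sum_comm.trans (Finset.sum_congr rfl fun δ _ => ?_)
  rw [Finset.sum_eq_single (z + k • dv n δ)]
  · simp [(mem_Om.1 hh).2]; ring
  · intro b _ hb
    rw [if_neg (Ne.symm hb)]; ring
  · simp

lemma sh_diff (x y : Vt n) : ShInv (fun h : Cfg n => (h x : ℝ) - h y) := by
  intro h c; push_cast; ring

lemma Uu_le_Mn (h : Cfg n) (z : Vt n) (δ : Dir) (k : ℕ) : Uu h z δ k ≤ ind (Mn h z) :=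
  ind_mono fun H => H.1
lemma Uu_nonneg (h : Cfg n) (z : Vt n) (δ : Dir) (k : ℕ) : 0 ≤ Uu h z δ k := ind_nonneg _

lemma mn_trans (h : Cfg n) (a z : Vt n) : Mn (fun x => h (x + a)) z ↔ Mn h (z + a) := by
  have f := frame_dir n (true, true)
  rw [mn_iff f, mn_iff f]
  simp only [add_right_comm, sub_add_eq_add_sub]

lemma pat_trans (h : Cfg n) (a z d q : Vt n) (k : ℕ) :
    Pat (fun x => h (x + a)) z d q k ↔ Pat h (z + a) d q k := by
  unfold Pat
  simp only [add_right_comm, sub_add_eq_add_sub]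

lemma Uu_trans (h : Cfg n) (a z : Vt n) (δ : Dir) (k : ℕ) :
    Uu (fun x => h (x + a)) z δ k = Uu h (z + a) δ k := by
  refine ind_congr ?_
  unfold Up
  rw [mn_trans, pat_trans]

lemma Cc_trans (h : Cfg n) (a z : Vt n) (δ : Dir) (k : ℕ) :
    Cc (fun x => h (x + a)) z δ k = Cc h (z + a) δ k := by
  unfold Cc
  have e : -(fun x => h (x + a)) = fun x => (-h) (x + a) := rfl
  rw [ind_congr (pat_trans h a z _ _ k), e, ind_congr (pat_trans (-h) a z _ _ k)]

/-- expectation of a tower event, by translation invariance -/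
lemma Sm_Uu (z : Vt n) (δ : Dir) (k : ℕ) : Sm (fun h => Uu h z δ k) = Sm (fun h : Cfg n => Uu h 0 δ k) := by
  rw [← Sm_trans z (fun h : Cfg n => Uu h 0 δ k) (shInv_Uu _ _ _)]
  simp only [Uu_trans, zero_add]

noncomputable def m1 (n : ℕ) [NeZero n] : ℝ := Sm (fun h : Cfg n => ind (Mn h 0))

lemma Sm_Mn (z : Vt n) : Sm (fun h => ind (Mn h z)) = m1 n := by
  have := Sm_Uu z (true, true) 0
  simpa [Uu_zero, m1] using this

lemma Tw_nonneg (z : Vt n) (δ : Dir) (k : ℕ) (x : Vt n) : 0 ≤ Tw z δ k x := by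
  unfold Tw; split_ifs <;> norm_num

lemma m1_lower (hn : 2 ≤ n) : Nn n / 8 ≤ m1 n := by
  have h1 : Sm (fun h : Cfg n => ∑ k ∈ Finset.range (n + 1), ∑ z : Vt n, ∑ δ : Dir, wt k *
      (((h (z + k • dv n δ) : ℝ) - h (0, 0)) * Uu h z δ k -
        ((h (z + k • dv n δ) : ℝ) - h (0, 0)) * Uu (-h) z δ k)) = Nn n * (-2 * (n : ℝ) ^ 2) := by
    rw [← Sm_const]
    exact Sm_congr fun h hh => sum_h_Lap' hh
  rw [Sm_sum] at h1
  have key : ∀ k ∈ Finset.range (n + 1), ((k : ℝ) - 2) * wt k * ∑ z : Vt n, ∑ δ : Dir,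
      Sm (fun h => Uu h z δ k) ≤ Sm (fun h : Cfg n => ∑ z : Vt n, ∑ δ : Dir, wt k *
      (((h (z + k • dv n δ) : ℝ) - h (0, 0)) * Uu h z δ k -
        ((h (z + k • dv n δ) : ℝ) - h (0, 0)) * Uu (-h) z δ k)) := by
    intro k _
    have e1 : Sm (fun h : Cfg n => ∑ z : Vt n, ∑ δ : Dir, wt k *
      (((h (z + k • dv n δ) : ℝ) - h (0, 0)) * Uu h z δ k -
        ((h (z + k • dv n δ) : ℝ) - h (0, 0)) * Uu (-h) z δ k)) = wt k * (∑ z : Vt n, ∑ δ : Dir,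
        Sm (fun h => ((h (z + k • dv n δ) : ℝ) - h (0, 0)) * Uu h z δ k) -
        ∑ z : Vt n, ∑ δ : Dir,
        Sm (fun h => ((h (z + k • dv n δ) : ℝ) - h (0, 0)) * Uu (-h) z δ k)) := by
      rw [Sm_sum, ← Finset.sum_sub_distrib, Finset.mul_sum]
      refine Finset.sum_congr rfl fun z _ => ?_
      rw [Sm_sum, ← Finset.sum_sub_distrib, Finset.mul_sum]
      refine Finset.sum_congr rfl fun δ _ => ?_
      rw [← Sm_sub, ← Sm_mul_left]
    have e2 : ∑ z : Vt n, ∑ δ : Dir,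
        Sm (fun h => ((h (z + k • dv n δ) : ℝ) - h (0, 0)) * Uu (-h) z δ k) =
        ∑ z : Vt n, ∑ δ : Dir,
        Sm (fun h => ((h z : ℝ) - h (0, 0) + 2 - Tw z δ k (0, 0)) * Uu h z δ k) := by
      rw [← Fintype.sum_prod_type', ← Fintype.sum_prod_type']
      symm
      let eqv : (Vt n × Dir) ≃ (Vt n × Dir) :=
        ⟨fun p => (p.1 + k • dv n p.2, dneg p.2), fun p => (p.1 + k • dv n p.2, dneg p.2),
          fun p => by simp [dv_dneg, dneg_dneg], fun p => by simp [dv_dneg, dneg_dneg]⟩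
      refine Fintype.sum_equiv eqv _ _ ?_
      rintro ⟨z, δ⟩
      have := Sm_tower hn z δ k (fun h => (h z : ℝ) - h (0, 0)) (sh_diff _ _)
      have e3 : z + k • dv n δ + k • dv n (dneg δ) = z := by simp [dv_dneg]
      show _ = Sm (fun h => ((h (z + k • dv n δ + k • dv n (dneg δ)) : ℝ) - h (0, 0)) *
        Uu (-h) (z + k • dv n δ) (dneg δ) k)
      rw [e3, this]
      refine Sm_congr fun h _ => ?_
      have : Tw z δ k z = 2 := by simpa using Tw_mem z δ k 0 (by omega)
      simp only [Pi.add_apply, this]; push_cast; ring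
    have wk : 0 ≤ wt k := by unfold wt; split_ifs <;> norm_num
    rw [e1, e2, ← Finset.sum_sub_distrib, mul_comm _ (wt k), mul_assoc]
    refine mul_le_mul_of_nonneg_left ?_ wk
    rw [Finset.mul_sum]
    refine Finset.sum_le_sum fun z _ => ?_
    rw [Finset.mul_sum, ← Finset.sum_sub_distrib]
    refine Finset.sum_le_sum fun δ _ => ?_
    rw [← Sm_sub, ← Sm_mul_left]
    refine Sm_mono fun h _ => ?_
    rw [← sub_mul]
    by_cases hU : Up h z (dv n δ) (qv n δ) k
    · have hT : (0 : ℝ) ≤ Tw z δ k (0, 0) := by exact_mod_cast Tw_nonneg z δ k (0, 0)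
      rw [hU.2.1 k (by omega)]
      refine mul_le_mul_of_nonneg_right ?_ (Uu_nonneg _ _ _ _)
      push_cast; linarith
    · have : Uu h z δ k = 0 := ind_false hU
      rw [this]; simp
  have h2 := Finset.sum_le_sum key
  rw [h1] at h2
  have low : -16 * (n : ℝ) ^ 2 * m1 n ≤ ∑ k ∈ Finset.range (n + 1), ((k : ℝ) - 2) * wt k *
      ∑ z : Vt n, ∑ δ : Dir, Sm (fun h => Uu h z δ k) := by
    obtain ⟨m, rfl⟩ : ∃ m, n = m + 1 := ⟨n - 1, by omega⟩
    rw [Finset.sum_range_succ', Finset.sum_range_succ']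
    have t0 : ∑ z : Vt (m + 1), ∑ δ : Dir, Sm (fun h => Uu h z δ 0) =
        4 * ((m + 1 : ℕ) : ℝ) ^ 2 * m1 (m + 1) := by
      simp only [Uu_zero, Sm_Mn, Finset.sum_const, Finset.card_univ, nsmul_eq_mul, card_Vt]
      simp [ZMod.card]; ring
    have t1 : ∑ z : Vt (m + 1), ∑ δ : Dir, Sm (fun h => Uu h z δ 1) ≤
        4 * ((m + 1 : ℕ) : ℝ) ^ 2 * m1 (m + 1) := by
      rw [← t0]
      refine Finset.sum_le_sum fun z _ => Finset.sum_le_sum fun δ _ => Sm_mono fun h _ => ?_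
      rw [Uu_zero]; exact Uu_le_Mn _ _ _ _
    have t2 : 0 ≤ ∑ k ∈ Finset.range m, (((k + 1 + 1 : ℕ) : ℝ) - 2) * wt (k + 1 + 1) *
      ∑ z : Vt (m + 1), ∑ δ : Dir, Sm (fun h => Uu h z δ (k + 1 + 1)) := by
      refine Finset.sum_nonneg fun k _ => mul_nonneg (mul_nonneg ?_ ?_) ?_
      · push_cast; have : (0 : ℝ) ≤ k := by positivity
        linarith
      · simp [wt]
      · exact Finset.sum_nonneg fun z _ => Finset.sum_nonneg fun δ _ =>
          Sm_nonneg fun h _ => Uu_nonneg _ _ _ _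
    simp only [zero_add]
    rw [t0]
    simp only [wt, if_true, Nat.cast_zero, one_ne_zero, if_false, Nat.cast_one] at t2 ⊢
    linarith
  have hn2 : (0 : ℝ) < (n : ℝ) ^ 2 := by have := NeZero.pos n; positivity
  have h3 : 2 * Nn n * (n : ℝ) ^ 2 ≤ 16 * m1 n * (n : ℝ) ^ 2 := by linarith
  have := le_of_mul_le_mul_right h3 hn2
  linarith
end dens

/-! ### Reflection positivity -/
section rp
variable {n : ℕ} [NeZero n]

lemma val_succ' {a : ZMod n} (h : a.val + 1 < n) : (a + 1).val = a.val + 1 := by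
  have : a + 1 = ((a.val + 1 : ℕ) : ZMod n) := by simp
  rw [this, ZMod.val_natCast_of_lt h]

def inH (x : Vt n) : Prop := x.1.val ≤ n / 2

lemma rfx_fix (hn : Even n) {x : Vt n} (h1 : inH x) (h2 : inH (rfx x)) : rfx x = x := by
  obtain ⟨m, hm⟩ := hn
  rcases x with ⟨a, b⟩
  simp only [inH, rfx] at *
  ext
  · show -a = a
    rw [ZMod.neg_val] at h2
    by_cases ha : a = 0
    · simp [ha]
    rw [if_neg ha] at h2
    have h3 := ZMod.val_lt a
    apply ZMod.val_injective
    rw [ZMod.neg_val, if_neg ha]; omega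
  · rfl

lemma rfx_out (hn : Even n) {x : Vt n} (h1 : ¬ inH x) : inH (rfx x) := by
  obtain ⟨m, hm⟩ := hn
  rcases x with ⟨a, b⟩
  simp only [inH, rfx] at *
  rw [ZMod.neg_val]
  split_ifs <;> omega

lemma bdry (hn : Even n) {u v : Vt n} (h : TAdj n u v) (h1 : inH u) (h2 : ¬ inH v) : rfx u = u := by
  obtain ⟨m, hm⟩ := hn
  apply rfx_fix ⟨m, hm⟩ h1
  rcases u with ⟨a, b⟩
  rcases v with ⟨a', b'⟩
  simp only [TAdj, inH, rfx] at *
  rcases h with ⟨rfl, _⟩ | ⟨rfl, h | h⟩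
  · exact absurd h1 h2
  · rw [ZMod.neg_val]
    by_cases ha : a = 0
    · simp [ha]
    · exfalso
      subst h
      have ht := ZMod.val_lt a'
      have : a'.val + 1 < n ∨ a'.val + 1 = n := by omega
      rcases this with h3 | h3
      · have := val_succ' h3
        omega
      · apply ha
        have : ((a'.val + 1 : ℕ) : ZMod n) = 0 := by rw [h3]; simp
        simpa using this
  · subst h
    have hb : a.val = m := by
      by_contra hne
      have : a.val + 1 < n := by omega
      have := val_succ' this
      omega
    rw [ZMod.neg_val]
    split_ifs <;> omega

open Classical in
/-- glue -/
noncomputable def gl (h1 h2 : Cfg n) : Cfg n := fun x => if inH x then h1 x else h2 (rfx x)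

lemma inH_zero : inH ((0, 0) : Vt n) := by simp [inH]

lemma gl_hom (hn : Even n) {h1 h2 : Cfg n} (hh1 : IsHom h1) (hh2 : IsHom h2)
    (hb : ∀ x, rfx x = x → h1 x = h2 x) : IsHom (gl h1 h2) := by
  intro u v huv
  unfold gl
  by_cases hu : inH u <;> by_cases hv : inH v <;> simp only [hu, hv, if_true, if_false]
  · exact hh1 _ _ huv
  · have := bdry hn huv hu hv
    rw [hb u this]; nth_rewrite 1 [← this]
    exact hh2 _ _ (tadj_rfx _ _ huv)
  · have := bdry hn (tadj_symm huv) hv hu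
    rw [hb v this]; nth_rewrite 1 [← this]
    exact hh2 _ _ (tadj_rfx _ _ huv)
  · exact hh2 _ _ (tadj_rfx _ _ huv)

open Classical in
noncomputable def Sy (n : ℕ) [NeZero n] : Finset (Cfg n) :=
  (Om n).filter fun h => ∀ x, h (rfx x) = h x

open Classical in
noncomputable def bd (h : Cfg n) : Cfg n := fun x => if rfx x = x then h x else 0

lemma bd_eq_iff {h1 h2 : Cfg n} : bd h1 = bd h2 ↔ ∀ x, rfx x = x → h1 x = h2 x := by
  constructor
  · intro H x hx
    have := congrFun H x
    simpa [bd, hx] using this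
  · intro H; funext x
    unfold bd; split_ifs with hx
    · exact H x hx
    · rfl

open Classical in
noncomputable def Sb (F : Cfg n → ℝ) (β : Cfg n) : ℝ :=
  ∑ s ∈ (Sy n).filter (fun s => bd s = β), F s

def DepH (F : Cfg n → ℝ) : Prop := ∀ h h', (∀ x, inH x → h x = h' x) → F h = F h'

lemma gl_on {h1 h2 : Cfg n} {x : Vt n} (hx : inH x) : gl h1 h2 x = h1 x := by simp [gl, hx]
lemma gl_off {h1 h2 : Cfg n} {x : Vt n} (hx : ¬ inH x) : gl h1 h2 x = h2 (rfx x) := by simp [gl, hx]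

lemma rp_eq (hn : Even n) (F G : Cfg n → ℝ) (hF : DepH F) (hG : DepH G) :
    Sm (fun h => F h * G (fun x => h (rfx x))) =
      ∑ β ∈ (Sy n).image bd, Sb F β * Sb G β := by
  classical
  have e1 : ∑ β ∈ (Sy n).image bd, Sb F β * Sb G β =
      ∑ p ∈ (Sy n ×ˢ Sy n).filter (fun p => bd p.1 = bd p.2), F p.1 * G p.2 := by
    rw [Finset.sum_filter, Finset.sum_product]
    rw [← Finset.sum_fiberwise_of_maps_to (t := (Sy n).image bd) (g := bd)
      (fun x hx => Finset.mem_image_of_mem _ hx)]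
    refine Finset.sum_congr rfl fun β _ => ?_
    unfold Sb
    rw [Finset.sum_mul]
    refine Finset.sum_congr (by ext; simp) fun s hs => ?_
    rw [Finset.mul_sum, Finset.sum_filter]
    refine Finset.sum_congr rfl fun t _ => ?_
    rw [(Finset.mem_filter.1 hs).2]
    by_cases h : β = bd t
    · simp [h]
    · rw [if_neg h, if_neg (Ne.symm h)]
  rw [e1]
  unfold Sm
  have rin : ∀ x : Vt n, rfx x = x → inH x := by
    intro x hx
    by_contra h
    have := rfx_out hn h
    rw [hx] at this; exact h this
  have symgl : ∀ g : Cfg n, ∀ x, gl g g (rfx x) = gl g g x := by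
    intro g x
    by_cases h1 : inH x <;> by_cases h2 : inH (rfx x)
    · rw [rfx_fix hn h1 h2]
    · rw [gl_on h1, gl_off h2, rfx_rfx]
    · rw [gl_on h2, gl_off h1]
    · exact absurd (rfx_out hn h1) h2
  have hr : ∀ h : Cfg n, IsHom h → IsHom (fun x => h (rfx x)) :=
    fun h hh u v huv => hh _ _ (tadj_rfx _ _ huv)
  have r0 : rfx ((0, 0) : Vt n) = (0, 0) := by simp [rfx]
  refine Finset.sum_nbij' (fun h => (gl h h, gl (fun x => h (rfx x)) (fun x => h (rfx x))))
    (fun p => gl p.1 p.2) ?_ ?_ ?_ ?_ ?_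
  · intro h hh
    rw [mem_Om] at hh
    simp only [Finset.mem_filter, Finset.mem_product, Sy, mem_Om, bd_eq_iff]
    refine ⟨⟨⟨⟨gl_hom hn hh.1 hh.1 fun _ _ => rfl, ?_⟩, symgl _⟩,
      ⟨⟨gl_hom hn (hr h hh.1) (hr h hh.1) fun _ _ => rfl, ?_⟩, symgl _⟩⟩, ?_⟩
    · rw [gl_on inH_zero, hh.2]
    · rw [gl_on inH_zero, r0, hh.2]
    · intro x hx
      rw [gl_on (rin x hx), gl_on (rin x hx), hx]
  · rintro ⟨s, t⟩ hst
    simp only [Finset.mem_filter, Finset.mem_product, Sy, mem_Om, bd_eq_iff] at hst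
    rw [mem_Om]
    exact ⟨gl_hom hn hst.1.1.1.1 hst.1.2.1.1 hst.2, by rw [gl_on inH_zero]; exact hst.1.1.1.2⟩
  · intro h hh
    funext x
    by_cases hx : inH x
    · simp only; rw [gl_on hx, gl_on hx]
    · simp only; rw [gl_off hx, gl_on (rfx_out hn hx), rfx_rfx]
  · rintro ⟨s, t⟩ hst
    simp only [Finset.mem_filter, Finset.mem_product, Sy, mem_Om, bd_eq_iff] at hst
    have hs := hst.1.1.2
    have ht := hst.1.2.2
    simp only [Prod.mk.injEq]
    have key : ∀ x, inH x → gl s t (rfx x) = t x := by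
      intro x hx
      by_cases h2 : inH (rfx x)
      · have := rfx_fix hn hx h2
        rw [gl_on h2, this, hst.2 x this]
      · rw [gl_off h2, rfx_rfx]
    constructor
    · funext x
      by_cases hx : inH x
      · rw [gl_on hx, gl_on hx]
      · rw [gl_off hx, gl_on (rfx_out hn hx), hs]
    · funext x
      by_cases hx : inH x
      · rw [gl_on hx, key x hx]
      · rw [gl_off hx, key _ (rfx_out hn hx), ht]
  · intro h hh
    congr 1
    · exact hF _ _ fun x hx => (gl_on hx).symm
    · exact hG _ _ fun x hx => (gl_on (h1 := fun x => h (rfx x)) (h2 := fun x => h (rfx x)) hx).symm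

lemma rp_nonneg (hn : Even n) (F : Cfg n → ℝ) (hF : DepH F) :
    0 ≤ Sm (fun h => F h * F (fun x => h (rfx x))) := by
  rw [rp_eq hn F F hF hF]
  exact Finset.sum_nonneg fun β _ => mul_self_nonneg _

lemma rp_cs (hn : Even n) (F G : Cfg n → ℝ) (hF : DepH F) (hG : DepH G) :
    (Sm (fun h => F h * G (fun x => h (rfx x)))) ^ 2 ≤
      Sm (fun h => F h * F (fun x => h (rfx x))) * Sm (fun h => G h * G (fun x => h (rfx x))) := by
  rw [rp_eq hn F F hF hF, rp_eq hn G G hG hG, rp_eq hn F G hF hG]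
  simp only [← sq]
  exact Finset.sum_mul_sq_le_sq_mul_sq _ _ _

lemma rp_one (hn : Even n) (F : Cfg n → ℝ) (hF : DepH F) :
    (Sm F) ^ 2 ≤ Nn n * Sm (fun h => F h * F (fun x => h (rfx x))) := by
  have := rp_cs hn F (fun _ => 1) hF (fun _ _ _ => rfl)
  simp only [mul_one, Sm_const] at this
  linarith
end rp

/-! ### Exponential tail of patterns -/

lemma dbl (m : ℕ) (q : ℕ → ℝ) (Q : ℝ) (h0 : ∀ L, 0 ≤ q L) (hQ0 : 0 ≤ Q) (hQ1 : Q ≤ 1)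
    (hd : ∀ L, 1 ≤ L → L ≤ m → q L ^ 2 ≤ q (min (2 * L) m)) (hm : q m ^ 2 ≤ Q) :
    ∀ L, 1 ≤ L → L ≤ m → q L ^ (4 * m) ≤ Q ^ L := by
  suffices H : ∀ j L, m - L ≤ j → 1 ≤ L → L ≤ m → q L ^ (4 * m) ≤ Q ^ L from
    fun L h1 h2 => H _ L le_rfl h1 h2
  intro j
  induction j with
  | zero =>
    intro L hj h1 h2
    obtain rfl : L = m := by omega
    calc q L ^ (4 * L) = ((q L ^ 2) ^ 2) ^ L := by rw [← pow_mul, ← pow_mul]; congr 1; ring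
      _ ≤ (Q ^ 2) ^ L := by gcongr; 
      _ ≤ Q ^ L := by gcongr; nlinarith
  | succ j ih =>
    intro L hj h1 h2
    rcases le_total (2 * L) m with h3 | h3
    · have e := hd L h1 h2
      rw [min_eq_left h3] at e
      have := ih (2 * L) (by omega) (by omega) h3
      have e2 : (q L ^ (4 * m)) ^ 2 ≤ (Q ^ L) ^ 2 := by
        calc (q L ^ (4 * m)) ^ 2 = (q L ^ 2) ^ (4 * m) := by rw [← pow_mul, ← pow_mul]; ring_nf
          _ ≤ (q (2 * L)) ^ (4 * m) := by gcongr
          _ ≤ _ := this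
          _ = _ := by rw [← pow_mul]; ring_nf
      exact (pow_le_pow_iff_left₀ (by have := h0 L; positivity) (by positivity) two_ne_zero).1 e2
    · have e := hd L h1 h2
      rw [min_eq_right h3] at e
      calc q L ^ (4 * m) = ((q L ^ 2) ^ 2) ^ m := by rw [← pow_mul, ← pow_mul]; congr 1; ring
        _ ≤ ((q m) ^ 2) ^ m := by gcongr
        _ ≤ Q ^ m := by gcongr
        _ ≤ Q ^ L := pow_le_pow_of_le_one hQ0 hQ1 h2

section tail
variable {n : ℕ} [NeZero n]

lemma Nn_pos' (hne : (Om n).Nonempty) : 0 < Nn n := by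
  unfold Nn; exact_mod_cast hne.card_pos

/-- parity of a site -/
noncomputable def par (hn : 2 ∣ n) (x : Vt n) : ZMod 2 := ZMod.castHom hn (ZMod 2) (x.1 + x.2)

lemma par_adj (hn : 2 ∣ n) {u v : Vt n} (h : TAdj n u v) : par hn v = par hn u + 1 := by
  unfold par
  have two : (1 : ZMod 2) + 1 = 0 := by decide
  rcases h with ⟨h1, h2 | h2⟩ | ⟨h1, h2 | h2⟩ <;> simp only [h1, h2, map_add, map_one] <;>
    (try linear_combination (-1 : ZMod 2) * two) <;> ring_nf

open Classical in
noncomputable def flat (hn : 2 ∣ n) (S : Finset (Vt n)) : Cfg n := fun x =>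
  if par hn x = 0 then 0 else if x ∈ S then 1 else -1

open Classical in
noncomputable def odds (hn : 2 ∣ n) : Finset (Vt n) := Finset.univ.filter fun x => par hn x ≠ 0

lemma flat_mem (hn : 2 ∣ n) (S : Finset (Vt n)) : flat hn S ∈ Om n := by
  rw [mem_Om]
  constructor
  · intro u v huv
    have := par_adj hn huv
    unfold flat
    have hz : ∀ a : ZMod 2, a = 0 ∨ a = 1 := by decide
    rcases hz (par hn u) with h | h
    · rw [h] at this
      rw [if_pos h, if_neg (by rw [this]; decide)]
      split_ifs <;> norm_num
    · rw [h] at this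
      rw [if_neg (show ¬ par hn u = 0 by rw [h]; decide), if_pos (show par hn v = 0 by rw [this]; decide)]
      split_ifs <;> norm_num
  · simp [flat, par]

lemma card_odds (hn : 2 ∣ n) : 2 * (odds hn).card = n ^ 2 := by
  classical
  have h1 : (odds hn).card = ((odds hn)ᶜ).card := by
    refine Finset.card_bij' (fun x _ => x + (1, 0)) (fun x _ => x - (1, 0)) ?_ ?_ ?_ ?_
    · intro x hx
      have hp : par hn (x + (1, 0)) = par hn x + 1 := par_adj hn (by simp [TAdj])
      simp only [odds, Finset.mem_filter, Finset.mem_univ, true_and, Finset.mem_compl, not_not] at *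
      rw [hp]
      have hz : ∀ a : ZMod 2, a ≠ 0 → a + 1 = 0 := by decide
      exact hz _ hx
    · intro x hx
      have hp : par hn (x - (1, 0)) = par hn x + 1 := par_adj hn (by simp [TAdj])
      simp only [odds, Finset.mem_filter, Finset.mem_univ, true_and, Finset.mem_compl, not_not] at *
      rw [hp, hx]; decide
    · intros; simp
    · intros; simp
  have h2 := Finset.card_add_card_compl (odds hn)
  have h3 : Fintype.card (Vt n) = n ^ 2 := by simp [ZMod.card]; ring
  omega

lemma Nn_lower (hn : 2 ∣ n) : (2 : ℝ) ^ (odds hn).card ≤ Nn n := by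
  classical
  unfold Nn
  have : (odds hn).powerset.card ≤ (Om n).card := by
    refine Finset.card_le_card_of_injOn (flat hn) (fun S _ => flat_mem hn S) ?_
    intro S hS T hT h
    simp only [Finset.coe_powerset, Set.mem_preimage, Set.mem_powerset_iff, Finset.coe_subset] at hS hT
    ext x
    by_cases hx : par hn x = 0
    · have : x ∉ odds hn := by simp [odds, hx]
      exact ⟨fun h => absurd (hS h) this, fun h => absurd (hT h) this⟩
    · have := congrFun h x
      simp only [flat, hx, if_false] at this
      by_cases h1 : x ∈ S <;> by_cases h2 : x ∈ T <;> simp [h1, h2] at this ⊢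
  rw [Finset.card_powerset] at this
  exact_mod_cast this

lemma Nn_pos (hn : Even n) : 0 < Nn n :=
  lt_of_lt_of_le (by positivity) (Nn_lower hn.two_dvd)

/-- events -/
def E1 (L : ℕ) (σ : ℕ → ℤ) (h : Cfg n) : Prop := ∀ i : ℕ, i ≤ L → ∀ r : ZMod n, r = 0 ∨ r = 1 →
  h ((i : ZMod n), r) - h (0, r) = σ i
def E2 (M : ℕ) (τ : ZMod n → ℤ) (h : Cfg n) : Prop := ∀ r : ℕ, r ≤ M → ∀ i : ZMod n,
  h ((r : ZMod n), i) - h ((r : ZMod n), 0) = τ i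

noncomputable def Pr (E : Cfg n → Prop) : ℝ := Sm (fun h => ind (E h)) / Nn n

lemma Pr_nonneg (E : Cfg n → Prop) : 0 ≤ Pr E :=
  div_nonneg (Sm_nonneg fun _ _ => ind_nonneg _) (by unfold Nn; positivity)

lemma Pr_le_one (E : Cfg n → Prop) : Pr E ≤ 1 := by
  refine div_le_one_of_le₀ ?_ (by unfold Nn; positivity)
  calc Sm (fun h => ind (E h)) ≤ Sm (fun _ => 1) := Sm_mono fun _ _ => ind_le_one _
    _ = Nn n := by rw [Sm_const, mul_one]

lemma Pr_mono {E E' : Cfg n → Prop} (H : ∀ h ∈ Om n, E h → E' h) : Pr E ≤ Pr E' := by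
  unfold Pr
  have : 0 ≤ Nn n := by unfold Nn; positivity
  gcongr
  exact Sm_mono fun h hh => ind_mono (H h hh)

lemma Pr_rp (hn : Even n) (E E' : Cfg n → Prop) (hE : ∀ h h', (∀ x, inH x → h x = h' x) → (E h ↔ E h'))
    (H : ∀ h ∈ Om n, E h → E (fun x => h (rfx x)) → E' h) : Pr E ^ 2 ≤ Pr E' := by
  have h1 := rp_one hn (fun h => ind (E h)) (fun h h' hh => ind_congr (hE h h' hh))
  have h2 : Sm (fun h => ind (E h) * ind (E (fun x => h (rfx x)))) ≤ Sm (fun h => ind (E' h)) := by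
    refine Sm_mono fun h hh => ?_
    rw [ind_mul]; exact ind_mono fun H2 => H h hh H2.1 H2.2
  have hN := Nn_pos hn
  unfold Pr
  rw [div_pow, div_le_div_iff₀ (by positivity) hN]
  nlinarith [mul_le_mul_of_nonneg_left h2 hN.le]

lemma Pr_trans (a : Vt n) (E : Cfg n → Prop) (hE : ∀ h (c : ℤ), E (fun x => h x + c) ↔ E h) :
    Pr (fun h => E (fun x => h (x + a))) = Pr E := by
  unfold Pr
  rw [Sm_trans a (fun h => ind (E h)) (fun h c => ind_congr (hE h c))]

lemma sup_sq_le {ι : Type*} [Nonempty ι] (f : ι → ℝ) (X : ℝ) (h0 : ∀ i, 0 ≤ f i)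
    (h : ∀ i, f i ^ 2 ≤ X) : (⨆ i, f i) ^ 2 ≤ X := by
  obtain ⟨i⟩ := ‹Nonempty ι›
  have hX : 0 ≤ X := le_trans (sq_nonneg _) (h i)
  have : (⨆ i, f i) ≤ Real.sqrt X := by
    haveI : Nonempty ι := ⟨i⟩
    exact ciSup_le fun j => Real.le_sqrt_of_sq_le (h j)
  calc (⨆ i, f i) ^ 2 ≤ Real.sqrt X ^ 2 := by
        have := Real.iSup_nonneg h0
        gcongr
    _ = X := Real.sq_sqrt hX

noncomputable def q1 (n : ℕ) [NeZero n] (L : ℕ) : ℝ := ⨆ σ : ℕ → ℤ, Pr (n := n) (E1 L σ)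
noncomputable def q2 (n : ℕ) [NeZero n] (L : ℕ) : ℝ := ⨆ τ : ZMod n → ℤ, Pr (n := n) (E2 L τ)

lemma le_q1 (L : ℕ) (σ : ℕ → ℤ) : Pr (n := n) (E1 L σ) ≤ q1 n L :=
  le_ciSup (f := fun σ : ℕ → ℤ => Pr (n := n) (E1 L σ)) ⟨1, by rintro _ ⟨σ, rfl⟩; exact Pr_le_one _⟩ σ
lemma le_q2 (L : ℕ) (σ : ZMod n → ℤ) : Pr (n := n) (E2 L σ) ≤ q2 n L :=
  le_ciSup (f := fun σ : ZMod n → ℤ => Pr (n := n) (E2 L σ))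
    ⟨1, by rintro _ ⟨σ, rfl⟩; exact Pr_le_one _⟩ σ

lemma E1_addc (L : ℕ) (σ : ℕ → ℤ) (h : Cfg n) (c : ℤ) : E1 L σ (fun x => h x + c) ↔ E1 L σ h := by
  simp [E1]
lemma E2_addc (L : ℕ) (σ : ZMod n → ℤ) (h : Cfg n) (c : ℤ) :
    E2 L σ (fun x => h x + c) ↔ E2 L σ h := by
  simp [E2]

lemma val_le_half {i m : ℕ} (hm : n = m + m) (hi : i ≤ m) : ((i : ZMod n)).val ≤ n / 2 := by
  have := ZMod.val_natCast_of_lt (n := n) (a := i) (by have := NeZero.pos n; omega)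
  omega

lemma E1_dep {m : ℕ} (hm : n = m + m) {L : ℕ} (hL : L ≤ m) (σ : ℕ → ℤ) (h h' : Cfg n)
    (H : ∀ x, inH x → h x = h' x) : E1 L σ h ↔ E1 L σ h' := by
  unfold E1
  refine forall_congr' fun i => forall_congr' fun hi => forall_congr' fun r => ?_
  rw [H (_, r) (val_le_half hm (hi.trans hL)), H (0, r) (by simp [inH])]
lemma E2_dep {m : ℕ} (hm : n = m + m) {L : ℕ} (hL : L ≤ m) (σ : ZMod n → ℤ) (h h' : Cfg n)
    (H : ∀ x, inH x → h x = h' x) : E2 L σ h ↔ E2 L σ h' := by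
  unfold E2
  refine forall_congr' fun i => forall_congr' fun hi => forall_congr' fun r => ?_
  rw [H (_, r) (val_le_half hm (hi.trans hL)), H (_, 0) (val_le_half hm (hi.trans hL))]

lemma cast_sub_case (i L : ℕ) : (∃ j : ℕ, j ≤ L ∧ ((i : ZMod n) - L = j) ∧ i ≤ 2 * L) ∨
    (∃ j : ℕ, j ≤ L ∧ ((i : ZMod n) - L = -(j : ZMod n))) ∨ 2 * L < i := by
  rcases Nat.lt_or_ge (2 * L) i with h | h
  · exact Or.inr (Or.inr h)
  rcases le_total i L with h1 | h1
  · right; left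
    exact ⟨L - i, by omega, by rw [Nat.cast_sub h1]; ring⟩
  · left
    exact ⟨i - L, by omega, by rw [Nat.cast_sub h1], h⟩

lemma q1_dbl {m : ℕ} (hm : n = m + m) (L : ℕ) (hL : L ≤ m) : q1 n L ^ 2 ≤ q1 n (min (2 * L) m) := by
  refine sup_sq_le _ _ (fun _ => Pr_nonneg _) fun σ => ?_
  refine le_trans ?_ (le_q1 _ (fun i => σ (if i ≤ L then L - i else i - L) - σ L))
  have hn : Even n := ⟨m, hm⟩
  rw [← Pr_trans (-((L : ℕ) : ZMod n), 0) (E1 (min (2 * L) m)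
    (fun i => σ (if i ≤ L then L - i else i - L) - σ L)) (E1_addc _ _)]
  refine Pr_rp (n := n) hn (E1 L σ) _ (fun h h' H => E1_dep hm hL σ h h' H) ?_
  · intro h hh h1 h2 i hi r hr
    have hi2 : i ≤ 2 * L := le_trans hi (min_le_left _ _)
    simp only [E1, rfx] at h1 h2
    have a2 := h2 L le_rfl r hr
    simp only [Prod.mk_add_mk, add_zero, zero_add, neg_zero] at a2 ⊢
    split_ifs with hc
    · have := h2 (L - i) (by omega) r hr
      rw [Nat.cast_sub hc] at this
      simp only [neg_sub, neg_zero] at this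
      rw [← sub_eq_add_neg]; linarith
    · have := h1 (i - L) (by omega) r hr
      rw [Nat.cast_sub (by omega)] at this
      rw [← sub_eq_add_neg]; linarith

lemma q2_dbl {m : ℕ} (hm : n = m + m) (L : ℕ) (hL : L ≤ m) : q2 n L ^ 2 ≤ q2 n (min (2 * L) m) := by
  refine sup_sq_le _ _ (fun _ => Pr_nonneg _) fun σ => ?_
  refine le_trans ?_ (le_q2 _ σ)
  have hn : Even n := ⟨m, hm⟩
  rw [← Pr_trans (-((L : ℕ) : ZMod n), 0) (E2 (min (2 * L) m) σ) (E2_addc _ _)]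
  refine Pr_rp (n := n) hn (E2 L σ) _ (fun h h' H => E2_dep hm hL σ h h' H) ?_
  intro h hh h1 h2 i hi r
  have hi2 : i ≤ 2 * L := le_trans hi (min_le_left _ _)
  simp only [E2, rfx] at h1 h2
  simp only [Prod.mk_add_mk, add_zero]
  rcases le_total i L with hc | hc
  · have := h2 (L - i) (by omega) r
    rw [Nat.cast_sub hc] at this
    simp only [neg_sub] at this
    rw [← sub_eq_add_neg]; linarith
  · have := h1 (i - L) (by omega) r
    rw [Nat.cast_sub (by omega)] at this
    rw [← sub_eq_add_neg]; linarith

lemma zmod_half {m : ℕ} (hm : n = m + m) (i : ZMod n) :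
    (∃ j : ℕ, j ≤ m ∧ i = j) ∨ ∃ j : ℕ, j ≤ m ∧ i = -(j : ZMod n) := by
  have hi := ZMod.val_lt i
  rcases le_total i.val m with h | h
  · exact Or.inl ⟨i.val, h, by simp⟩
  · exact Or.inr ⟨n - i.val, by omega, by rw [Nat.cast_sub hi.le]; simp⟩

lemma q1_full {m : ℕ} (hm : n = m + m) : q1 n m ^ 2 ≤ q2 n 1 := by
  have hn : Even n := ⟨m, hm⟩
  refine sup_sq_le _ _ (fun _ => Pr_nonneg _) fun σ => ?_
  refine le_trans ?_ (le_q2 1 (fun i => σ (if i.val ≤ m then i.val else n - i.val)))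
  have e : Pr (E2 (n := n) 1 (fun i => σ (if i.val ≤ m then i.val else n - i.val))) =
      Pr (fun h : Cfg n => E2 (n := n) 1 (fun i => σ (if i.val ≤ m then i.val else n - i.val))
        (fun x => h (swp x))) := by
    unfold Pr
    rw [Sm_swp (fun h => ind (E2 1 _ h)) (fun h c => ind_congr (E2_addc _ _ _ _))]
  rw [e]
  refine Pr_rp hn _ _ (fun h h' H => E1_dep hm le_rfl σ h h' H) ?_
  intro h hh h1 h2 r hr i
  simp only [swp]
  have hr' : (r : ZMod n) = 0 ∨ (r : ZMod n) = 1 := by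
    interval_cases r <;> simp
  have hi := ZMod.val_lt i
  simp only [E1, rfx] at h1 h2
  split_ifs with hc
  · have := h1 i.val hc _ hr'
    simpa using this
  · have := h2 (n - i.val) (by omega) _ hr'
    rw [Nat.cast_sub hi.le] at this
    simpa using this

lemma q2_full {m : ℕ} (hm : n = m + m) : q2 n m ^ 2 ≤ 2 ^ n / Nn n := by
  classical
  have hn : Even n := ⟨m, hm⟩
  refine sup_sq_le _ _ (fun _ => Pr_nonneg _) fun τ => ?_
  have k1 : Pr (E2 (n := n) m τ) ^ 2 ≤ Pr (fun h : Cfg n => ∀ r i : ZMod n, h (r, i) - h (r, 0) = τ i) := by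
    refine Pr_rp hn _ _ (fun h h' H => E2_dep hm le_rfl τ h h' H) ?_
    intro h hh h1 h2 r i
    simp only [E2, rfx] at h1 h2
    rcases zmod_half hm r with ⟨j, hj, rfl⟩ | ⟨j, hj, rfl⟩
    · exact h1 j hj i
    · exact h2 j hj i
  refine k1.trans ?_
  unfold Pr
  have hN := Nn_pos hn
  gcongr
  have e : Sm (fun h : Cfg n => ind (∀ r i : ZMod n, h (r, i) - h (r, 0) = τ i)) =
      (((Om n).filter fun h : Cfg n => ∀ r i : ZMod n, h (r, i) - h (r, 0) = τ i).card : ℝ) := by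
    unfold Sm ind
    rw [Finset.card_filter]; push_cast
    exact Finset.sum_congr rfl fun h _ => by congr
  rw [e]
  have : ((Om n).filter fun h : Cfg n => ∀ r i : ZMod n, h (r, i) - h (r, 0) = τ i).card ≤
      (Finset.univ : Finset (ZMod n → Bool)).card := by
    refine Finset.card_le_card_of_injOn (fun h r => decide (h (r + 1, 0) = h (r, 0) + 1))
      (fun _ _ => Finset.mem_coe.2 (Finset.mem_univ _)) ?_
    intro h hh h' hh' H
    simp only [Finset.coe_filter, Set.mem_setOf_eq, mem_Om] at hh hh'
    have base : ∀ r : ℕ, h ((r : ZMod n), 0) = h' ((r : ZMod n), 0) := by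
      intro r
      induction r with
      | zero => have a := hh.1.2; have b := hh'.1.2; simp only [Nat.cast_zero]; rw [a, b]
      | succ r ih =>
        have a := hh.1.1.abs_step (frame_dir n (true, true)) ((r : ZMod n), 0)
        have b := hh'.1.1.abs_step (frame_dir n (true, true)) ((r : ZMod n), 0)
        simp only [dv, ax, if_true, Prod.mk_add_mk, add_zero] at a b
        have c := congrFun H (r : ZMod n)
        simp only [decide_eq_decide] at c
        push_cast
        by_cases hc : h ((r : ZMod n) + 1, 0) = h ((r : ZMod n), 0) + 1
        · rw [hc, c.1 hc, ih]
        · have hc' := fun hx => hc (c.2 hx)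
          omega
    funext x
    rcases x with ⟨r, i⟩
    have a := hh.2 r i
    have b := hh'.2 r i
    have c := base r.val
    simp only [ZMod.natCast_val, ZMod.cast_id', id_eq] at c
    linarith
  have c2 : (Finset.univ : Finset (ZMod n → Bool)).card = 2 ^ n := by
    simp [ZMod.card]
  rw [c2] at this
  exact_mod_cast this

lemma q1_bound (hn : Even n) (h4 : 4 ≤ n) (L : ℕ) (hL : L ≤ n / 2) : q1 n L ^ 16 ≤ (1 / 2) ^ L := by
  obtain ⟨m, hm⟩ := hn
  have hN := Nn_pos (n := n) ⟨m, hm⟩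
  have q1n : ∀ L, 0 ≤ q1 n L := fun L => Real.iSup_nonneg fun _ => Pr_nonneg _
  have q2n : ∀ L, 0 ≤ q2 n L := fun L => Real.iSup_nonneg fun _ => Pr_nonneg _
  have q1l : ∀ L, q1 n L ≤ 1 := fun L => ciSup_le fun _ => Pr_le_one _
  have q2l : ∀ L, q2 n L ≤ 1 := fun L => ciSup_le fun _ => Pr_le_one _
  rcases Nat.eq_zero_or_pos L with rfl | hpos
  · simpa using pow_le_one₀ (q1n 0) (q1l 0)
  have hd : 2 ∣ n := ⟨m, by omega⟩
  have hodd : (odds hd).card = 2 * m ^ 2 := by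
    have := card_odds hd
    have : n ^ 2 = 4 * m ^ 2 := by rw [hm]; ring
    omega
  have hlow := Nn_lower hd
  rw [hodd] at hlow
  have hm2 : 2 ≤ m := by omega
  have hQ1 : (2 : ℝ) ^ n / Nn n ≤ (1 / 2) ^ (m ^ 2) := by
    rw [div_le_iff₀ hN]
    calc (2 : ℝ) ^ n ≤ 2 ^ (m ^ 2) := by
          apply pow_le_pow_right₀ (by norm_num); nlinarith
      _ = (1 / 2) ^ (m ^ 2) * 2 ^ (2 * m ^ 2) := by
          rw [two_mul, pow_add, ← mul_assoc, ← mul_pow]; norm_num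
      _ ≤ _ := by gcongr
  have hQ0 : 0 ≤ (2 : ℝ) ^ n / Nn n := by positivity
  have hh1 : ((1 : ℝ) / 2) ^ (m ^ 2) ≤ 1 := pow_le_one₀ (by norm_num) (by norm_num)
  have s2 := dbl m (q2 n) _ q2n hQ0 (hQ1.trans hh1) (fun L _ h => q2_dbl hm L h) (q2_full hm) 1
    le_rfl (by omega)
  have s1 := dbl m (q1 n) _ q1n (q2n 1) (q2l 1) (fun L _ h => q1_dbl hm L h) (q1_full hm) L hpos
    (by omega)
  rw [pow_one] at s2
  have s3 : (q1 n L ^ 16) ^ (m ^ 2) ≤ ((1 / 2) ^ L) ^ (m ^ 2) := by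
    calc (q1 n L ^ 16) ^ (m ^ 2) = (q1 n L ^ (4 * m)) ^ (4 * m) := by
          rw [← pow_mul, ← pow_mul]; ring_nf
      _ ≤ (q2 n 1 ^ L) ^ (4 * m) := by have := q1n L; gcongr
      _ = (q2 n 1 ^ (4 * m)) ^ L := by rw [← pow_mul, ← pow_mul, mul_comm]
      _ ≤ ((1 / 2) ^ (m ^ 2)) ^ L := by
          have := q2n 1
          gcongr; exact s2.trans hQ1
      _ = _ := by rw [← pow_mul, ← pow_mul, mul_comm]
  have := q1n L
  exact (pow_le_pow_iff_left₀ (by positivity) (by positivity) (by positivity)).1 s3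

end tail

noncomputable def rho : ℝ := (1 / 2 : ℝ) ^ (1 / 64 : ℝ)
lemma rho_pos : 0 < rho := by unfold rho; positivity
lemma rho_pow : rho ^ 64 = 1 / 2 := by
  unfold rho
  rw [← Real.rpow_natCast, ← Real.rpow_mul (by norm_num)]; norm_num
lemma rho_lt : rho < 1 := by
  unfold rho; exact Real.rpow_lt_one (by norm_num) (by norm_num) (by norm_num)

section tail2
variable {n : ℕ} [NeZero n]

lemma pat_aut (σ : Vt n →+ Vt n) (h : Cfg n) (p d q : Vt n) (k : ℕ) :
    Pat (fun x => h (σ x)) p d q k ↔ Pat h (σ p) (σ d) (σ q) k := by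
  unfold Pat; simp only [map_add, map_sub, map_nsmul]

def rfxH (n : ℕ) : Vt n →+ Vt n where
  toFun := rfx
  map_zero' := by simp [rfx]
  map_add' := by intro x y; simp [rfx]; ring
def swpH (n : ℕ) : Vt n →+ Vt n where
  toFun := swp
  map_zero' := by simp [swp]
  map_add' := by intro x y; simp [swp]

lemma Pr_pat_trans (p d q : Vt n) (k : ℕ) :
    Pr (fun h : Cfg n => Pat h p d q k) = Pr (fun h : Cfg n => Pat h 0 d q k) := by
  rw [← Pr_trans p (fun h => Pat h 0 d q k) (fun h c => pat_addc _ _ _ _ _ _)]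
  simp only [pat_trans, zero_add]

lemma Pr_pat_rfx (d q : Vt n) (k : ℕ) :
    Pr (fun h : Cfg n => Pat h 0 (rfx d) (rfx q) k) = Pr (fun h : Cfg n => Pat h 0 d q k) := by
  unfold Pr
  rw [← Sm_rfx (fun h => ind (Pat h 0 d q k)) (shInv_ind_pat _ _ _ _)]
  congr 1; refine Sm_congr fun h _ => ?_
  have := pat_aut (rfxH n) h 0 d q k
  rw [map_zero] at this
  exact ind_congr this.symm
lemma Pr_pat_swp (d q : Vt n) (k : ℕ) :
    Pr (fun h : Cfg n => Pat h 0 (swp d) (swp q) k) = Pr (fun h : Cfg n => Pat h 0 d q k) := by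
  unfold Pr
  have e := Sm_swp (fun h => ind (Pat h 0 d q k)) (shInv_ind_pat _ _ _ _)
  have e2 : Sm (fun h : Cfg n => ind (Pat h 0 (swp d) (swp q) k)) =
      Sm (fun h : Cfg n => ind (Pat (fun x => h (swp x)) 0 d q k)) := by
    refine Sm_congr fun h _ => ?_
    have := pat_aut (swpH n) h 0 d q k
    rw [map_zero] at this
    exact ind_congr this.symm
  rw [e2, e]

lemma Pr_pat_base (p : Vt n) (δ : Dir) (k : ℕ) :
    Pr (fun h : Cfg n => Pat h p (dv n δ) (qv n δ) k) =
      Pr (fun h : Cfg n => Pat h 0 ((1, 0) : Vt n) ((0, 1) : Vt n) k) := by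
  rw [Pr_pat_trans]
  have e1 := Pr_pat_rfx (n := n) (1, 0) (0, 1) k
  have e2 := Pr_pat_swp (n := n) (1, 0) (0, 1) k
  have e3 := Pr_pat_swp (n := n) (-1, 0) (0, 1) k
  rcases δ with ⟨a, s⟩
  cases a <;> cases s <;> simp [dv, qv, ax, rfx, swp] at * <;> simp_all

lemma pat_tail' (hn : Even n) (h4 : 4 ≤ n) (k : ℕ) :
    Pr (fun h : Cfg n => Pat h 0 ((1, 0) : Vt n) ((0, 1) : Vt n) k) ≤ 2 * rho ^ (2 * k) := by
  have hr := rho_pos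
  set P := Pr (fun h : Cfg n => Pat h 0 ((1, 0) : Vt n) ((0, 1) : Vt n) k) with hP
  have hP0 : 0 ≤ P := Pr_nonneg _
  have hP1 : P ≤ 1 := Pr_le_one _
  rcases Nat.lt_or_ge n (k + 2) with hk | hk
  · have : P = 0 := by
      rw [hP]; unfold Pr
      have : (fun h : Cfg n => ind (Pat h 0 ((1, 0) : Vt n) ((0, 1) : Vt n) k)) = fun _ => 0 := by
        funext h; exact ind_false (pat_large (by omega))
      rw [this]; simp [Sm]
    rw [this]; positivity
  have main : P ^ 32 ≤ 2 * (1 / 2) ^ k := by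
    rcases Nat.lt_or_ge k 2 with hk1 | hk1
    · have : P ^ 32 ≤ 1 := pow_le_one₀ hP0 hP1
      interval_cases k <;> norm_num <;> linarith
    · obtain ⟨m, hm⟩ := id hn
      set L := min (k - 1) m with hL
      have h1 := q1_bound hn h4 L (by omega)
      have h2 : P ≤ q1 n L := by
        refine le_trans ?_ (le_q1 L (fun i => (i : ℤ)))
        rw [← Pr_trans (1, 0) (E1 L (fun i => (i : ℤ))) (E1_addc _ _)]
        refine Pr_mono fun h hh hp => ?_
        intro i hi r hr
        have hi' : i ≤ k - 1 := by omega
        simp only [Prod.mk_add_mk, add_zero, zero_add]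
        rcases hr with rfl | rfl
        · have a := hp.1 (i + 1) (by omega)
          have b := hp.1 1 (by omega)
          simp at a b
          rw [a, b]; ring
        · have a := (hp.2 (i + 1) (by omega) (by omega)).1
          have b := (hp.2 1 (by omega) (by omega)).1
          simp at a b
          rw [a, b]; ring
      calc P ^ 32 = (P ^ 16) ^ 2 := by rw [← pow_mul]
        _ ≤ (q1 n L ^ 16) ^ 2 := by gcongr
        _ ≤ ((1 / 2) ^ L) ^ 2 := by have := hP0.trans h2; gcongr
        _ = (1 / 2) ^ (L * 2) := by rw [← pow_mul]
        _ ≤ (1 / 2) ^ (k - 1) := by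
            apply pow_le_pow_of_le_one (by norm_num) (by norm_num); omega
        _ = 2 * (1 / 2) ^ k := by
            obtain ⟨j, rfl⟩ : ∃ j, k = j + 1 := ⟨k - 1, by omega⟩
            simp [pow_succ]; ring
  have : P ^ 32 ≤ (2 * rho ^ (2 * k)) ^ 32 := by
    refine main.trans ?_
    rw [mul_pow, ← pow_mul, show 2 * k * 32 = 64 * k by ring, pow_mul, rho_pow]
    gcongr; norm_num
  exact (pow_le_pow_iff_left₀ hP0 (by positivity) (by norm_num)).1 this

lemma pat_tail (hn : Even n) (h4 : 4 ≤ n) (p : Vt n) (δ : Dir) (k : ℕ) :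
    Sm (fun h : Cfg n => ind (Pat h p (dv n δ) (qv n δ) k)) ≤ 2 * rho ^ (2 * k) * Nn n := by
  have := pat_tail' hn h4 k
  rw [← Pr_pat_base p δ k] at this
  unfold Pr at this
  rwa [div_le_iff₀ (Nn_pos hn)] at this

lemma Uu_tail (hn : Even n) (h4 : 4 ≤ n) (p : Vt n) (δ : Dir) (k : ℕ) :
    Sm (fun h : Cfg n => Uu h p δ k) ≤ 2 * rho ^ (2 * k) * Nn n :=
  le_trans (Sm_mono fun h _ => ind_mono fun H => H.2) (pat_tail hn h4 p δ k)
end tail2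

/-! ### FKG on fibres -/
section fkgsec
variable {n : ℕ} [NeZero n]

open Classical in
noncomputable def fib (c : ZMod n → ℤ) : Finset (Cfg n) := (Om n).filter fun h => ∀ y, h (0, y) = c y

noncomputable def Sc (c : ZMod n → ℤ) (F : Cfg n → ℝ) : ℝ := ∑ h ∈ fib c, F h
noncomputable def Nc (c : ZMod n → ℤ) : ℝ := ((fib c).card : ℝ)

lemma Sc_add (c : ZMod n → ℤ) (F G : Cfg n → ℝ) : Sc c (fun h => F h + G h) = Sc c F + Sc c G :=
  Finset.sum_add_distrib
lemma Sc_sub (c : ZMod n → ℤ) (F G : Cfg n → ℝ) : Sc c (fun h => F h - G h) = Sc c F - Sc c G :=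
  Finset.sum_sub_distrib _ _
lemma Sc_mul_left (c : ZMod n → ℤ) (a : ℝ) (F : Cfg n → ℝ) : Sc c (fun h => a * F h) = a * Sc c F :=
  (Finset.mul_sum _ _ _).symm
lemma Sc_sum (c : ZMod n → ℤ) {ι : Type*} (s : Finset ι) (F : ι → Cfg n → ℝ) :
    Sc c (fun h => ∑ i ∈ s, F i h) = ∑ i ∈ s, Sc c (F i) := Finset.sum_comm
lemma Sc_const (c : ZMod n → ℤ) (a : ℝ) : Sc c (fun _ => a) = Nc c * a := by simp [Sc, Nc]

noncomputable def indc (c : ZMod n → ℤ) (h : Cfg n) : ℝ := ind (∀ y, h (0, y) - h (0, 0) = c y)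

lemma shInv_indc (c : ZMod n → ℤ) : ShInv (indc c) := by
  intro h a; exact ind_congr (by simp)

lemma Sc_eq (c : ZMod n → ℤ) (F : Cfg n → ℝ) : Sc c F = Sm (fun h => indc c h * F h) := by
  unfold Sc fib Sm
  rw [Finset.sum_filter]
  refine Finset.sum_congr rfl fun h hh => ?_
  have := (mem_Om.1 hh).2
  unfold indc ind
  simp only [this, sub_zero]
  split_ifs <;> simp

open Classical in
noncomputable def cols (n : ℕ) [NeZero n] : Finset (ZMod n → ℤ) := (Om n).image fun h y => h (0, y)

lemma Sm_disint (F : Cfg n → ℝ) : Sm F = ∑ c ∈ cols n, Sc c F := by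
  classical
  unfold Sm cols Sc fib
  rw [← Finset.sum_fiberwise_of_maps_to (t := (Om n).image fun h y => h (0, y))
    (g := fun h y => h (0, y)) (fun x hx => Finset.mem_image_of_mem _ hx)]
  refine Finset.sum_congr rfl fun c _ => Finset.sum_congr ?_ fun _ _ => rfl
  ext h; simp [funext_iff]

lemma parity_eq {h h' : Cfg n} (hh : h ∈ Om n) (hh' : h' ∈ Om n) (x : Vt n) : (2 : ℤ) ∣ h x - h' x := by
  rw [mem_Om] at hh hh'
  have a := (isHom_nat hh.1 x.1.val x.2.val).2
  have b := (isHom_nat hh'.1 x.1.val x.2.val).2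
  simp only [ZMod.natCast_val, ZMod.cast_id', id_eq, Prod.mk.eta] at a b
  rw [hh.2] at a; rw [hh'.2] at b
  omega

lemma sup_mem {c : ZMod n → ℤ} {h h' : Cfg n} (hh : h ∈ fib c) (hh' : h' ∈ fib c) : h ⊔ h' ∈ fib c := by
  simp only [fib, Finset.mem_filter] at *
  refine ⟨mem_Om.2 ⟨?_, ?_⟩, ?_⟩
  · intro u v huv
    have a := (mem_Om.1 hh.1).1 u v huv
    have b := (mem_Om.1 hh'.1).1 u v huv
    have p := parity_eq hh.1 hh'.1 u
    simp only [Pi.sup_apply, max_def]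
    rw [abs_eq (by norm_num)] at *
    split_ifs <;> omega
  · simp [(mem_Om.1 hh.1).2, (mem_Om.1 hh'.1).2]
  · intro y; simp [hh.2 y, hh'.2 y]
lemma inf_mem {c : ZMod n → ℤ} {h h' : Cfg n} (hh : h ∈ fib c) (hh' : h' ∈ fib c) : h ⊓ h' ∈ fib c := by
  simp only [fib, Finset.mem_filter] at *
  refine ⟨mem_Om.2 ⟨?_, ?_⟩, ?_⟩
  · intro u v huv
    have a := (mem_Om.1 hh.1).1 u v huv
    have b := (mem_Om.1 hh'.1).1 u v huv
    have p := parity_eq hh.1 hh'.1 u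
    simp only [Pi.inf_apply, min_def]
    rw [abs_eq (by norm_num)] at *
    split_ifs <;> omega
  · simp [(mem_Om.1 hh.1).2, (mem_Om.1 hh'.1).2]
  · intro y; simp [hh.2 y, hh'.2 y]

def MonoF (c : ZMod n → ℤ) (F : Cfg n → ℝ) : Prop :=
  ∀ h ∈ fib c, ∀ h' ∈ fib c, h ≤ h' → F h ≤ F h'

lemma fkg_fib (c : ZMod n → ℤ) (F G : Cfg n → ℝ) (hF : MonoF c F) (hG : MonoF c G) :
    Sc c F * Sc c G ≤ Nc c * Sc c (fun h => F h * G h) := by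
  classical
  let L : Sublattice (Cfg n) := ⟨(fib c : Set (Cfg n)), fun a ha b hb => sup_mem ha hb,
    fun a ha b hb => inf_mem ha hb⟩
  letI : Fintype L := (fib c).finite_toSet.fintype
  have conv : ∀ f : Cfg n → ℝ, ∑ a : L, f a = Sc c f := by
    intro f
    unfold Sc
    exact (Finset.sum_subtype (fib c) (fun x => Iff.rfl) f).symm
  set a := ∑ h ∈ fib c, |F h| with ha
  set b := ∑ h ∈ fib c, |G h| with hb
  have hFa : ∀ h ∈ fib c, 0 ≤ F h + a := by
    intro h hh
    have := Finset.single_le_sum (f := fun h => |F h|) (fun _ _ => abs_nonneg _) hh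
    have := neg_abs_le (F h)
    linarith
  have hGb : ∀ h ∈ fib c, 0 ≤ G h + b := by
    intro h hh
    have := Finset.single_le_sum (f := fun h => |G h|) (fun _ _ => abs_nonneg _) hh
    have := neg_abs_le (G h)
    linarith
  have key := fkg (α := L) (β := ℝ) (fun h => F h + a) (fun h => G h + b) (fun _ => 1)
    (fun _ => zero_le_one) (fun h => hFa h h.2) (fun h => hGb h h.2)
    (fun h h' hle => by have := hF h h.2 h' h'.2 hle; simp only; linarith)
    (fun h h' hle => by have := hG h h.2 h' h'.2 hle; simp only; linarith)
    (fun _ _ => by simp)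
  simp only [one_mul] at key
  rw [conv (fun h => F h + a), conv (fun h => G h + b), conv (fun h => (F h + a) * (G h + b)),
    conv (fun _ => 1)] at key
  have e : Sc c (fun h => (F h + a) * (G h + b)) =
      Sc c (fun h => F h * G h) + b * Sc c F + a * Sc c G + Nc c * (a * b) := by
    rw [← Sc_mul_left, ← Sc_mul_left, ← Sc_const, ← Sc_add, ← Sc_add, ← Sc_add]
    congr 1; funext h; ring
  rw [e, Sc_add, Sc_add, Sc_const, Sc_const, Sc_const] at key
  linarith

/-- Lipschitz bounds -/
lemma IsHom.step_le {h : Cfg n} (hh : IsHom h) {d q : Vt n} (fr : Frame n d q) (x : Vt n) :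
    h (x + d) ≤ h x + 1 := by
  rcases hh.abs_step fr x with a | a <;> omega

lemma IsHom.run_le {h : Cfg n} (hh : IsHom h) {d q : Vt n} (fr : Frame n d q) (x : Vt n) (i : ℕ) :
    h (x + i • d) ≤ h x + i := by
  induction i with
  | zero => simp
  | succ i ih =>
    have := hh.step_le fr (x + i • d)
    rw [add_smul, one_smul, ← add_assoc]; push_cast; linarith

lemma pat_incr {h h' : Cfg n} (hh' : IsHom h') (hle : h ≤ h') {d q : Vt n} (fr : Frame n d q) (p : Vt n)
    (hp : h p = h' p) (k : ℕ) (H : Pat h p d q k) : Pat h' p d q k := by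
  refine ⟨fun i hi => ?_, fun i hi hi' => ⟨?_, ?_⟩⟩
  · have := H.1 i hi
    have a : h (p + i • d) ≤ h' (p + i • d) := hle _
    have b := hh'.run_le fr p i
    omega
  · have := (H.2 i hi hi').1
    have a : h (p + i • d + q) ≤ h' (p + i • d + q) := hle _
    have b := hh'.run_le fr p i
    have c := hh'.step_le fr.swap (p + i • d)
    omega
  · have := (H.2 i hi hi').2
    have a : h (p + i • d - q) ≤ h' (p + i • d - q) := hle _
    have b := hh'.run_le fr p i
    have c := hh'.step_le fr.swap.neg (p + i • d)
    rw [← sub_eq_add_neg] at c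
    omega

lemma fib_hom {c : ZMod n → ℤ} {h : Cfg n} (hh : h ∈ fib c) : IsHom h := by
  simp only [fib, Finset.mem_filter] at hh; exact (mem_Om.1 hh.1).1
lemma fib_col {c : ZMod n → ℤ} {h : Cfg n} (hh : h ∈ fib c) (y : ZMod n) : h (0, y) = c y := by
  simp only [fib, Finset.mem_filter] at hh; exact hh.2 y

lemma Cc_mono (c : ZMod n → ℤ) (z : Vt n) (hz : z.1 = 0) (δ : Dir) (k : ℕ) :
    MonoF c (fun h => Cc h z δ k) := by
  intro h hh h' hh' hle
  have hp : h z = h' z := by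
    have : z = (0, z.2) := by ext <;> simp [hz]
    rw [this, fib_col hh, fib_col hh']
  have a := ind_mono (pat_incr (fib_hom hh') hle (frame_dir n δ) z hp k)
  have b := ind_mono (pat_incr (isHom_neg (fib_hom hh)) (neg_le_neg hle) (frame_dir n δ) z
    (by simp [hp]) k)
  simp only [Cc]; linarith

lemma MonoF.add {c : ZMod n → ℤ} {F G : Cfg n → ℝ} (hF : MonoF c F) (hG : MonoF c G) :
    MonoF c (fun h => F h + G h) := fun h hh h' hh' hle =>
  add_le_add (hF h hh h' hh' hle) (hG h hh h' hh' hle)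
lemma MonoF.sum {c : ZMod n → ℤ} {ι : Type*} {s : Finset ι} {F : ι → Cfg n → ℝ}
    (hF : ∀ i ∈ s, MonoF c (F i)) : MonoF c (fun h => ∑ i ∈ s, F i h) := fun h hh h' hh' hle =>
  Finset.sum_le_sum fun i hi => hF i hi h hh h' hh' hle
lemma MonoF.smul {c : ZMod n → ℤ} {F : Cfg n → ℝ} (a : ℝ) (ha : 0 ≤ a) (hF : MonoF c F) :
    MonoF c (fun h => a * F h) := fun h hh h' hh' hle =>
  mul_le_mul_of_nonneg_left (hF h hh h' hh' hle) ha
end fkgsec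

section flux
variable {n : ℕ} [NeZero n]

noncomputable def psD (z : Vt n) (δ : Dir) (k : ℕ) : ℝ := ind (∀ i : ℕ, i ≤ k → (z + i • dv n δ).1 ≠ 0)

lemma psD_sym (z : Vt n) (δ : Dir) (k : ℕ) : psD (z + k • dv n δ) (dneg δ) k = psD z δ k := by
  refine ind_congr ⟨fun H i hi => ?_, fun H i hi => ?_⟩
  · have := H (k - i) (by omega)
    convert this using 2
    rw [dv_dneg]
    obtain ⟨j, rfl⟩ := Nat.exists_eq_add_of_le hi
    simp only [Nat.add_sub_cancel_left, add_smul, smul_neg]; abel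
  · have := H (k - i) (by omega)
    convert this using 2
    rw [dv_dneg]
    obtain ⟨j, rfl⟩ := Nat.exists_eq_add_of_le hi
    simp only [Nat.add_sub_cancel_left, add_smul, smul_neg]; abel

lemma psD_step (z : Vt n) (δ : Dir) (k : ℕ) :
    psD z δ (k + 1) - psD (z + dv n δ) δ k = - (ind (z.1 = 0) * psD (z + dv n δ) δ k) := by
  have e : psD z δ (k + 1) = ind (z.1 ≠ 0) * psD (z + dv n δ) δ k := by
    unfold psD
    rw [ind_mul]
    refine ind_congr ⟨fun H => ⟨by simpa using H 0 (by omega), fun i hi => ?_⟩, fun H i hi => ?_⟩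
    · have := H (i + 1) (by omega)
      convert this using 2
      rw [add_smul, one_smul]; abel
    · rcases i with _ | i
      · simpa using H.1
      · have := H.2 i (by omega)
        convert this using 2
        rw [add_smul, one_smul]; abel
  rw [e]
  by_cases h : z.1 = 0
  · rw [ind_true h, ind_false (not_not.2 h)]; ring
  · rw [ind_false h, ind_true h]; ring

lemma YD_eq {h : Cfg n} (hh : IsHom h) :
    - Yy psD h = ∑ x : Vt n, ind (x.1 = 0) * Lap (fun y => (h y : ℝ)) x +
      2 * ∑ k ∈ Finset.range n, ∑ z : Vt n, ∑ δ : Dir,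
        ind (z.1 = 0) * psD (z + dv n δ) δ k * Cc h z δ (k + 1) := by
  rw [Yy_eq psD (fun z => ind (z.1 ≠ 0)) (fun z δ => by unfold psD; exact ind_congr (by simp)) hh]
  simp only [psD_step, neg_mul, Finset.sum_neg_distrib]
  have : ∑ x : Vt n, ind (x.1 ≠ 0) * Lap (fun y => (h y : ℝ)) x =
      - ∑ x : Vt n, ind (x.1 = 0) * Lap (fun y => (h y : ℝ)) x := by
    rw [eq_neg_iff_add_eq_zero, ← Finset.sum_add_distrib, ← sum_Lap (fun y => (h y : ℝ))]
    refine Finset.sum_congr rfl fun x _ => ?_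
    by_cases hx : x.1 = 0
    · rw [ind_true hx, ind_false (not_not.2 hx)]; ring
    · rw [ind_false hx, ind_true hx]; ring
  rw [this]; ring

noncomputable def Rr (j : ℕ) (y : ZMod n) (h : Cfg n) : ℝ := Cc h (0, y) (true, true) j
noncomputable def Ll (j : ℕ) (y : ZMod n) (h : Cfg n) : ℝ := Cc h (0, y) (true, false) j

lemma sum_Rr (j : ℕ) (hj : j + 1 < n) (h : Cfg n) : ∑ y, Rr (j + 1) y h =
    ∑ k ∈ Finset.range n, ∑ z : Vt n, ∑ δ : Dir,
      ind (z.1 = 0) * ind (k = j ∧ δ = (true, true)) * Cc h z δ (k + 1) := by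
  symm
  rw [Finset.sum_eq_single_of_mem j (Finset.mem_range.2 (by omega))]
  · rw [Fintype.sum_prod_type]
    refine (Finset.sum_eq_single_of_mem (0 : ZMod n) (Finset.mem_univ _) ?_).trans ?_
    rotate_left
    · refine Finset.sum_congr rfl fun y _ => ?_
      rw [Finset.sum_eq_single_of_mem (true, true) (Finset.mem_univ _)]
      · rw [ind_true rfl, ind_true ⟨rfl, rfl⟩]; simp [Rr]
      · intro δ _ hδ
        rw [ind_false (P := _ ∧ _) (fun H => hδ H.2)]; ring
    · intro a _ ha
      refine Finset.sum_eq_zero fun y _ => Finset.sum_eq_zero fun δ _ => ?_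
      rw [ind_false (P := a = 0) ha]; ring
  · intro k _ hk
    refine Finset.sum_eq_zero fun z _ => Finset.sum_eq_zero fun δ _ => ?_
    rw [ind_false (P := _ ∧ _) (fun H => hk H.1)]; ring

lemma psD_one (j : ℕ) (hj : j + 1 < n) (z : Vt n) (hz : z.1 = 0) :
    psD (z + dv n (true, true)) (true, true) j = 1 := by
  refine ind_true fun i hi => ?_
  simp only [dv, ax, if_true, Prod.fst_add, hz, Prod.smul_fst, zero_add]
  intro H
  have : ((i + 1 : ℕ) : ZMod n) = 0 := by push_cast; rw [← H]; simp; ring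
  rw [ZMod.natCast_eq_zero_iff] at this
  have := Nat.le_of_dvd (by omega) this
  omega

lemma GD_mono (c : ZMod n → ℤ) (j : ℕ) (hj : j + 1 < n) :
    MonoF c (fun h => - Yy psD h - 2 * ∑ y, Rr (j + 1) y h) := by
  have e : ∀ h ∈ fib c, - Yy psD h - 2 * ∑ y, Rr (j + 1) y h =
      ∑ x : Vt n, ind (x.1 = 0) * Lap (fun y => (h y : ℝ)) x +
      2 * ∑ k ∈ Finset.range n, ∑ z : Vt n, ∑ δ : Dir,
        (ind (z.1 = 0) * (psD (z + dv n δ) δ k - ind (k = j ∧ δ = (true, true)))) *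
          Cc h z δ (k + 1) := by
    intro h hh
    rw [YD_eq (fib_hom hh), sum_Rr j hj, add_sub_assoc, ← mul_sub, ← Finset.sum_sub_distrib]
    simp only [← Finset.sum_sub_distrib]
    congr 2
    refine Finset.sum_congr rfl fun k _ => Finset.sum_congr rfl fun z _ =>
      Finset.sum_congr rfl fun δ _ => ?_
    ring
  have m : MonoF c (fun h => ∑ x : Vt n, ind (x.1 = 0) * Lap (fun y => (h y : ℝ)) x +
      2 * ∑ k ∈ Finset.range n, ∑ z : Vt n, ∑ δ : Dir,
        (ind (z.1 = 0) * (psD (z + dv n δ) δ k - ind (k = j ∧ δ = (true, true)))) *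
          Cc h z δ (k + 1)) := by
    refine MonoF.add (MonoF.sum fun x _ => ?_) (MonoF.smul 2 (by norm_num) (MonoF.sum fun k _ =>
      MonoF.sum fun z _ => MonoF.sum fun δ _ => ?_))
    · intro h hh h' hh' hle
      by_cases hx : x.1 = 0
      · refine mul_le_mul_of_nonneg_left ?_ (ind_nonneg _)
        refine Finset.sum_le_sum fun δ _ => ?_
        have hp : h x = h' x := by
          have : x = (0, x.2) := by ext <;> simp [hx]
          rw [this, fib_col hh, fib_col hh']
        have : (h (x + dv n δ) : ℝ) ≤ h' (x + dv n δ) := by exact_mod_cast hle _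
        simp only [hp]; linarith
      · simp [ind_false hx]
    · by_cases hz : z.1 = 0
      · refine MonoF.smul _ (mul_nonneg (ind_nonneg _) ?_) (Cc_mono c z hz δ (k + 1))
        by_cases hk : k = j ∧ δ = (true, true)
        · obtain ⟨rfl, rfl⟩ := hk
          rw [psD_one k hj z hz]
          linarith [ind_le_one (k = k ∧ ((true, true) : Dir) = (true, true))]
        · rw [ind_false hk, sub_zero]; exact ind_nonneg _
      · intro h hh h' hh' hle
        simp [ind_false hz]
  intro h hh h' hh' hle
  have := m h hh h' hh' hle
  simp only at this ⊢
  rw [e h hh, e h' hh']; exact this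

lemma indc_tw (c : ZMod n → ℤ) (z : Vt n) (δ : Dir) (k : ℕ) (h : Cfg n)
    (H : ∀ i : ℕ, i ≤ k → (z + i • dv n δ).1 ≠ 0) : indc c (h + Tw z δ k) = indc c h := by
  have : ∀ y, Tw z δ k (0, y) = 0 := fun y => Tw_not_mem z δ k _ fun i hi e => H i hi (by rw [← e])
  refine ind_congr ?_
  simp [this]

lemma Sc_YD (hn : 2 ≤ n) (c : ZMod n → ℤ) : Sc c (Yy psD) = 0 := by
  rw [Sc_eq, Sm_ibp hn psD psD_sym (indc c) (shInv_indc c)]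
  rw [neg_eq_zero]
  refine Finset.sum_eq_zero fun k _ => Finset.sum_eq_zero fun z _ => Finset.sum_eq_zero fun δ _ => ?_
  by_cases H : ∀ i : ℕ, i ≤ k → (z + i • dv n δ).1 ≠ 0
  · simp only [indc_tw c z δ k _ H, sub_self, zero_mul]
    simp [Sm]
  · rw [psD, ind_false H]; ring

lemma cov_row (hn : 2 ≤ n) (c : ZMod n → ℤ) (j : ℕ) (hj : j + 1 < n) (y : ZMod n) :
    2 * ∑ y', (Nc c * Sc c (fun h => Rr (j + 1) y h * Rr (j + 1) y' h) -
      Sc c (Rr (j + 1) y) * Sc c (Rr (j + 1) y')) ≤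
    Nc c * Sc c (fun h => Rr (j + 1) y h * (- Yy psD h)) := by
  have key := fkg_fib c (Rr (j + 1) y) _ (Cc_mono c (0, y) rfl (true, true) (j + 1)) (GD_mono c j hj)
  have e1 : Sc c (fun h => - Yy psD h - 2 * ∑ y, Rr (j + 1) y h) = - 2 * ∑ y', Sc c (Rr (j + 1) y') := by
    rw [Sc_sub, Sc_mul_left, Sc_sum]
    have : Sc c (fun h => - Yy psD h) = 0 := by
      have := Sc_mul_left c (-1) (Yy psD)
      rw [Sc_YD hn] at this
      simpa using this
    rw [this]; ring
  have e2 : Sc c (fun h => Rr (j + 1) y h * (- Yy psD h - 2 * ∑ y, Rr (j + 1) y h)) =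
      Sc c (fun h => Rr (j + 1) y h * (- Yy psD h)) -
        2 * ∑ y', Sc c (fun h => Rr (j + 1) y h * Rr (j + 1) y' h) := by
    rw [← Sc_sum, ← Sc_mul_left, ← Sc_sub]
    congr 1; funext h; rw [← Finset.mul_sum]; ring
  rw [e1, e2] at key
  rw [Finset.sum_sub_distrib, ← Finset.mul_sum, ← Finset.mul_sum]
  linarith

lemma Sc_rfx (c : ZMod n → ℤ) (F : Cfg n → ℝ) (hF : ShInv F) :
    Sc c (fun h => F (fun x => h (rfx x))) = Sc c F := by
  rw [Sc_eq, Sc_eq, ← Sm_rfx (fun h => indc c h * F h) ((shInv_indc c).mul hF)]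
  refine Sm_congr fun h _ => ?_
  congr 1
  unfold indc rfx; simp

lemma Rr_rfx (j : ℕ) (y : ZMod n) (h : Cfg n) : Rr j y (fun x => h (rfx x)) = Ll j y h := by
  unfold Rr Ll Cc
  have e : -(fun x => h (rfx x)) = fun x => (-h) (rfx x) := rfl
  have a := pat_aut (rfxH n) h (0, y) (dv n (true, true)) (qv n (true, true)) j
  have b := pat_aut (rfxH n) (-h) (0, y) (dv n (true, true)) (qv n (true, true)) j
  have e1 : rfxH n (0, y) = (0, y) := by simp [rfxH, rfx]
  have e2 : rfxH n (dv n (true, true)) = dv n (true, false) := by simp [rfxH, rfx, dv, ax]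
  have e3 : rfxH n (qv n (true, true)) = qv n (true, false) := by simp [rfxH, rfx, qv, ax]
  rw [e1, e2, e3] at a b
  rw [e]
  exact congrArg₂ _ (ind_congr a) (ind_congr b)

lemma Rr_mono (c : ZMod n → ℤ) (j : ℕ) (y : ZMod n) : MonoF c (Rr j y) :=
  Cc_mono c (0, y) rfl (true, true) j

lemma var_fib (hn : 2 ≤ n) (c : ZMod n → ℤ) (hc : c ∈ cols n) (j : ℕ) (hj : j + 1 < n) (w : ZMod n → ℝ) :
    Sc c (fun h => (∑ y, w y * (Rr (j + 1) y h - Ll (j + 1) y h)) ^ 2) ≤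
      2 * ∑ y, w y ^ 2 * Sc c (fun h => Rr (j + 1) y h * (- Yy psD h)) := by
  classical
  have hN : 0 < Nc c := by
    unfold cols at hc
    obtain ⟨h, hh, rfl⟩ := Finset.mem_image.1 hc
    unfold Nc
    have : h ∈ fib (fun y => h (0, y)) := by simp [fib, hh]
    exact_mod_cast Finset.card_pos.2 ⟨h, this⟩
  set Rw : Cfg n → ℝ := fun h => ∑ y, w y * Rr (j + 1) y h with hRw
  set Lw : Cfg n → ℝ := fun h => ∑ y, w y * Ll (j + 1) y h with hLw
  have shR : ShInv Rw := by
    intro h a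
    exact Finset.sum_congr rfl fun y _ => by
      have := shInv_Cc (0, y) (true, true) (j + 1) h a
      exact congrArg _ this
  have RL : ∀ h, Rw (fun x => h (rfx x)) = Lw h := fun h => by simp only [hRw, hLw, Rr_rfx]
  have s1 : Sc c Lw = Sc c Rw := by rw [← Sc_rfx c Rw shR]; simp only [RL]
  have s2 : Sc c (fun h => Lw h ^ 2) = Sc c (fun h => Rw h ^ 2) := by
    rw [← Sc_rfx c (fun h => Rw h ^ 2) (shR.comp (fun t => t ^ 2))]; simp only [RL]
  set μ := Sc c Rw / Nc c with hμ
  have t1 : Sc c (fun h => (∑ y, w y * (Rr (j + 1) y h - Ll (j + 1) y h)) ^ 2) ≤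
      Sc c (fun h => 2 * (Rw h ^ 2 - 2 * μ * Rw h + μ ^ 2) + 2 * (Lw h ^ 2 - 2 * μ * Lw h + μ ^ 2)) := by
    refine Finset.sum_le_sum fun h _ => ?_
    have : ∑ y, w y * (Rr (j + 1) y h - Ll (j + 1) y h) = Rw h - Lw h := by
      simp only [hRw, hLw, mul_sub, Finset.sum_sub_distrib]
    rw [this]
    nlinarith [sq_nonneg ((Rw h - μ) + (Lw h - μ))]
  have t2 : Sc c (fun h => 2 * (Rw h ^ 2 - 2 * μ * Rw h + μ ^ 2) +
      2 * (Lw h ^ 2 - 2 * μ * Lw h + μ ^ 2)) = 4 * (Sc c (fun h => Rw h ^ 2) - Sc c Rw ^ 2 / Nc c) := by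
    rw [Sc_add, Sc_mul_left, Sc_mul_left, Sc_add, Sc_add, Sc_sub, Sc_sub, Sc_mul_left, Sc_mul_left,
      Sc_const, s1, s2, hμ]
    field_simp; ring
  refine t1.trans (t2.le.trans ?_)
  set K : ZMod n → ZMod n → ℝ := fun y y' => Nc c * Sc c (fun h => Rr (j + 1) y h * Rr (j + 1) y' h) -
      Sc c (Rr (j + 1) y) * Sc c (Rr (j + 1) y') with hK
  have K0 : ∀ y y', 0 ≤ K y y' := fun y y' =>
    sub_nonneg.2 (fkg_fib c _ _ (Rr_mono c _ y) (Rr_mono c _ y'))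
  have Ks : ∀ y y', K y y' = K y' y := by
    intro y y'; simp only [hK]
    rw [mul_comm (Sc c (Rr (j + 1) y))]
    congr 3; funext h; ring
  have q : Nc c * Sc c (fun h => Rw h ^ 2) - Sc c Rw ^ 2 = ∑ y, ∑ y', w y * w y' * K y y' := by
    have a : Sc c (fun h => Rw h ^ 2) =
        ∑ y, ∑ y', w y * w y' * Sc c (fun h => Rr (j + 1) y h * Rr (j + 1) y' h) := by
      simp only [← Sc_mul_left, ← Sc_sum]
      congr 1; funext h
      simp only [hRw, sq, Finset.sum_mul_sum]
      refine Finset.sum_congr rfl fun y _ => Finset.sum_congr rfl fun y' _ => by ring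
    have b : Sc c Rw = ∑ y, w y * Sc c (Rr (j + 1) y) := by
      simp only [hRw, Sc_sum, Sc_mul_left]
    rw [a, b, sq, Finset.sum_mul_sum, Finset.mul_sum, ← Finset.sum_sub_distrib]
    refine Finset.sum_congr rfl fun y _ => ?_
    rw [Finset.mul_sum, ← Finset.sum_sub_distrib]
    refine Finset.sum_congr rfl fun y' _ => ?_
    simp only [hK]; ring
  have q2 : ∑ y, ∑ y', w y * w y' * K y y' ≤ ∑ y, w y ^ 2 * ∑ y', K y y' := by
    have a : ∑ y, ∑ y', w y * w y' * K y y' ≤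
        ∑ y, ∑ y', (w y ^ 2 * K y y' / 2 + w y' ^ 2 * K y' y / 2) := by
      refine Finset.sum_le_sum fun y _ => Finset.sum_le_sum fun y' _ => ?_
      rw [← Ks y y']
      nlinarith [mul_nonneg (sq_nonneg (w y - w y')) (K0 y y')]
    refine a.trans (le_of_eq ?_)
    simp only [Finset.sum_add_distrib]
    rw [Finset.sum_comm (f := fun y y' => w y' ^ 2 * K y' y / 2), ← Finset.sum_add_distrib]
    refine Finset.sum_congr rfl fun y _ => ?_
    rw [Finset.mul_sum, ← Finset.sum_add_distrib]
    refine Finset.sum_congr rfl fun y' _ => ?_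
    ring
  have q3 : ∑ y, w y ^ 2 * ∑ y', K y y' ≤
      ∑ y, w y ^ 2 * (Nc c * Sc c (fun h => Rr (j + 1) y h * (- Yy psD h)) / 2) := by
    refine Finset.sum_le_sum fun y _ => mul_le_mul_of_nonneg_left ?_ (sq_nonneg _)
    have := cov_row hn c j hj y
    simp only [hK]; linarith
  have q4 : ∑ y, w y ^ 2 * (Nc c * Sc c (fun h => Rr (j + 1) y h * (- Yy psD h)) / 2) =
      Nc c * (∑ y, w y ^ 2 * Sc c (fun h => Rr (j + 1) y h * (- Yy psD h))) / 2 := by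
    rw [Finset.mul_sum, Finset.sum_div]
    refine Finset.sum_congr rfl fun y _ => by ring
  have q5 := q.le.trans (q2.trans (q3.trans q4.le))
  have q6 : Nc c * (4 * (Sc c (fun h => Rw h ^ 2) - Sc c Rw ^ 2 / Nc c)) =
      4 * (Nc c * Sc c (fun h => Rw h ^ 2) - Sc c Rw ^ 2) := by field_simp
  refine le_of_mul_le_mul_left ?_ hN
  rw [q6]; linarith
end flux

/-! ### Flux bound -/
lemma summ_Kg (a : ℕ) : Summable (fun k : ℕ => ((k : ℝ) + 1) ^ a * rho ^ k) := by
  have h := summable_pow_mul_geometric_of_norm_lt_one (R := ℝ) a (r := rho)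
    (by rw [Real.norm_eq_abs, abs_of_pos rho_pos]; exact rho_lt)
  have h1 := (summable_nat_add_iff 1).2 h
  have h2 := h1.mul_left rho⁻¹
  refine h2.congr fun k => ?_
  have := rho_pos.ne'
  push_cast
  field_simp
  ring

noncomputable def Kg (a : ℕ) : ℝ := ∑' k : ℕ, ((k : ℝ) + 1) ^ a * rho ^ k

lemma geo_sum (a M : ℕ) : ∑ k ∈ Finset.range M, ((k : ℝ) + 1) ^ a * rho ^ k ≤ Kg a :=
  (summ_Kg a).sum_le_tsum _ fun k _ => mul_nonneg (by positivity) (pow_nonneg rho_pos.le _)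

lemma Kg_nonneg (a : ℕ) : 0 ≤ Kg a :=
  tsum_nonneg fun k => mul_nonneg (by positivity) (pow_nonneg rho_pos.le _)

section fl
variable {n : ℕ} [NeZero n]

lemma cover_sum (S : Finset (Vt n)) (k : ℕ) (f : Vt n → Dir → ℝ) (B : ℝ) (hB : ∀ z δ, f z δ ≤ B)
    (h0 : 0 ≤ B)
    (hz : ∀ z δ, (∀ i : ℕ, i ≤ k → z + i • dv n δ ∉ S) → f z δ = 0) :
    ∑ z, ∑ δ, f z δ ≤ 4 * (S.card * (k + 1)) * B := by
  classical
  refine Finset.sum_comm.trans_le ?_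
  have : ∀ δ : Dir, ∑ z, f z δ ≤ (S.card * (k + 1)) * B := by
    intro δ
    set T := (S ×ˢ Finset.range (k + 1)).image (fun p => p.1 - p.2 • dv n δ) with hT
    have c : (T.card : ℝ) ≤ S.card * (k + 1) := by
      have := Finset.card_image_le (s := S ×ˢ Finset.range (k + 1)) (f := fun p => p.1 - p.2 • dv n δ)
      rw [Finset.card_product, Finset.card_range] at this
      exact_mod_cast this
    have e : ∑ z, f z δ = ∑ z ∈ T, f z δ := by
      symm
      refine Finset.sum_subset (Finset.subset_univ _) fun z _ hzT => hz z δ fun i hi hs => hzT ?_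
      refine Finset.mem_image.2 ⟨(z + i • dv n δ, i), ?_, ?_⟩
      · exact Finset.mem_product.2 ⟨hs, Finset.mem_range.2 (by show i < k + 1; omega)⟩
      · simp only; abel
    rw [e]
    refine (Finset.sum_le_card_nsmul _ _ _ fun z _ => hB z δ).trans ?_
    rw [nsmul_eq_mul]
    exact mul_le_mul_of_nonneg_right c h0
  refine (Finset.sum_le_sum fun δ _ => this δ).trans ?_
  simp; linarith

noncomputable def supp (p d q : Vt n) (k : ℕ) : Finset (Vt n) :=
  open Classical in
  (Finset.range (k + 2) ×ˢ ({0, q, -q} : Finset (Vt n))).image (fun t => p + t.1 • d + t.2)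

lemma supp_card (p d q : Vt n) (k : ℕ) : ((supp p d q k).card : ℝ) ≤ 3 * (k + 2) := by
  classical
  have h1 : (supp p d q k).card ≤ (Finset.range (k + 2) ×ˢ ({0, q, -q} : Finset (Vt n))).card := by
    unfold supp; convert Finset.card_image_le
  have h2 : ({0, q, -q} : Finset (Vt n)).card ≤ 3 := Finset.card_le_three
  rw [Finset.card_product, Finset.card_range] at h1
  have : (supp p d q k).card ≤ (k + 2) * 3 := h1.trans (Nat.mul_le_mul_left _ h2)
  have : ((supp p d q k).card : ℝ) ≤ ((k + 2) * 3 : ℕ) := by exact_mod_cast this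
  push_cast at this; linarith

lemma pat_supp (h a : Cfg n) (p d q : Vt n) (k : ℕ) (ha : ∀ x ∈ supp p d q k, a x = 0) :
    Pat (h + a) p d q k ↔ Pat h p d q k := by
  classical
  have m0 : ∀ i : ℕ, i ≤ k + 1 → a (p + i • d) = 0 := fun i hi => ha _ (by
    unfold supp
    refine Finset.mem_image.2 ⟨(i, 0), ?_, by simp⟩
    simp; omega)
  have m1 : ∀ i : ℕ, i ≤ k → a (p + i • d + q) = 0 := fun i hi => ha _ (by
    unfold supp
    refine Finset.mem_image.2 ⟨(i, q), ?_, rfl⟩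
    simp; omega)
  have m2 : ∀ i : ℕ, i ≤ k → a (p + i • d - q) = 0 := fun i hi => ha _ (by
    unfold supp
    refine Finset.mem_image.2 ⟨(i, -q), ?_, by simp only; abel⟩
    simp; omega)
  have mp : a p = 0 := by simpa using m0 0 (by omega)
  unfold Pat
  simp only [Pi.add_apply, mp, add_zero]
  refine and_congr (forall_congr' fun i => forall_congr' fun hi => ?_)
    (forall_congr' fun i => forall_congr' fun hi => forall_congr' fun hi' => ?_)
  · rw [m0 i hi, add_zero]
  · rw [m1 i hi', m2 i hi', add_zero, add_zero]

lemma Cc_supp (h a : Cfg n) (p : Vt n) (δ : Dir) (k : ℕ)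
    (ha : ∀ x ∈ supp p (dv n δ) (qv n δ) k, a x = 0) : Cc (h + a) p δ k = Cc h p δ k := by
  unfold Cc
  rw [neg_add, ind_congr (pat_supp h a _ _ _ _ ha),
    ind_congr (pat_supp (-h) (-a) _ _ _ _ fun x hx => by simp [ha x hx])]

lemma Cc_abs_tail (hn : Even n) (h4 : 4 ≤ n) (p : Vt n) (δ : Dir) (k : ℕ) :
    Sm (fun h => |Cc h p δ k|) ≤ 4 * rho ^ (2 * k) * Nn n := by
  have h1 := pat_tail hn h4 p δ k
  have h2 := Sm_neg_cfg (fun h : Cfg n => ind (Pat h p (dv n δ) (qv n δ) k))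
  have h3 : Sm (fun h => |Cc h p δ k|) ≤ Sm (fun h : Cfg n => ind (Pat h p (dv n δ) (qv n δ) k) +
      ind (Pat (-h) p (dv n δ) (qv n δ) k)) := Sm_mono fun h _ => by
    unfold Cc
    have a := ind_nonneg (Pat h p (dv n δ) (qv n δ) k)
    have b := ind_nonneg (Pat (-h) p (dv n δ) (qv n δ) k)
    rw [abs_le]; constructor <;> linarith
  rw [Sm_add, h2] at h3
  linarith

lemma Cc_abs_le (h : Cfg n) (p : Vt n) (δ : Dir) (k : ℕ) : |Cc h p δ k| ≤ 1 := by
  unfold Cc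
  have a := ind_nonneg (Pat h p (dv n δ) (qv n δ) k)
  have b := ind_nonneg (Pat (-h) p (dv n δ) (qv n δ) k)
  have a' := ind_le_one (Pat h p (dv n δ) (qv n δ) k)
  have b' := ind_le_one (Pat (-h) p (dv n δ) (qv n δ) k)
  rw [abs_le]; constructor <;> linarith

lemma Nn_nonneg (n : ℕ) [NeZero n] : 0 ≤ Nn n := by unfold Nn; positivity

lemma Sm_prod_tail (F G : Cfg n → ℝ) (A : ℝ) (a b : ℕ) (hA : 0 ≤ A)
    (hF0 : ∀ h, 0 ≤ F h) (hG0 : ∀ h, 0 ≤ G h) (hF1 : ∀ h, F h ≤ 1) (hG1 : ∀ h, G h ≤ 1)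
    (hF : Sm F ≤ A * rho ^ (2 * a) * Nn n) (hG : Sm G ≤ A * rho ^ (2 * b) * Nn n) :
    Sm (fun h => F h * G h) ≤ A * rho ^ (a + b) * Nn n := by
  have hN := Nn_nonneg n
  have r0 := rho_pos
  have r1 := rho_lt
  rcases le_total a b with hab | hab
  · refine (Sm_mono (G := G) fun h _ => ?_).trans (hG.trans ?_)
    · exact mul_le_of_le_one_left (hG0 h) (hF1 h)
    · have := pow_le_pow_of_le_one r0.le r1.le (show a + b ≤ 2 * b by omega)
      gcongr
  · refine (Sm_mono (G := F) fun h _ => ?_).trans (hF.trans ?_)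
    · exact mul_le_of_le_one_right (hF0 h) (hG1 h)
    · have := pow_le_pow_of_le_one r0.le r1.le (show a + b ≤ 2 * a by omega)
      gcongr

lemma flux_term (hn : Even n) (h4 : 4 ≤ n) (p : Vt n) (ε : Dir) (j : ℕ) (z : Vt n) (δ : Dir) (k : ℕ) :
    |Sm (fun h => (Cc (h + Tw z δ k) p ε j - Cc h p ε j) * Uu h z δ k)| ≤ 8 * rho ^ (j + k) * Nn n := by
  have hN := Nn_nonneg n
  have U1 : ∀ h : Cfg n, ∀ z δ k, Uu h z δ k ≤ 1 := fun h z δ k => ind_le_one _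
  have tU : ∀ z δ k, Sm (fun h : Cfg n => Uu h z δ k) ≤ 4 * rho ^ (2 * k) * Nn n := fun z δ k => by
    have := Uu_tail hn h4 z δ k
    have : 0 ≤ rho ^ (2 * k) * Nn n := mul_nonneg (pow_nonneg rho_pos.le _) hN
    linarith
  have s1 : Sm (fun h => |Cc h p ε j| * Uu h z δ k) ≤ 4 * rho ^ (j + k) * Nn n :=
    Sm_prod_tail _ _ 4 j k (by norm_num) (fun h => abs_nonneg _) (fun h => Uu_nonneg _ _ _ _)
      (fun h => Cc_abs_le _ _ _ _) (fun h => U1 _ _ _ _) (Cc_abs_tail hn h4 p ε j) (tU z δ k)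
  have s2 : Sm (fun h => |Cc (h + Tw z δ k) p ε j| * Uu h z δ k) ≤ 4 * rho ^ (j + k) * Nn n := by
    rw [← Sm_tower (by omega) z δ k (fun h => |Cc h p ε j|) ((shInv_Cc p ε j).comp _)]
    refine Sm_prod_tail _ _ 4 j k (by norm_num) (fun h => abs_nonneg _) (fun h => Uu_nonneg _ _ _ _)
      (fun h => Cc_abs_le _ _ _ _) (fun h => U1 _ _ _ _) (Cc_abs_tail hn h4 p ε j) ?_
    rw [Sm_neg_cfg (fun h : Cfg n => Uu h (z + k • dv n δ) (dneg δ) k)]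
    exact tU _ _ _
  have : |Sm (fun h => (Cc (h + Tw z δ k) p ε j - Cc h p ε j) * Uu h z δ k)| ≤
      Sm (fun h => |Cc (h + Tw z δ k) p ε j| * Uu h z δ k + |Cc h p ε j| * Uu h z δ k) := by
    refine (Finset.abs_sum_le_sum_abs _ _).trans (Finset.sum_le_sum fun h _ => ?_)
    rw [abs_mul, abs_of_nonneg (Uu_nonneg h z δ k), ← add_mul]
    exact mul_le_mul_of_nonneg_right (abs_sub _ _) (Uu_nonneg _ _ _ _)
  rw [Sm_add] at this
  linarith

noncomputable def sg (j : ℕ) : ℝ := 192 * Kg 1 * ((j + 2) * rho ^ j)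

lemma sg_nonneg (j : ℕ) : 0 ≤ sg j := by
  unfold sg
  have := Kg_nonneg 1
  have := rho_pos
  positivity

lemma flux (hn : Even n) (h4 : 4 ≤ n) (ψ : Vt n → Dir → ℕ → ℝ)
    (hψ : ∀ z δ k, ψ (z + k • dv n δ) (dneg δ) k = ψ z δ k) (hψ1 : ∀ z δ k, |ψ z δ k| ≤ 1)
    (p : Vt n) (ε : Dir) (j : ℕ) :
    Sm (fun h => Cc h p ε j * (- Yy ψ h)) ≤ sg j * Nn n := by
  have hN := Nn_nonneg n
  have r0 := rho_pos
  have e : Sm (fun h => Cc h p ε j * (- Yy ψ h)) = ∑ k ∈ Finset.range (n + 1), ∑ z : Vt n, ∑ δ : Dir,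
      wt k * ψ z δ k * Sm (fun h => (Cc (h + Tw z δ k) p ε j - Cc h p ε j) * Uu h z δ k) := by
    have := Sm_ibp (show 2 ≤ n by omega) ψ hψ (fun h => Cc h p ε j) (shInv_Cc p ε j)
    rw [eq_neg_iff_add_eq_zero] at this
    rw [← sub_eq_zero, ← neg_eq_zero, ← this, neg_sub, sub_eq_add_neg, ← Sm_neg, add_comm]
    congr 1
    refine Sm_congr fun h _ => by ring
  rw [e]
  have b : ∀ k ∈ Finset.range (n + 1), ∑ z : Vt n, ∑ δ : Dir,
      wt k * ψ z δ k * Sm (fun h => (Cc (h + Tw z δ k) p ε j - Cc h p ε j) * Uu h z δ k) ≤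
      192 * ((j + 2) * rho ^ j) * Nn n * ((k + 1) ^ 1 * rho ^ k) := by
    intro k _
    refine (cover_sum (supp p (dv n ε) (qv n ε) j) k _ (16 * rho ^ (j + k) * Nn n) ?_ ?_ ?_).trans ?_
    · intro z δ
      refine (le_abs_self _).trans ?_
      rw [abs_mul, abs_mul]
      have w : |wt k| ≤ 2 := by unfold wt; split_ifs <;> norm_num
      have := mul_le_mul (mul_le_mul w (hψ1 z δ k) (abs_nonneg _) (by norm_num))
        (flux_term hn h4 p ε j z δ k) (abs_nonneg _) (by norm_num)
      linarith
    · positivity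
    · intro z δ H
      have : ∀ h : Cfg n, Cc (h + Tw z δ k) p ε j = Cc h p ε j := fun h =>
        Cc_supp h _ p ε j fun x hx => Tw_not_mem z δ k x fun i hi e => H i hi (e ▸ hx)
      simp [this, Sm]
    · have := supp_card p (dv n ε) (qv n ε) j
      calc 4 * (((supp p (dv n ε) (qv n ε) j).card : ℝ) * (k + 1)) * (16 * rho ^ (j + k) * Nn n)
          ≤ 4 * ((3 * (j + 2)) * (k + 1)) * (16 * rho ^ (j + k) * Nn n) := by gcongr
        _ = _ := by rw [pow_add]; ring
  refine (Finset.sum_le_sum b).trans ?_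
  rw [← Finset.mul_sum]
  have := geo_sum 1 (n + 1)
  calc _ ≤ 192 * (((j : ℝ) + 2) * rho ^ j) * Nn n * Kg 1 := by gcongr
    _ = _ := by unfold sg; ring

/-- antisymmetrised horizontal pattern -/
noncomputable def Ah (j : ℕ) (x : Vt n) (h : Cfg n) : ℝ := Cc h x (true, true) j - Cc h x (true, false) j

lemma col_bound (hn : Even n) (h4 : 4 ≤ n) (j : ℕ) (w : ZMod n → ℝ) :
    Sm (fun h => (∑ y, w y * Ah (j + 1) (0, y) h) ^ 2) ≤ 2 * sg (j + 1) * Nn n * ∑ y, w y ^ 2 := by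
  have hN := Nn_nonneg n
  by_cases hj : j + 1 < n
  · rw [Sm_disint]
    refine (Finset.sum_le_sum fun c hc => var_fib (by omega) c hc j hj w).trans ?_
    rw [← Finset.mul_sum]
    have e : ∑ c ∈ cols n, ∑ y, w y ^ 2 * Sc c (fun h => Rr (j + 1) y h * (- Yy psD h)) =
        ∑ y, w y ^ 2 * Sm (fun h => Rr (j + 1) y h * (- Yy psD h)) := by
      refine Finset.sum_comm.trans ?_
      simp only [← Finset.mul_sum]
      refine Finset.sum_congr rfl fun y _ => ?_
      rw [Sm_disint]
    rw [e, Finset.mul_sum, Finset.mul_sum]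
    refine Finset.sum_le_sum fun y _ => ?_
    have := flux hn h4 psD psD_sym (fun z δ k => by
      unfold psD
      rw [abs_of_nonneg (ind_nonneg _)]; exact ind_le_one _) (0, y) (true, true) (j + 1)
    have := mul_le_mul_of_nonneg_left this (sq_nonneg (w y))
    unfold Rr
    linarith
  · have : ∀ y (h : Cfg n), Ah (j + 1) (0, y) h = 0 := fun y h => by
      unfold Ah; rw [Cc_large (by omega), Cc_large (by omega), sub_zero]
    simp only [this, mul_zero, Finset.sum_const_zero]
    have := sg_nonneg (j + 1)
    have : Sm (fun h : Cfg n => (0:ℝ) ^ 2) = 0 := by simp [Sm]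
    rw [this]
    have : 0 ≤ ∑ y, w y ^ 2 := Finset.sum_nonneg fun y _ => sq_nonneg _
    positivity
end fl

/-! ### A Polya-type criterion on the cycle -/
section polya
def cd {m : ℕ} (i i' : ZMod m) : ℕ := min (i - i').val (i' - i).val

lemma abel_id (f : ℕ → ℝ) (M s : ℕ) (hs : s ≤ M) :
    f s = f M + ((M - s : ℕ) : ℝ) * (f (M - 1) - f M) +
      ∑ t ∈ Finset.range M, ((t - s : ℕ) : ℝ) * (f (t - 1) - 2 * f t + f (t + 1)) := by
  induction M, hs using Nat.le_induction with
  | base =>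
    rw [Finset.sum_eq_zero]
    · simp
    · intro t ht
      rw [Nat.sub_eq_zero_of_le (Finset.mem_range.1 ht).le]; simp
  | succ M hM ih =>
    rw [Finset.sum_range_succ]
    have e : (((M + 1 - s : ℕ)) : ℝ) = ((M - s : ℕ) : ℝ) + 1 := by
      rw [Nat.sub_add_comm hM]; push_cast; ring
    rw [e, Nat.add_sub_cancel]
    linarith

variable {m : ℕ} [NeZero m]

lemma cd_le (i i' : ZMod m) : cd i i' ≤ m / 2 := by
  unfold cd
  have : (i - i') = - (i' - i) := by ring
  rw [this, ZMod.neg_val]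
  have := ZMod.val_lt (i' - i)
  split_ifs with h
  · simp
  · omega

lemma card_val_Ico (a b : ℕ) (hb : b ≤ m) :
    (Finset.univ.filter (fun c : ZMod m => a ≤ c.val ∧ c.val < b)).card = b - a := by
  rw [← Nat.card_Ico]
  refine Finset.card_nbij' (fun c => c.val) (fun c => (c : ZMod m)) ?_ ?_ ?_ ?_
  · intro c hc; simpa using hc
  · intro c hc
    simp only [Finset.coe_Ico, Set.mem_Ico] at hc
    simp [ZMod.val_natCast_of_lt (show c < m by omega), hc]
  · intro c hc; simp
  · intro c hc
    simp only [Finset.coe_Ico, Set.mem_Ico] at hc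
    simp [ZMod.val_natCast_of_lt (show c < m by omega)]

lemma tent_aux (t : ℕ) (ht : 2 * t ≤ m) (r : ZMod m) :
    (Finset.univ.filter (fun c : ZMod m => c.val < t ∧ (c + r).val < t)).card =
      t - min r.val (-r).val := by
  have hr := ZMod.val_lt r
  by_cases h : 2 * r.val ≤ m
  · have e : min r.val (-r).val = r.val := by
      rw [ZMod.neg_val]; split_ifs with h0
      · simp [h0]
      · omega
    rw [e, ← Nat.sub_zero (t - r.val), ← card_val_Ico (m := m) 0 (t - r.val) (by omega)]
    congr 1
    ext c
    simp only [Finset.mem_filter, Finset.mem_univ, true_and, ZMod.val_add]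
    have hc := ZMod.val_lt c
    constructor
    · rintro ⟨h1, h2⟩
      rw [Nat.mod_eq_of_lt (by omega)] at h2
      omega
    · rintro ⟨_, h1⟩
      rw [Nat.mod_eq_of_lt (by omega)]
      omega
  · have h0 : r ≠ 0 := by rintro rfl; simp at h
    have e : min r.val (-r).val = m - r.val := by
      rw [ZMod.neg_val, if_neg h0]; omega
    rw [e, ← card_val_Ico (m := m) (m - r.val) t (by omega)]
    congr 1
    ext c
    simp only [Finset.mem_filter, Finset.mem_univ, true_and, ZMod.val_add]
    have hc := ZMod.val_lt c
    by_cases hw : c.val + r.val < m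
    · rw [Nat.mod_eq_of_lt hw]; omega
    · rw [Nat.mod_eq_sub_mod (by omega), Nat.mod_eq_of_lt (by omega)]; omega

lemma tent (t : ℕ) (ht : 2 * t ≤ m) (i i' : ZMod m) :
    (Finset.univ.filter (fun a : ZMod m => (i - a).val < t ∧ (i' - a).val < t)).card = t - cd i i' := by
  have := tent_aux t ht (i' - i)
  unfold cd
  rw [min_comm, show i - i' = -(i' - i) by ring, ← this]
  refine Finset.card_nbij' (fun a => i - a) (fun c => i - c) ?_ ?_ ?_ ?_
  · intro a ha; simpa [sub_add_sub_cancel', show i - a + (i' - i) = i' - a by ring] using ha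
  · intro a ha; simpa [show i' - (i - a) = a + (i' - i) by ring] using ha
  · intro a _; simp
  · intro a _; simp

variable {ι : Type*} [Fintype ι]
def PSD (K : ι → ι → ℝ) : Prop := ∀ w : ι → ℝ, 0 ≤ ∑ y, ∑ y', K y y' * (w y * w y')

lemma psd_tent (K : ι → ι → ℝ) (hK : PSD K) (t : ℕ) (ht : 2 * t ≤ m) (b : ZMod m → ι → ℝ) :
    0 ≤ ∑ i, ∑ i', ((t - cd i i' : ℕ) : ℝ) * ∑ y, ∑ y', K y y' * (b i y * b i' y') := by
  classical
  have e : ∀ i i' : ZMod m, ((t - cd i i' : ℕ) : ℝ) =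
      ∑ a : ZMod m, (if (i - a).val < t then (1:ℝ) else 0) * (if (i' - a).val < t then 1 else 0) := by
    intro i i'
    rw [← tent t ht]
    simp only [← ite_and, ite_mul, one_mul, zero_mul, Finset.sum_boole]
  have e2 : ∑ i, ∑ i', ((t - cd i i' : ℕ) : ℝ) * ∑ y, ∑ y', K y y' * (b i y * b i' y') =
      ∑ a : ZMod m, ∑ y, ∑ y', K y y' * ((∑ i, (if (i - a).val < t then (1:ℝ) else 0) * b i y) *
        (∑ i', (if (i' - a).val < t then (1:ℝ) else 0) * b i' y')) := by
    simp only [e, Finset.sum_mul_sum, Finset.mul_sum, Finset.sum_mul]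
    -- order of summation
    have s1 : ∀ (f : ZMod m → ZMod m → ZMod m → ι → ι → ℝ),
        ∑ i, ∑ i', ∑ y, ∑ y', ∑ a, f a i i' y y' = ∑ a, ∑ y, ∑ y', ∑ i', ∑ i, f a i i' y y' := by
      intro f
      simp only [← Fintype.sum_prod_type']
      refine Fintype.sum_equiv ⟨fun p => (p.2.2.2.2, p.2.2.1, p.2.2.2.1, p.2.1, p.1),
        fun p => (p.2.2.2.2, p.2.2.2.1, p.2.1, p.2.2.1, p.1), fun p => rfl, fun p => rfl⟩ _ _
        fun p => rfl
    have s2 := s1 (fun a i i' y y' => K y y' * ((if (i - a).val < t then (1:ℝ) else 0) * b i y *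
        ((if (i' - a).val < t then (1:ℝ) else 0) * b i' y')))
    rw [← s2]
    refine Finset.sum_congr rfl fun i _ => Finset.sum_congr rfl fun i' _ =>
      Finset.sum_congr rfl fun y _ => Finset.sum_congr rfl fun y' _ => ?_
    refine Finset.sum_congr rfl fun a _ => ?_
    ring
  rw [e2]
  exact Finset.sum_nonneg fun a _ => hK _

lemma polya (f : ℕ → ι → ι → ℝ) (M : ℕ) (hM : M = m / 2)
    (h1 : PSD (f M)) (h2 : PSD (fun y y' => f (M - 1) y y' - f M y y'))
    (h3 : ∀ t, 1 ≤ t → t < M → PSD (fun y y' => f (t - 1) y y' - 2 * f t y y' + f (t + 1) y y'))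
    (b : ZMod m → ι → ℝ) :
    0 ≤ ∑ i, ∑ i', ∑ y, ∑ y', f (cd i i') y y' * (b i y * b i' y') := by
  have e : ∑ i, ∑ i', ∑ y, ∑ y', f (cd i i') y y' * (b i y * b i' y') =
      (∑ y, ∑ y', f M y y' * ((∑ i, b i y) * (∑ i', b i' y'))) +
      (∑ i, ∑ i', ((M - cd i i' : ℕ) : ℝ) * ∑ y, ∑ y', (f (M - 1) y y' - f M y y') * (b i y * b i' y')) +
      ∑ t ∈ Finset.range M, ∑ i, ∑ i', ((t - cd i i' : ℕ) : ℝ) * ∑ y, ∑ y',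
        (f (t - 1) y y' - 2 * f t y y' + f (t + 1) y y') * (b i y * b i' y') := by
    have a1 : (∑ y, ∑ y', f M y y' * ((∑ i, b i y) * (∑ i', b i' y'))) =
        ∑ i, ∑ i', ∑ y, ∑ y', f M y y' * (b i y * b i' y') := by
      simp only [Finset.mul_sum, Finset.sum_mul]
      have s1 : ∀ (f : ZMod m → ZMod m → ι → ι → ℝ),
          ∑ y, ∑ y', ∑ i', ∑ i, f i i' y y' = ∑ i, ∑ i', ∑ y, ∑ y', f i i' y y' := by
        intro f
        simp only [← Fintype.sum_prod_type']
        refine Fintype.sum_equiv ⟨fun p => (p.2.2.2, p.2.2.1, p.1, p.2.1),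
          fun p => (p.2.2.1, p.2.2.2, p.2.1, p.1), fun p => rfl, fun p => rfl⟩ _ _
          fun p => rfl
      exact s1 (fun i i' y y' => f M y y' * (b i y * b i' y'))
    have a2 : ∑ t ∈ Finset.range M, ∑ i, ∑ i', ((t - cd i i' : ℕ) : ℝ) * ∑ y, ∑ y',
        (f (t - 1) y y' - 2 * f t y y' + f (t + 1) y y') * (b i y * b i' y') =
        ∑ i : ZMod m, ∑ i', ∑ y, ∑ y', ∑ t ∈ Finset.range M, ((t - cd i i' : ℕ) : ℝ) *
          ((f (t - 1) y y' - 2 * f t y y' + f (t + 1) y y') * (b i y * b i' y')) := by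
      simp only [Finset.mul_sum]
      refine Finset.sum_comm.trans (Finset.sum_congr rfl fun i _ => ?_)
      refine Finset.sum_comm.trans (Finset.sum_congr rfl fun i' _ => ?_)
      refine Finset.sum_comm.trans (Finset.sum_congr rfl fun y _ => ?_)
      exact Finset.sum_comm
    rw [a1, a2]
    simp only [Finset.mul_sum, ← Finset.sum_add_distrib]
    refine Finset.sum_congr rfl fun i _ => Finset.sum_congr rfl fun i' _ =>
      Finset.sum_congr rfl fun y _ => Finset.sum_congr rfl fun y' _ => ?_
    have := abel_id (fun s => f s y y') M (cd i i') (hM ▸ cd_le i i')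
    rw [this, add_mul, add_mul, Finset.sum_mul]
    congr 1
    · ring
    · exact Finset.sum_congr rfl fun t _ => by ring
  rw [e]
  refine add_nonneg (add_nonneg (h1 _) (psd_tent _ h2 M (by omega) b)) ?_
  refine Finset.sum_nonneg fun t ht => ?_
  rcases Nat.eq_zero_or_pos t with rfl | h0
  · simp
  · exact psd_tent _ (h3 t h0 (Finset.mem_range.1 ht)) t (by have := Finset.mem_range.1 ht; omega) b

def BdF (K : ι → ι → ℝ) (S : ℝ) : Prop := ∀ w w' : ι → ℝ,
  |∑ y, ∑ y', K y y' * (w y * w' y')| ≤ S / 2 * (∑ y, w y ^ 2 + ∑ y, w' y ^ 2)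

lemma BdF.add {K L : ι → ι → ℝ} {S T : ℝ} (h : BdF K S) (h' : BdF L T) :
    BdF (fun y y' => K y y' + L y y') (S + T) := by
  intro w w'
  have a := h w w'
  have b := h' w w'
  have e : ∑ y, ∑ y', (K y y' + L y y') * (w y * w' y') =
    ∑ y, ∑ y', K y y' * (w y * w' y') + ∑ y, ∑ y', L y y' * (w y * w' y') := by
    simp only [add_mul, Finset.sum_add_distrib]
  rw [e]
  refine (abs_add_le _ _).trans ?_
  have : (S + T) / 2 * (∑ y, w y ^ 2 + ∑ y, w' y ^ 2) = S / 2 * (∑ y, w y ^ 2 + ∑ y, w' y ^ 2) +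
    T / 2 * (∑ y, w y ^ 2 + ∑ y, w' y ^ 2) := by ring
  linarith

lemma BdF.smul {K : ι → ι → ℝ} {S : ℝ} (h : BdF K S) (c : ℝ) :
    BdF (fun y y' => c * K y y') (|c| * S) := by
  intro w w'
  have a := h w w'
  have e : ∑ y, ∑ y', (c * K y y') * (w y * w' y') = c * ∑ y, ∑ y', K y y' * (w y * w' y') := by
    simp only [Finset.mul_sum, mul_assoc]
  rw [e, abs_mul]
  have := mul_le_mul_of_nonneg_left a (abs_nonneg c)
  linarith

lemma near_card (s0 : ℕ) (i : ZMod m) : (Finset.univ.filter (fun i' : ZMod m => cd i i' < s0)).card ≤ 2 * s0 := by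
  classical
  have : Finset.univ.filter (fun i' : ZMod m => cd i i' < s0) ⊆
      (Finset.range s0).image (fun r : ℕ => i - (r : ZMod m)) ∪
      (Finset.range s0).image (fun r : ℕ => i + (r : ZMod m)) := by
    intro i' hi'
    simp only [cd, Finset.mem_filter, Finset.mem_univ, true_and, min_lt_iff] at hi'
    rw [Finset.mem_union]
    rcases hi' with h | h
    · left; exact Finset.mem_image.2 ⟨_, Finset.mem_range.2 h, by simp⟩
    · right; exact Finset.mem_image.2 ⟨_, Finset.mem_range.2 h, by simp⟩
  refine (Finset.card_le_card this).trans ((Finset.card_union_le _ _).trans ?_)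
  have a := Finset.card_image_le (s := Finset.range s0) (f := fun r : ℕ => i - (r : ZMod m))
  have b := Finset.card_image_le (s := Finset.range s0) (f := fun r : ℕ => i + (r : ZMod m))
  rw [Finset.card_range] at a b
  omega

lemma cd_comm (i i' : ZMod m) : cd i i' = cd i' i := by unfold cd; rw [min_comm]

lemma near_bound (g : ℕ → ι → ι → ℝ) (s0 : ℕ) (S : ℝ) (hS : 0 ≤ S) (hg : ∀ s, s < s0 → BdF (g s) S)
    (hz : ∀ s, s0 ≤ s → s ≤ m / 2 → ∀ y y', g s y y' = 0) (b : ZMod m → ι → ℝ) :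
    - (S * (2 * s0) * ∑ i, ∑ y, b i y ^ 2) ≤
      ∑ i, ∑ i', ∑ y, ∑ y', g (cd i i') y y' * (b i y * b i' y') := by
  classical
  have h1 : ∀ i i' : ZMod m, - ((if cd i i' < s0 then (1:ℝ) else 0) * (S / 2 * (∑ y, b i y ^ 2 + ∑ y, b i' y ^ 2))) ≤
      ∑ y, ∑ y', g (cd i i') y y' * (b i y * b i' y') := by
    intro i i'
    split_ifs with h
    · have := neg_le_of_abs_le (hg _ h (b i) (b i')); linarith
    · have := hz _ (not_lt.1 h) (cd_le i i')
      simp [this]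
  refine le_trans ?_ (Finset.sum_le_sum fun i _ => Finset.sum_le_sum fun i' _ => h1 i i')
  simp only [Finset.sum_neg_distrib, neg_le_neg_iff]
  have e : ∑ i : ZMod m, ∑ i' : ZMod m, (if cd i i' < s0 then (1:ℝ) else 0) *
      (S / 2 * (∑ y, b i y ^ 2 + ∑ y, b i' y ^ 2)) =
      S * ∑ i : ZMod m, (∑ i' : ZMod m, (if cd i i' < s0 then (1:ℝ) else 0)) * ∑ y, b i y ^ 2 := by
    have e1 : ∑ i : ZMod m, ∑ i' : ZMod m, (if cd i i' < s0 then (1:ℝ) else 0) * (S / 2 * ∑ y, b i' y ^ 2) =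
        ∑ i : ZMod m, ∑ i' : ZMod m, (if cd i i' < s0 then (1:ℝ) else 0) * (S / 2 * ∑ y, b i y ^ 2) := by
      refine Finset.sum_comm.trans ?_
      refine Finset.sum_congr rfl fun i _ => Finset.sum_congr rfl fun i' _ => ?_
      rw [cd_comm]
    simp only [mul_add, Finset.sum_add_distrib]
    rw [e1, Finset.mul_sum, ← Finset.sum_add_distrib]
    refine Finset.sum_congr rfl fun i _ => ?_
    rw [← Finset.sum_mul]; ring
  rw [e, mul_assoc, Finset.mul_sum (a := 2 * (s0:ℝ))]
  refine mul_le_mul_of_nonneg_left (Finset.sum_le_sum fun i _ => ?_) hS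
  refine mul_le_mul_of_nonneg_right ?_ (Finset.sum_nonneg fun y _ => sq_nonneg _)
  rw [Finset.sum_boole]
  exact_mod_cast near_card s0 i

lemma kernel (e : ℕ → ι → ι → ℝ) (s0 : ℕ) (hs : 1 ≤ s0) (S : ℝ) (hS : 0 ≤ S) (hb : ∀ s, BdF (e s) S)
    (hsym : ∀ s, s ≤ m → ∀ y y', e (m - s) y y' = e s y y')
    (hp : ∀ s, s0 ≤ s → s + s0 ≤ m → PSD (e s))
    (hd : ∀ t, s0 + 1 ≤ t → t + s0 + 1 ≤ m →
      PSD (fun y y' => e (t - 1) y y' - 2 * e t y y' + e (t + 1) y y'))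
    (b : ZMod m → ι → ℝ) :
    - (S * (2 + 2 * s0) * (2 * s0) * ∑ i, ∑ y, b i y ^ 2) ≤
      ∑ i, ∑ i', ∑ y, ∑ y', e (cd i i') y y' * (b i y * b i' y') := by
  have hB : 0 ≤ ∑ i, ∑ y, b i y ^ 2 := Finset.sum_nonneg fun i _ => Finset.sum_nonneg fun y _ => sq_nonneg _
  have hs' : (1:ℝ) ≤ s0 := by exact_mod_cast hs
  by_cases hm : m < 2 * s0 + 2
  · have := near_bound e (s0 + 1) S hS (fun s _ => hb s) (fun s h1 h2 => by omega) b
    push_cast at this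
    refine le_trans ?_ this
    rw [neg_le_neg_iff]
    have : 0 ≤ S * ∑ i, ∑ y, b i y ^ 2 := mul_nonneg hS hB
    have : S * (2 + 2 * s0) * (2 * s0) * ∑ i, ∑ y, b i y ^ 2 - S * (2 * (s0 + 1)) * ∑ i, ∑ y, b i y ^ 2 =
      (2 * s0 - 1) * (2 + 2 * s0) * (S * ∑ i, ∑ y, b i y ^ 2) := by ring
    have : 0 ≤ (2 * (s0:ℝ) - 1) * (2 + 2 * s0) * (S * ∑ i, ∑ y, b i y ^ 2) := by
      apply mul_nonneg _ (by assumption)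
      apply mul_nonneg <;> linarith
    linarith
  set f : ℕ → ι → ι → ℝ := fun s y y' => if s0 ≤ s then e s y y' else
    e s0 y y' + ((s0 - s : ℕ) : ℝ) * (e s0 y y' - e (s0 + 1) y y') with hf
  have fge : ∀ s, s0 ≤ s → f s = e s := fun s h => by simp [hf, h]
  have flt : ∀ s, s ≤ s0 → f s = fun y y' => e s0 y y' + ((s0:ℝ) - s) * (e s0 y y' - e (s0 + 1) y y') := by
    intro s h
    rcases h.lt_or_eq with h | h
    · funext y y'; simp only [hf, if_neg (not_le.2 h)]; rw [Nat.cast_sub h.le]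
    · subst h; funext y y'; simp [hf]
  set M := m / 2 with hM
  have P := polya f M hM (by rw [fge _ (by omega)]; exact hp M (by omega) (by omega))
    (by
      rw [fge M (by omega), fge (M - 1) (by omega)]
      have h := hd M (by omega) (by omega)
      intro w
      have hw := h w
      rcases Nat.even_or_odd' m with ⟨c, hc | hc⟩
      · have : ∀ y y', e (M + 1) y y' = e (M - 1) y y' := fun y y' => by
          rw [← hsym (M - 1) (by omega)]; congr 1; omega
        simp only [this] at hw
        have e1 : ∑ y, ∑ y', (e (M - 1) y y' - 2 * e M y y' + e (M - 1) y y') * (w y * w y') =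
          2 * ∑ y, ∑ y', (e (M - 1) y y' - e M y y') * (w y * w y') := by
          simp only [Finset.mul_sum]
          refine Finset.sum_congr rfl fun y _ => Finset.sum_congr rfl fun y' _ => by ring
        rw [e1] at hw; linarith
      · have : ∀ y y', e (M + 1) y y' = e M y y' := fun y y' => by
          rw [← hsym M (by omega)]; congr 1; omega
        simp only [this] at hw
        refine hw.trans_eq ?_
        refine Finset.sum_congr rfl fun y _ => Finset.sum_congr rfl fun y' _ => by ring)
    (by
      intro t h1 ht
      by_cases h : s0 + 1 ≤ t
      · rw [fge _ (by omega), fge t (by omega), fge (t + 1) (by omega)]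
        exact hd t h (by omega)
      · have z : ∀ y y', f (t - 1) y y' - 2 * f t y y' + f (t + 1) y y' = 0 := by
          intro y y'
          rw [flt (t - 1) (by omega), flt t (by omega)]
          have c1 : ((t - 1 : ℕ) : ℝ) = t - 1 := by rw [Nat.cast_sub h1]; simp
          rcases Nat.lt_or_ge t s0 with h2 | h2
          · rw [flt (t + 1) (by omega)]
            simp only [c1]; push_cast; ring
          · have : t = s0 := by omega
            subst this
            rw [fge (t + 1) (by omega)]
            simp only [c1]; ring
        intro w; simp [z])
    b
  have Q := near_bound (fun s y y' => e s y y' - f s y y') s0 (S * (2 + 2 * s0)) (by positivity)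
    (by
      intro s h
      rw [flt s h.le]
      have hh := ((hb s).add (((hb s0).smul (-(1 + (s0 - s)))).add ((hb (s0 + 1)).smul (s0 - s))))
      intro w w'
      have := hh w w'
      refine le_trans (le_of_eq ?_) (this.trans ?_)
      · congr 1
        refine Finset.sum_congr rfl fun y _ => Finset.sum_congr rfl fun y' _ => by ring
      · have p : (0:ℝ) ≤ s0 - s := by rw [sub_nonneg]; exact_mod_cast h.le
        have p' : (0:ℝ) ≤ s := by positivity
        rw [abs_neg, abs_of_nonneg p, abs_of_nonneg (by linarith : (0:ℝ) ≤ 1 + (s0 - s))]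
        refine mul_le_mul_of_nonneg_right ?_ (add_nonneg (Finset.sum_nonneg fun y _ => sq_nonneg _)
          (Finset.sum_nonneg fun y _ => sq_nonneg _))
        nlinarith)
    (by intro s h1 _ y y'; rw [fge s h1]; ring) b
  have T : ∑ i, ∑ i', ∑ y, ∑ y', e (cd i i') y y' * (b i y * b i' y') =
      ∑ i, ∑ i', ∑ y, ∑ y', f (cd i i') y y' * (b i y * b i' y') +
      ∑ i, ∑ i', ∑ y, ∑ y', (e (cd i i') y y' - f (cd i i') y y') * (b i y * b i' y') := by
    simp only [← Finset.sum_add_distrib]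
    refine Finset.sum_congr rfl fun i _ => Finset.sum_congr rfl fun i' _ =>
      Finset.sum_congr rfl fun y _ => Finset.sum_congr rfl fun y' _ => by ring
  rw [T]
  linarith
end polya

section app
variable {n : ℕ} [NeZero n]

lemma shInv_Ah (k : ℕ) (x : Vt n) : ShInv (Ah k x) := (shInv_Cc _ _ _).sub (shInv_Cc _ _ _)

lemma Ah_trans (k : ℕ) (x a : Vt n) (h : Cfg n) : Ah k x (fun z => h (z + a)) = Ah k (x + a) h := by
  unfold Ah; rw [Cc_trans, Cc_trans]

lemma Cc_rfx (k : ℕ) (x : Vt n) (s : Bool) (h : Cfg n) :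
    Cc (fun z => h (rfx z)) x (true, s) k = Cc h (rfx x) (true, !s) k := by
  unfold Cc
  have e : -(fun x => h (rfx x)) = fun x => (-h) (rfx x) := rfl
  have a := pat_aut (rfxH n) h x (dv n (true, s)) (qv n (true, s)) k
  have b := pat_aut (rfxH n) (-h) x (dv n (true, s)) (qv n (true, s)) k
  have e2 : rfxH n (dv n (true, s)) = dv n (true, !s) := by cases s <;> simp [rfxH, rfx, dv, ax]
  have e3 : rfxH n (qv n (true, s)) = qv n (true, !s) := by simp [rfxH, rfx, qv, ax]
  rw [e2, e3] at a b
  rw [e]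
  exact congrArg₂ _ (ind_congr a) (ind_congr b)

lemma Ah_rfx (k : ℕ) (x : Vt n) (h : Cfg n) : Ah k x (fun z => h (rfx z)) = - Ah k (rfx x) h := by
  unfold Ah; rw [Cc_rfx, Cc_rfx]; simp

noncomputable def cc (k : ℕ) (r : ZMod n) (y y' : ZMod n) : ℝ :=
  Sm (fun h => Ah k (0, y) h * Ah k (r, y') h)

lemma cc_trans (k : ℕ) (a b y y' : ZMod n) :
    Sm (fun h => Ah k (a, y) h * Ah k (b, y') h) = cc k (b - a) y y' := by
  have := Sm_trans (a, 0) (fun h => Ah k (0, y) h * Ah k (b - a, y') h)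
    ((shInv_Ah _ _).mul (shInv_Ah _ _))
  simp only [Ah_trans] at this
  rw [cc, ← this]
  simp

lemma cc_neg (k : ℕ) (r y y' : ZMod n) : cc k (-r) y y' = cc k r y y' := by
  have := Sm_rfx (fun h => Ah k (0, y) h * Ah k (r, y') h) ((shInv_Ah _ _).mul (shInv_Ah _ _))
  simp only [Ah_rfx] at this
  rw [cc, cc, ← this]
  simp [rfx]

noncomputable def Vv (k : ℕ) (a : ZMod n) (w : ZMod n → ℝ) (h : Cfg n) : ℝ := ∑ y, w y * Ah k (a, y) h

lemma Sm_V (k : ℕ) (a b : ZMod n) (w w' : ZMod n → ℝ) :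
    Sm (fun h => Vv k a w h * Vv k b w' h) = ∑ y, ∑ y', cc k (b - a) y y' * (w y * w' y') := by
  have : ∀ h, Vv k a w h * Vv k b w' h = ∑ y, ∑ y', (w y * w' y') * (Ah k (a, y) h * Ah k (b, y') h) := by
    intro h
    unfold Vv
    rw [Finset.sum_mul_sum]
    exact Finset.sum_congr rfl fun y _ => Finset.sum_congr rfl fun y' _ => by ring
  simp only [this, Sm_sum, Sm_mul_left, cc_trans]
  exact Finset.sum_congr rfl fun y _ => Finset.sum_congr rfl fun y' _ => by ring

lemma V_rfx (k : ℕ) (a : ZMod n) (w : ZMod n → ℝ) (h : Cfg n) :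
    Vv k a w (fun z => h (rfx z)) = - Vv k (-a) w h := by
  unfold Vv; simp only [Ah_rfx, mul_neg, Finset.sum_neg_distrib]; rfl

lemma V_sq_bound (hn : Even n) (h4 : 4 ≤ n) (j : ℕ) (a : ZMod n) (w : ZMod n → ℝ) :
    Sm (fun h => Vv (j + 1) a w h ^ 2) ≤ 2 * sg (j + 1) * Nn n * ∑ y, w y ^ 2 := by
  have := col_bound hn h4 j w
  refine le_trans (le_of_eq ?_) this
  have e := Sm_V (j + 1) a a w w
  have e' := Sm_V (j + 1) 0 0 w w
  simp only [sub_self] at e e'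
  simp only [sq]
  exact e.trans e'.symm

lemma bdF_e (hn : Even n) (h4 : 4 ≤ n) (j : ℕ) (r : ZMod n) :
    BdF (fun y y' => - cc (j + 1) r y y') (2 * sg (j + 1) * Nn n) := by
  intro w w'
  have e := Sm_V (j + 1) 0 r w w'
  rw [sub_zero] at e
  simp only [neg_mul, Finset.sum_neg_distrib]
  rw [abs_neg, ← e]
  have a := V_sq_bound hn h4 j 0 w
  have b := V_sq_bound hn h4 j r w'
  have : |Sm (fun h => Vv (j + 1) 0 w h * Vv (j + 1) r w' h)| ≤
      Sm (fun h => 1 / 2 * (Vv (j + 1) 0 w h ^ 2 + Vv (j + 1) r w' h ^ 2)) := by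
    refine (Finset.abs_sum_le_sum_abs _ _).trans (Finset.sum_le_sum fun h _ => ?_)
    rw [abs_mul, ← sq_abs (Vv (j + 1) 0 w h), ← sq_abs (Vv (j + 1) r w' h)]
    nlinarith [sq_nonneg (|Vv (j + 1) 0 w h| - |Vv (j + 1) r w' h|)]
  rw [Sm_mul_left, Sm_add] at this
  linarith

lemma Cc_dep (h h' : Cfg n) (p : Vt n) (δ : Dir) (k : ℕ)
    (ha : ∀ x ∈ supp p (dv n δ) (qv n δ) k, h x = h' x) : Cc h p δ k = Cc h' p δ k := by
  have := Cc_supp h' (h - h') p δ k fun x hx => by simp [ha x hx]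
  rw [← this]; congr 1; simp

lemma DepH_Ah (hn : Even n) (k s : ℕ) (h1 : k + 1 ≤ s) (h2 : s + (k + 1) ≤ n / 2) (y : ZMod n) :
    DepH (Ah k ((s : ZMod n), y)) := by
  intro h h' H
  have n0 := NeZero.pos n
  have mem : ∀ (b : Bool) x, x ∈ supp ((s : ZMod n), y) (dv n (true, b)) (qv n (true, b)) k → inH x := by
    classical
    intro b x hx
    unfold supp at hx
    obtain ⟨⟨i, q⟩, hq, rfl⟩ := Finset.mem_image.1 hx
    simp only [Finset.mem_product, Finset.mem_range, Finset.mem_insert, Finset.mem_singleton] at hq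
    obtain ⟨hi, hq⟩ := hq
    have q0 : q.1 = 0 := by
      rcases hq with rfl | rfl | rfl <;> simp [qv, ax]
    unfold inH
    cases b
    · have e : (((s : ZMod n), y) + i • dv n (true, false) + q).1 = ((s - i : ℕ) : ZMod n) := by
        rw [Nat.cast_sub (by omega)]
        simp [q0, dv, ax]; ring
      show (((s : ZMod n), y) + i • dv n (true, false) + q).1.val ≤ n / 2
      rw [e, ZMod.val_natCast_of_lt (by omega)]; omega
    · have e : (((s : ZMod n), y) + i • dv n (true, true) + q).1 = ((s + i : ℕ) : ZMod n) := by
        simp [q0, dv, ax]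
      show (((s : ZMod n), y) + i • dv n (true, true) + q).1.val ≤ n / 2
      rw [e, ZMod.val_natCast_of_lt (by omega)]; omega
  unfold Ah
  rw [Cc_dep h h' _ _ _ fun x hx => H x (mem _ x hx), Cc_dep h h' _ (true, false) _ fun x hx => H x (mem _ x hx)]

lemma DepH_V (hn : Even n) (k s : ℕ) (h1 : k + 1 ≤ s) (h2 : s + (k + 1) ≤ n / 2) (w : ZMod n → ℝ) :
    DepH (Vv k (s : ZMod n) w) := fun h h' H =>
  Finset.sum_congr rfl fun y _ => by rw [DepH_Ah hn k s h1 h2 y h h' H]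

lemma psd_e (hn : Even n) (k s : ℕ) (h1 : k + 1 ≤ s) (h2 : s + (k + 1) ≤ n / 2) :
    PSD (fun y y' => - cc k ((2 * s : ℕ) : ZMod n) y y') := by
  intro w
  have := rp_nonneg hn _ (DepH_V hn k s h1 h2 w)
  simp only [V_rfx, mul_neg, Sm_neg, Sm_V] at this
  simp only [neg_mul, Finset.sum_neg_distrib]
  refine this.trans_eq ?_
  congr 1
  refine Finset.sum_congr rfl fun y _ => Finset.sum_congr rfl fun y' _ => ?_
  rw [← cc_neg]
  congr 2
  push_cast; ring

lemma psd_d (hn : Even n) (k t : ℕ) (h1 : k + 2 ≤ t) (h2 : t + (k + 2) ≤ n / 2) :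
    PSD (fun y y' => - cc k ((2 * (t - 1) : ℕ) : ZMod n) y y' - 2 * - cc k ((2 * t : ℕ) : ZMod n) y y' +
      - cc k ((2 * (t + 1) : ℕ) : ZMod n) y y') := by
  intro w
  have D : DepH (fun h => Vv k ((t - 1 : ℕ) : ZMod n) w h - Vv k ((t + 1 : ℕ) : ZMod n) w h) := fun h h' H => by
    show _ - _ = _ - _
    rw [DepH_V hn k (t - 1) (by omega) (by omega) w h h' H, DepH_V hn k (t + 1) (by omega) (by omega) w h h' H]
  have := rp_nonneg hn _ D
  simp only [V_rfx] at this
  have e : ∀ h : Cfg n, (Vv k ((t - 1 : ℕ) : ZMod n) w h - Vv k ((t + 1 : ℕ) : ZMod n) w h) *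
      (- Vv k (-((t - 1 : ℕ) : ZMod n)) w h - - Vv k (-((t + 1 : ℕ) : ZMod n)) w h) =
      (Vv k ((t - 1 : ℕ) : ZMod n) w h * Vv k (-((t + 1 : ℕ) : ZMod n)) w h +
        Vv k ((t + 1 : ℕ) : ZMod n) w h * Vv k (-((t - 1 : ℕ) : ZMod n)) w h) -
      (Vv k ((t - 1 : ℕ) : ZMod n) w h * Vv k (-((t - 1 : ℕ) : ZMod n)) w h +
        Vv k ((t + 1 : ℕ) : ZMod n) w h * Vv k (-((t + 1 : ℕ) : ZMod n)) w h) := fun h => by ring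
  simp only [e, Sm_sub, Sm_add, Sm_V] at this
  simp only [← Finset.sum_add_distrib, ← Finset.sum_sub_distrib] at this
  refine this.trans_eq ?_
  refine Finset.sum_congr rfl fun y _ => Finset.sum_congr rfl fun y' _ => ?_
  have c1 : ((t - 1 : ℕ) : ZMod n) = t - 1 := by rw [Nat.cast_sub (by omega)]; simp
  have a1 : cc k (-((t + 1 : ℕ) : ZMod n) - ((t - 1 : ℕ) : ZMod n)) y y' = cc k ((2 * t : ℕ) : ZMod n) y y' := by
    rw [← cc_neg, c1]; congr 1; push_cast; ring
  have a2 : cc k (-((t - 1 : ℕ) : ZMod n) - ((t + 1 : ℕ) : ZMod n)) y y' = cc k ((2 * t : ℕ) : ZMod n) y y' := by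
    rw [← cc_neg, c1]; congr 1; push_cast; ring
  have a3 : cc k (-((t - 1 : ℕ) : ZMod n) - ((t - 1 : ℕ) : ZMod n)) y y' = cc k ((2 * (t - 1) : ℕ) : ZMod n) y y' := by
    rw [← cc_neg, Nat.cast_mul, c1]; congr 1; push_cast; ring
  have a4 : cc k (-((t + 1 : ℕ) : ZMod n) - ((t + 1 : ℕ) : ZMod n)) y y' = cc k ((2 * (t + 1) : ℕ) : ZMod n) y y' := by
    rw [← cc_neg]; congr 1; push_cast; ring
  rw [a1, a2, a3, a4]; ring

lemma zsum {M : Type*} [AddCommMonoid M] (f : ZMod n → M) :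
    ∑ a, f a = ∑ t ∈ Finset.range n, f (t : ZMod n) := by
  refine Finset.sum_nbij' (fun a => a.val) (fun t => (t : ZMod n)) ?_ ?_ ?_ ?_ ?_
  · intro a _; exact Finset.mem_range.2 (ZMod.val_lt a)
  · intro a _; exact Finset.mem_univ _
  · intro a _; simp
  · intro a ha; exact ZMod.val_natCast_of_lt (Finset.mem_range.1 ha)
  · intro a _; simp

lemma range_two (m : ℕ) (f : ℕ → ℝ) : ∑ t ∈ Finset.range (2 * m), f t =
    ∑ s ∈ Finset.range m, f (2 * s) + ∑ s ∈ Finset.range m, f (2 * s + 1) := by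
  induction m with
  | zero => simp
  | succ m ih =>
    rw [show 2 * (m + 1) = 2 * m + 1 + 1 by ring, Finset.sum_range_succ, Finset.sum_range_succ, ih,
      Finset.sum_range_succ, Finset.sum_range_succ]; ring

lemma split_par (m : ℕ) [NeZero m] (hm : n = 2 * m) (f : ZMod n → ℝ) :
    ∑ a, f a = ∑ i : ZMod m, f ((2 * i.val + 0 : ℕ) : ZMod n) + ∑ i : ZMod m, f ((2 * i.val + 1 : ℕ) : ZMod n) := by
  rw [zsum f, zsum (fun i : ZMod m => f ((2 * i.val + 0 : ℕ) : ZMod n)),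
    zsum (fun i : ZMod m => f ((2 * i.val + 1 : ℕ) : ZMod n)), congrArg Finset.range hm,
    range_two m (fun t : ℕ => f (t : ZMod n))]
  congr 1 <;>
  · refine Finset.sum_congr rfl fun s hs => ?_
    rw [ZMod.val_natCast_of_lt (Finset.mem_range.1 hs)]
    try rfl

lemma cc_cd (m : ℕ) [NeZero m] (hm : n = 2 * m) (k ε : ℕ) (i i' : ZMod m) (y y' : ZMod n) :
    cc k (((2 * i'.val + ε : ℕ) : ZMod n) - ((2 * i.val + ε : ℕ) : ZMod n)) y y' =
      cc k ((2 * cd i i' : ℕ) : ZMod n) y y' := by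
  have key : ∀ i i' : ZMod m, ((2 * (i' - i).val : ℕ) : ZMod n) =
      ((2 * i'.val + ε : ℕ) : ZMod n) - ((2 * i.val + ε : ℕ) : ZMod n) := by
    intro i i'
    have h : ((i' - i).val + i.val) ≡ i'.val [MOD m] := by
      have := ZMod.val_add (i' - i) i
      rw [sub_add_cancel] at this
      unfold Nat.ModEq
      rw [← this, Nat.mod_eq_of_lt (ZMod.val_lt i')]
    have h2 := Nat.ModEq.mul_left' 2 h
    rw [← hm] at h2
    have h3 := (ZMod.natCast_eq_natCast_iff _ _ n).2 h2
    push_cast at h3 ⊢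
    linear_combination h3
  unfold cd
  rcases le_total (i - i').val (i' - i).val with h | h
  · rw [min_eq_left h, key, ← cc_neg]; congr 1; ring
  · rw [min_eq_right h, key]

lemma par_bound (hn : Even n) (h4 : 4 ≤ n) (m : ℕ) [NeZero m] (hm : n = 2 * m) (j ε : ℕ) (b : ZMod m → ZMod n → ℝ) :
    Sm (fun h => (∑ i : ZMod m, Vv (j + 1) ((2 * i.val + ε : ℕ) : ZMod n) (b i) h) ^ 2) ≤
      8 * ((j + 3) * (j + 2)) * sg (j + 1) * Nn n * ∑ i, ∑ y, b i y ^ 2 := by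
  have hN := Nn_nonneg n
  have hs := sg_nonneg (j + 1)
  have K := kernel (m := m) (fun s y y' => - cc (n := n) (j + 1) ((2 * s : ℕ) : ZMod n) y y') (j + 2) (by omega)
    (2 * sg (j + 1) * Nn n) (by positivity) (fun s => bdF_e hn h4 j _)
    (fun s hs y y' => by
      rw [← cc_neg]; congr 2
      rw [Nat.mul_sub, ← hm, Nat.cast_sub (by omega)]; simp)
    (fun s h1 h2 => psd_e hn (j + 1) s (by omega) (by omega))
    (fun t h1 h2 => psd_d hn (j + 1) t (by omega) (by omega)) b
  have e : Sm (fun h => (∑ i : ZMod m, Vv (j + 1) ((2 * i.val + ε : ℕ) : ZMod n) (b i) h) ^ 2) =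
      - ∑ i, ∑ i', ∑ y, ∑ y', - cc (n := n) (j + 1) ((2 * cd i i' : ℕ) : ZMod n) y y' * (b i y * b i' y') := by
    simp only [sq, Finset.sum_mul_sum, Sm_sum, Sm_V, neg_mul, Finset.sum_neg_distrib, neg_neg]
    refine Finset.sum_congr rfl fun i _ => Finset.sum_congr rfl fun i' _ =>
      Finset.sum_congr rfl fun y _ => Finset.sum_congr rfl fun y' _ => ?_
    rw [cc_cd m hm]
  rw [e, neg_le]
  refine le_trans (le_of_eq ?_) K
  push_cast; ring

lemma hor_bound (hn : Even n) (h4 : 4 ≤ n) (j : ℕ) (b : Vt n → ℝ) :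
    Sm (fun h => (∑ x, b x * Ah (j + 1) x h) ^ 2) ≤
      16 * ((j + 3) * (j + 2)) * sg (j + 1) * Nn n * ∑ x, b x ^ 2 := by
  obtain ⟨m, hm'⟩ := id hn
  have hm : n = 2 * m := by omega
  haveI : NeZero m := ⟨by omega⟩
  have e : ∀ h : Cfg n, ∑ x, b x * Ah (j + 1) x h =
      ∑ i : ZMod m, Vv (j + 1) ((2 * i.val + 0 : ℕ) : ZMod n) (fun y => b (((2 * i.val + 0 : ℕ) : ZMod n), y)) h +
      ∑ i : ZMod m, Vv (j + 1) ((2 * i.val + 1 : ℕ) : ZMod n) (fun y => b (((2 * i.val + 1 : ℕ) : ZMod n), y)) h := by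
    intro h
    rw [Fintype.sum_prod_type, split_par m hm]; rfl
  have e2 : ∑ x, b x ^ 2 = ∑ i : ZMod m, ∑ y, b (((2 * i.val + 0 : ℕ) : ZMod n), y) ^ 2 +
      ∑ i : ZMod m, ∑ y, b (((2 * i.val + 1 : ℕ) : ZMod n), y) ^ 2 := by
    rw [Fintype.sum_prod_type, split_par m hm]
  have p0 := par_bound hn h4 m hm j 0 (fun i y => b (((2 * i.val + 0 : ℕ) : ZMod n), y))
  have p1 := par_bound hn h4 m hm j 1 (fun i y => b (((2 * i.val + 1 : ℕ) : ZMod n), y))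
  have q : Sm (fun h => (∑ x, b x * Ah (j + 1) x h) ^ 2) ≤ Sm (fun h =>
      2 * (∑ i : ZMod m, Vv (j + 1) ((2 * i.val + 0 : ℕ) : ZMod n) (fun y => b (((2 * i.val + 0 : ℕ) : ZMod n), y)) h) ^ 2 +
      2 * (∑ i : ZMod m, Vv (j + 1) ((2 * i.val + 1 : ℕ) : ZMod n) (fun y => b (((2 * i.val + 1 : ℕ) : ZMod n), y)) h) ^ 2) := by
    refine Sm_mono fun h _ => ?_
    rw [e]
    exact (add_sq_le (a := _) (b := _)).trans (by linarith)
  rw [Sm_add, Sm_mul_left, Sm_mul_left] at q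
  refine q.trans ?_
  rw [e2]
  linarith

/-- antisymmetrised vertical pattern -/
noncomputable def Av (j : ℕ) (x : Vt n) (h : Cfg n) : ℝ := Cc h x (false, true) j - Cc h x (false, false) j

lemma Cc_swp (k : ℕ) (x : Vt n) (s : Bool) (h : Cfg n) :
    Cc (fun z => h (swp z)) x (true, s) k = Cc h (swp x) (false, s) k := by
  unfold Cc
  have e : -(fun x => h (swp x)) = fun x => (-h) (swp x) := rfl
  have a := pat_aut (swpH n) h x (dv n (true, s)) (qv n (true, s)) k
  have b := pat_aut (swpH n) (-h) x (dv n (true, s)) (qv n (true, s)) k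
  have e2 : swpH n (dv n (true, s)) = dv n (false, s) := by
    show swp _ = _
    cases s <;> simp [swp, dv, ax]
  have e3 : swpH n (qv n (true, s)) = qv n (false, s) := by
    show swp _ = _
    simp [swp, qv, ax]
  rw [e2, e3] at a b
  rw [e]
  exact congrArg₂ _ (ind_congr a) (ind_congr b)

lemma ver_bound (hn : Even n) (h4 : 4 ≤ n) (j : ℕ) (b : Vt n → ℝ) :
    Sm (fun h => (∑ x, b x * Av (j + 1) x h) ^ 2) ≤
      16 * ((j + 3) * (j + 2)) * sg (j + 1) * Nn n * ∑ x, b x ^ 2 := by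
  have H := hor_bound hn h4 j (fun x => b (swp x))
  have sw : ∀ f : Vt n → ℝ, ∑ x, f (swp x) = ∑ x, f x := fun f =>
    Equiv.sum_comp (⟨swp, swp, swp_swp, swp_swp⟩ : Vt n ≃ Vt n) f
  rw [sw (fun x => b x ^ 2)] at H
  refine le_trans (le_of_eq ?_) H
  have := Sm_swp (fun h => (∑ x, b (swp x) * Ah (j + 1) x h) ^ 2) (fun h c => by
    simp only [shInv_Ah (j + 1) _ h c])
  rw [← this]
  refine Sm_congr fun h _ => ?_
  congr 1
  rw [← sw]
  refine Finset.sum_congr rfl fun x _ => ?_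
  unfold Ah Av; rw [Cc_swp, Cc_swp]
end app

section err
variable {n : ℕ} [NeZero n]

lemma w_sum (M : ℕ) : ∑ j ∈ Finset.range M, 1 / (((j : ℝ) + 1) * (j + 2)) ≤ 1 := by
  have : ∑ j ∈ Finset.range M, 1 / (((j : ℝ) + 1) * (j + 2)) = 1 - 1 / ((M : ℝ) + 1) := by
    induction M with
    | zero => simp
    | succ M ih => rw [Finset.sum_range_succ, ih]; push_cast; field_simp; ring
  rw [this]
  have : 0 ≤ 1 / ((M : ℝ) + 1) := by positivity
  linarith

lemma w_cs (M : ℕ) (a : ℕ → ℝ) : (∑ j ∈ Finset.range M, a j) ^ 2 ≤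
    ∑ j ∈ Finset.range M, ((j : ℝ) + 1) * (j + 2) * a j ^ 2 := by
  have h := Finset.sum_sq_le_sum_mul_sum_of_sq_eq_mul (Finset.range M) (r := a)
    (f := fun j => 1 / (((j : ℝ) + 1) * (j + 2))) (g := fun j => ((j : ℝ) + 1) * (j + 2) * a j ^ 2)
    (fun j _ => by positivity) (fun j _ => by positivity) (fun j _ => by field_simp)
  refine h.trans ?_
  have : 0 ≤ ∑ j ∈ Finset.range M, ((j : ℝ) + 1) * (j + 2) * a j ^ 2 :=
    Finset.sum_nonneg fun j _ => by positivity
  nlinarith [w_sum M]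

/-- error term -/
noncomputable def Er (b1 b2 : Vt n → ℝ) (h : Cfg n) : ℝ :=
  ∑ j ∈ Finset.range n, (∑ x, b1 x * Ah (j + 1) x h + ∑ x, b2 x * Av (j + 1) x h)

noncomputable def CE : ℝ := 4 * (16 * 192 * 27 * Kg 1) * Kg 5

lemma CE_nonneg : 0 ≤ CE := by
  have := Kg_nonneg 1
  have := Kg_nonneg 5
  unfold CE; positivity

lemma Er_bound (hn : Even n) (h4 : 4 ≤ n) (b1 b2 : Vt n → ℝ) :
    Sm (fun h => Er b1 b2 h ^ 2) ≤ CE * Nn n * (∑ x, b1 x ^ 2 + ∑ x, b2 x ^ 2) := by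
  have hN := Nn_nonneg n
  have hK1 := Kg_nonneg 1
  have hr := rho_pos
  have hr1 := rho_lt
  set B := ∑ x, b1 x ^ 2 + ∑ x, b2 x ^ 2 with hB
  have hB0 : 0 ≤ B := add_nonneg (Finset.sum_nonneg fun _ _ => sq_nonneg _) (Finset.sum_nonneg fun _ _ => sq_nonneg _)
  have h1 : Sm (fun h => Er b1 b2 h ^ 2) ≤ ∑ j ∈ Finset.range n, ((j : ℝ) + 1) * (j + 2) *
      Sm (fun h => (∑ x, b1 x * Ah (j + 1) x h + ∑ x, b2 x * Av (j + 1) x h) ^ 2) := by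
    simp only [← Sm_mul_left]
    rw [← Sm_sum]
    exact Sm_mono fun h _ => w_cs n _
  refine h1.trans ?_
  have h2 : ∀ j ∈ Finset.range n, ((j : ℝ) + 1) * (j + 2) *
      Sm (fun h => (∑ x, b1 x * Ah (j + 1) x h + ∑ x, b2 x * Av (j + 1) x h) ^ 2) ≤
      (4 * (16 * 192 * 27 * Kg 1) * Nn n * B) * (((j : ℝ) + 1) ^ 5 * rho ^ j) := by
    intro j _
    have a1 := hor_bound hn h4 j b1
    have a2 := ver_bound hn h4 j b2
    have a3 : Sm (fun h => (∑ x, b1 x * Ah (j + 1) x h + ∑ x, b2 x * Av (j + 1) x h) ^ 2) ≤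
        2 * (16 * ((j + 3) * (j + 2)) * sg (j + 1) * Nn n * B) := by
      refine (Sm_mono (G := fun h => 2 * (∑ x, b1 x * Ah (j + 1) x h) ^ 2 + 2 * (∑ x, b2 x * Av (j + 1) x h) ^ 2)
        fun h _ => (add_sq_le (a := _) (b := _)).trans (by linarith)).trans ?_
      rw [Sm_add, Sm_mul_left, Sm_mul_left, hB]; linarith
    have a4 : 16 * (((j : ℝ) + 3) * (j + 2)) * sg (j + 1) ≤ 16 * 192 * 27 * Kg 1 * (((j : ℝ) + 1) ^ 3 * rho ^ j) := by
      unfold sg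
      have e : ((j : ℝ) + 3) * (j + 2) * (((j + 1 : ℕ) : ℝ) + 2) ≤ 27 * ((j : ℝ) + 1) ^ 3 := by
        push_cast
        have : (0 : ℝ) ≤ j := Nat.cast_nonneg j
        nlinarith [mul_nonneg this this, mul_nonneg (mul_nonneg this this) this]
      have e2 : rho ^ (j + 1) ≤ rho ^ j := pow_le_pow_of_le_one hr.le hr1.le (by omega)
      calc _ = 16 * 192 * Kg 1 * ((((j : ℝ) + 3) * (j + 2) * (((j + 1 : ℕ) : ℝ) + 2)) * rho ^ (j + 1)) := by ring
        _ ≤ 16 * 192 * Kg 1 * ((27 * ((j : ℝ) + 1) ^ 3) * rho ^ j) := by gcongr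
        _ = _ := by ring
    calc _ ≤ ((j : ℝ) + 1) * (j + 2) * (2 * (16 * ((j + 3) * (j + 2)) * sg (j + 1) * Nn n * B)) := by gcongr
      _ = (((j : ℝ) + 1) * (j + 2)) * 2 * (Nn n * B) * (16 * ((j + 3) * (j + 2)) * sg (j + 1)) := by ring
      _ ≤ (((j : ℝ) + 1) * (2 * (j + 1))) * 2 * (Nn n * B) * (16 * 192 * 27 * Kg 1 * (((j : ℝ) + 1) ^ 3 * rho ^ j)) := by
        gcongr
        · exact mul_nonneg (by positivity) (sg_nonneg _)
        · have : (0 : ℝ) ≤ j := Nat.cast_nonneg j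
          linarith
      _ = _ := by ring
  refine (Finset.sum_le_sum h2).trans ?_
  rw [← Finset.mul_sum]
  refine (mul_le_mul_of_nonneg_left (geo_sum 5 n) (by positivity)).trans (le_of_eq ?_)
  unfold CE; ring
end err

section pot
variable {n : ℕ} [NeZero n]

noncomputable def En (φ : Vt n → ℝ) : ℝ := 1 / 2 * ∑ x : Vt n, ∑ δ : Dir, (φ (x + dv n δ) - φ x) ^ 2

lemma En_nonneg (φ : Vt n → ℝ) : 0 ≤ En φ :=
  mul_nonneg (by norm_num) (Finset.sum_nonneg fun _ _ => Finset.sum_nonneg fun _ _ => sq_nonneg _)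

lemma sum_Lap_self (φ : Vt n → ℝ) : ∑ x, φ x * Lap φ x = - En φ := by
  rw [sum_mul_Lap, En]; simp only [sq]; ring

lemma Lap_symm (φ χ : Vt n → ℝ) : ∑ x, φ x * Lap χ x = ∑ x, χ x * Lap φ x := by
  rw [sum_mul_Lap, sum_mul_Lap]; simp only [mul_comm]

lemma En_eq (φ : Vt n → ℝ) : En φ = ∑ x, (φ (x + (1, 0)) - φ x) ^ 2 + ∑ x, (φ (x + (0, 1)) - φ x) ^ 2 := by
  have h1 : ∑ x, (φ (x - (1, 0)) - φ x) ^ 2 = ∑ x, (φ (x + (1, 0)) - φ x) ^ 2 := by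
    rw [← Equiv.sum_comp (Equiv.addRight ((1, 0) : Vt n))]
    refine Finset.sum_congr rfl fun x _ => ?_
    simp only [Equiv.coe_addRight, add_sub_cancel_right]; ring
  have h2 : ∑ x, (φ (x - (0, 1)) - φ x) ^ 2 = ∑ x, (φ (x + (0, 1)) - φ x) ^ 2 := by
    rw [← Equiv.sum_comp (Equiv.addRight ((0, 1) : Vt n))]
    refine Finset.sum_congr rfl fun x _ => ?_
    simp only [Equiv.coe_addRight, add_sub_cancel_right]; ring
  unfold En
  simp only [sum_dir, Finset.sum_add_distrib, dv, ax, if_true, Bool.false_eq_true, if_false, ← sub_eq_add_neg, h1, h2]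
  ring

lemma grad_le (φ : Vt n → ℝ) (x : Vt n) (δ : Dir) : (φ (x + dv n δ) - φ x) ^ 2 ≤ En φ := by
  have key : ∀ x : Vt n, (φ (x + (1, 0)) - φ x) ^ 2 ≤ En φ ∧ (φ (x + (0, 1)) - φ x) ^ 2 ≤ En φ := by
    intro x
    have a1 := Finset.single_le_sum (f := fun x => (φ (x + (1, 0)) - φ x) ^ 2) (fun _ _ => sq_nonneg _) (Finset.mem_univ x)
    have a2 := Finset.single_le_sum (f := fun x => (φ (x + (0, 1)) - φ x) ^ 2) (fun _ _ => sq_nonneg _) (Finset.mem_univ x)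
    have b1 : 0 ≤ ∑ x, (φ (x + (1, 0)) - φ x) ^ 2 := Finset.sum_nonneg fun _ _ => sq_nonneg _
    have b2 : 0 ≤ ∑ x, (φ (x + (0, 1)) - φ x) ^ 2 := Finset.sum_nonneg fun _ _ => sq_nonneg _
    rw [En_eq]
    constructor <;> linarith
  rcases δ with ⟨a, s⟩
  cases s
  · have : φ (x + dv n (a, false)) - φ x = -(φ ((x + dv n (a, false)) + ax n a) - φ (x + dv n (a, false))) := by
      simp [dv]
    rw [this, neg_sq]
    cases a
    · exact (key _).2
    · exact (key _).1
  · cases a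
    · exact (key _).2
    · exact (key _).1

lemma const_of_grad (φ : Vt n → ℝ) (h : En φ = 0) (x : Vt n) : φ x = φ 0 := by
  have g : ∀ (x : Vt n) (δ : Dir), φ (x + dv n δ) = φ x := fun x δ => by
    have := grad_le φ x δ
    rw [h] at this
    have := pow_eq_zero_iff (two_ne_zero) |>.1 (le_antisymm this (sq_nonneg _))
    linarith
  have k : ∀ a b : ℕ, φ ((a : ZMod n), (b : ZMod n)) = φ 0 := by
    intro a b
    induction a with
    | zero =>
      induction b with
      | zero => simp; rfl
      | succ b ih =>
        rw [← ih, ← g (((0 : ℕ) : ZMod n), (b : ZMod n)) (false, true)]; simp [dv, ax]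
    | succ a ih => rw [← ih, ← g ((a : ZMod n), (b : ZMod n)) (true, true)]; simp [dv, ax]
  have := k x.1.val x.2.val
  simpa using this

noncomputable def LapL : (Vt n → ℝ) →ₗ[ℝ] (Vt n → ℝ) where
  toFun φ := fun x => Lap φ x - ∑ y, φ y
  map_add' φ χ := by
    funext x; simp only [Lap, Pi.add_apply, Finset.sum_add_distrib, Finset.sum_sub_distrib]; ring
  map_smul' c φ := by
    funext x; simp only [Lap, Pi.smul_apply, smul_eq_mul, ← Finset.mul_sum, RingHom.id_apply, ← mul_sub]

lemma LapL_sum (φ : Vt n → ℝ) : ∑ x, LapL φ x = - (n : ℝ) ^ 2 * ∑ y, φ y := by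
  show ∑ x, (Lap φ x - ∑ y, φ y) = _
  rw [Finset.sum_sub_distrib, sum_Lap, Finset.sum_const, Finset.card_univ, nsmul_eq_mul, card_Vt]; ring

lemma exists_pot (u v : Vt n) : ∃ Γ : Vt n → ℝ, ∀ x, Lap Γ x =
    (if x = v then 1 else 0) - (if x = u then 1 else 0) := by
  have hn0 : (n : ℝ) ^ 2 ≠ 0 := pow_ne_zero _ (Nat.cast_ne_zero.2 (NeZero.ne n))
  have inj : Function.Injective (LapL (n := n)) := by
    rw [← LinearMap.ker_eq_bot, LinearMap.ker_eq_bot']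
    intro φ hφ
    have h1 := LapL_sum φ
    rw [hφ] at h1
    simp only [Pi.zero_apply, Finset.sum_const_zero] at h1
    have h2 : ∑ y, φ y = 0 := by
      rcases mul_eq_zero.1 h1.symm with h | h
      · exact absurd (neg_eq_zero.1 h) hn0
      · exact h
    have h3 : ∀ x, Lap φ x = 0 := fun x => by
      have : LapL φ x = 0 := by rw [hφ]; rfl
      have e : LapL φ x = Lap φ x - ∑ y, φ y := rfl
      linarith
    have h4 : En φ = 0 := by
      have := sum_Lap_self φ
      simp only [h3, mul_zero, Finset.sum_const_zero] at this
      linarith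
    have h5 := const_of_grad φ h4
    have h6 : (n : ℝ) ^ 2 * φ 0 = 0 := by
      rw [← h2, ← card_Vt (n := n)]
      simp only [h5, Finset.sum_const, Finset.card_univ, nsmul_eq_mul]
    funext x
    rw [h5 x]; rcases mul_eq_zero.1 h6 with h | h
    · exact absurd h hn0
    · exact h
  obtain ⟨Γ, hΓ⟩ := (LinearMap.injective_iff_surjective.1 inj)
    (fun x => (if x = v then 1 else 0) - (if x = u then 1 else 0))
  refine ⟨Γ, fun x => ?_⟩
  have h1 := LapL_sum Γ
  rw [hΓ] at h1
  simp only [Finset.sum_sub_distrib, Finset.sum_ite_eq', Finset.mem_univ, if_true, sub_self] at h1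
  have h2 : ∑ y, Γ y = 0 := by
    rcases mul_eq_zero.1 h1.symm with h | h
    · exact absurd (neg_eq_zero.1 h) hn0
    · exact h
  have e : LapL Γ x = Lap Γ x - ∑ y, Γ y := rfl
  rw [hΓ, h2] at e
  simpa using e.symm

def IsPot (u v : Vt n) (Γ : Vt n → ℝ) : Prop := ∀ x, Lap Γ x = (if x = v then 1 else 0) - (if x = u then 1 else 0)

lemma IsPot.pair {u v : Vt n} {Γ : Vt n → ℝ} (hΓ : IsPot u v Γ) (φ : Vt n → ℝ) :
    ∑ x, φ x * Lap Γ x = φ v - φ u := by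
  simp only [hΓ _, mul_sub, Finset.sum_sub_distrib, mul_ite, mul_one, mul_zero, Finset.sum_ite_eq', Finset.mem_univ, if_true]

lemma IsPot.en {u v : Vt n} {Γ : Vt n → ℝ} (hΓ : IsPot u v Γ) : Γ u - Γ v = En Γ := by
  have h1 := hΓ.pair Γ
  rw [sum_Lap_self] at h1
  linarith

/-- Dirichlet principle -/
lemma IsPot.dir {u v : Vt n} {Γ : Vt n → ℝ} (hΓ : IsPot u v Γ) (φ : Vt n → ℝ) :
    (φ u - φ v) ^ 2 ≤ En Γ * En φ := by
  have h1 := hΓ.pair φ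
  rw [sum_mul_Lap] at h1
  have h2 : φ u - φ v = 1 / 2 * ∑ p : Vt n × Dir, (φ (p.1 + dv n p.2) - φ p.1) * (Γ (p.1 + dv n p.2) - Γ p.1) := by
    rw [Fintype.sum_prod_type]; linarith
  rw [h2]
  have cs := Finset.sum_mul_sq_le_sq_mul_sq Finset.univ (fun p : Vt n × Dir => φ (p.1 + dv n p.2) - φ p.1)
    (fun p : Vt n × Dir => Γ (p.1 + dv n p.2) - Γ p.1)
  unfold En
  rw [Fintype.sum_prod_type (f := fun p : Vt n × Dir => (φ (p.1 + dv n p.2) - φ p.1) ^ 2),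
    Fintype.sum_prod_type (f := fun p : Vt n × Dir => (Γ (p.1 + dv n p.2) - Γ p.1) ^ 2)] at cs
  rw [mul_pow]
  linarith

/-- Lipschitz -/
lemma pot_lip (Γ : Vt n → ℝ) (r : ℝ) (hr : 0 ≤ r) (h : En Γ ≤ r ^ 2) (x : Vt n) (δ : Dir) (i : ℕ) :
    |Γ (x + i • dv n δ) - Γ x| ≤ i * r := by
  induction i with
  | zero => simp
  | succ i ih =>
    have g := abs_le_of_sq_le_sq ((grad_le Γ (x + i • dv n δ) δ).trans h) hr
    have e : x + (i + 1) • dv n δ = x + i • dv n δ + dv n δ := by rw [add_smul, one_smul]; abel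
    rw [e]
    rw [abs_le] at *
    push_cast
    constructor <;> linarith [g.1, g.2, ih.1, ih.2]
end pot

section psi
variable {n : ℕ} [NeZero n]

noncomputable def Bf (Γ : Vt n → ℝ) (a : Bool) (x : Vt n) : ℝ := 1 / 2 * (Γ x + Γ (x - ax n (!a)))
noncomputable def Bh (Γ : Vt n → ℝ) (δ : Dir) (x : Vt n) : ℝ :=
  if δ.2 then Bf Γ δ.1 x else Bf Γ δ.1 (x - ax n δ.1)
noncomputable def ps (Γ : Vt n → ℝ) (z : Vt n) (δ : Dir) (k : ℕ) : ℝ :=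
  1 / 2 * (Bh Γ (dneg δ) z + Bh Γ δ (z + k • dv n δ))
noncomputable def bb (Γ : Vt n → ℝ) (a : Bool) (x : Vt n) : ℝ := Bf Γ a x - Bf Γ a (x - ax n a)
def cr (n : ℕ) (c : Dir) : Vt n := (if c.1 then (1, 0) else 0) + (if c.2 then (0, 1) else 0)
noncomputable def Gg (Γ : Vt n → ℝ) (x : Vt n) : ℝ := 1 / 4 * ∑ c : Dir, Γ (x - cr n c)
noncomputable def Xb (u v : Vt n) (h : Cfg n) : ℝ := 1 / 4 * ∑ c : Dir, ((h (u + cr n c) : ℝ) - h (v + cr n c))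

lemma ps_symm (Γ : Vt n → ℝ) (z : Vt n) (δ : Dir) (k : ℕ) :
    ps Γ (z + k • dv n δ) (dneg δ) k = ps Γ z δ k := by
  unfold ps
  rw [dneg_dneg, dv_dneg, smul_neg, add_neg_cancel_right]; ring

lemma ps_zero (Γ : Vt n → ℝ) (z : Vt n) (δ : Dir) : ps Γ z δ 0 = Gg Γ z := by
  unfold ps Gg
  rw [sum_dir]
  rcases δ with ⟨a, s⟩
  have e : z - (1, 0) - (0, 1) = z - (1, 1) := by ext <;> simp
  have e' : z - (0, 1) - (1, 0) = z - (1, 1) := by ext <;> simp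
  cases a <;> cases s <;> simp [Bh, Bf, dneg, ax, cr, e, e'] <;> ring

lemma ps_diff (Γ : Vt n → ℝ) (z : Vt n) (δ : Dir) (k : ℕ) :
    ps Γ z δ (k + 1) - ps Γ (z + dv n δ) δ k = - (1 / 2) * (if δ.2 then bb Γ δ.1 z else - bb Γ δ.1 z) := by
  unfold ps
  have e : z + (k + 1) • dv n δ = z + dv n δ + k • dv n δ := by rw [add_smul, one_smul]; abel
  rw [e]
  have e2 : Bh Γ (dneg δ) (z + dv n δ) = Bh Γ δ z := by
    rcases δ with ⟨a, s⟩
    cases s <;> simp [Bh, dneg, dv, sub_eq_add_neg]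
  rw [e2]
  rcases δ with ⟨a, s⟩
  cases s <;> simp [Bh, dneg, bb] <;> ring

lemma sum_Gg (Γ : Vt n → ℝ) {u v : Vt n} (hΓ : IsPot u v Γ) (h : Cfg n) :
    ∑ x, Gg Γ x * Lap (fun y => (h y : ℝ)) x = - Xb u v h := by
  unfold Gg Xb
  have key : ∀ c : Dir, ∑ x, Γ (x - cr n c) * Lap (fun y => (h y : ℝ)) x =
      (h (v + cr n c) : ℝ) - h (u + cr n c) := by
    intro c
    rw [← Equiv.sum_comp (Equiv.addRight (cr n c))]
    simp only [Equiv.coe_addRight, add_sub_cancel_right]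
    rw [← hΓ.pair (fun x => (h (x + cr n c) : ℝ)), ← Lap_symm]
    refine Finset.sum_congr rfl fun x _ => ?_
    unfold Lap
    simp only [add_right_comm]
  simp only [mul_assoc, ← Finset.mul_sum, Finset.sum_mul]
  rw [Finset.sum_comm]
  simp only [key, ← mul_neg, ← Finset.sum_neg_distrib, neg_sub]

lemma Yy_decomp (Γ : Vt n → ℝ) {u v : Vt n} (hΓ : IsPot u v Γ) {h : Cfg n} (hh : IsHom h) :
    Yy (ps Γ) h = - Xb u v h - Er (bb Γ true) (bb Γ false) h := by
  rw [Yy_eq (ps Γ) (Gg Γ) (ps_zero Γ) hh, sum_Gg Γ hΓ h]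
  simp only [ps_diff, sum_dir, if_true, Bool.false_eq_true, if_false]
  unfold Er Ah Av
  rw [sub_eq_add_neg, Finset.mul_sum, ← Finset.sum_neg_distrib]
  congr 1
  refine Finset.sum_congr rfl fun k _ => ?_
  rw [Finset.mul_sum, ← Finset.sum_add_distrib, ← Finset.sum_neg_distrib]
  refine Finset.sum_congr rfl fun x _ => ?_
  ring

lemma sum_bb (Γ : Vt n → ℝ) : ∑ x, bb Γ true x ^ 2 + ∑ x, bb Γ false x ^ 2 ≤ En Γ := by
  have key : ∀ (a : Bool), ∑ x, bb Γ a x ^ 2 ≤ ∑ x, (Γ (x + ax n a) - Γ x) ^ 2 := by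
    intro a
    have h1 : ∀ x, bb Γ a x ^ 2 ≤ 1 / 2 * (Γ ((x - ax n a) + ax n a) - Γ (x - ax n a)) ^ 2 +
        1 / 2 * (Γ ((x - ax n a - ax n (!a)) + ax n a) - Γ (x - ax n a - ax n (!a))) ^ 2 := by
      intro x
      have e : x - ax n a - ax n (!a) + ax n a = x - ax n (!a) := by abel
      rw [sub_add_cancel, e]
      unfold bb Bf
      nlinarith [sq_nonneg ((Γ x - Γ (x - ax n a)) - (Γ (x - ax n (!a)) - Γ (x - ax n a - ax n (!a))))]
    refine (Finset.sum_le_sum fun x _ => h1 x).trans (le_of_eq ?_)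
    rw [Finset.sum_add_distrib, ← Finset.mul_sum, ← Finset.mul_sum]
    have s1 := Equiv.sum_comp (Equiv.subRight (ax n a)) (fun x => (Γ (x + ax n a) - Γ x) ^ 2)
    have s2 := Equiv.sum_comp ((Equiv.subRight (ax n a)).trans (Equiv.subRight (ax n (!a)))) (fun x => (Γ (x + ax n a) - Γ x) ^ 2)
    simp only [Equiv.trans_apply, Equiv.subRight_apply] at s1 s2
    rw [s1, s2]; ring
  rw [En_eq]
  exact add_le_add (key true) (key false)

lemma ps_lip (Γ : Vt n → ℝ) (r : ℝ) (hr : 0 ≤ r) (h : En Γ ≤ r ^ 2) (y : Vt n) (δ : Dir) (k i : ℕ) (hi : i ≤ k) :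
    |ps Γ (y - i • dv n δ) δ k - Γ y| ≤ (k + 2) * r := by
  have L := pot_lip Γ r hr h
  have one : ∀ x a, |Γ (x - ax n a) - Γ x| ≤ r := by
    intro x a
    have := L x (a, false) 1
    simpa [dv, ← sub_eq_add_neg] using this
  have b1 : ∀ a x, |Bf Γ a x - Γ x| ≤ r := by
    intro a x
    have := one x (!a)
    unfold Bf
    rw [abs_le] at *
    constructor <;> linarith [this.1, this.2]
  have b2 : ∀ δ x, |Bh Γ δ x - Γ x| ≤ 2 * r := by
    rintro ⟨a, s⟩ x
    cases s
    · have := b1 a (x - ax n a)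
      have h2 := one x a
      simp only [Bh, Bool.false_eq_true, if_false]
      rw [abs_le] at *
      constructor <;> linarith [this.1, this.2, h2.1, h2.2]
    · have := b1 a x
      simp only [Bh, if_true]
      rw [abs_le] at *
      constructor <;> linarith [this.1, this.2]
  obtain ⟨m, rfl⟩ := Nat.exists_eq_add_of_le hi
  have e : y - i • dv n δ + (i + m) • dv n δ = y + m • dv n δ := by rw [add_smul]; abel
  have e2 : y - i • dv n δ = y + i • dv n (dneg δ) := by rw [dv_dneg, smul_neg, sub_eq_add_neg]
  have h1 := b2 (dneg δ) (y - i • dv n δ)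
  have h2 := b2 δ (y + m • dv n δ)
  have h3 := L y δ m
  have h4 := L y (dneg δ) i
  rw [← e2] at h4
  unfold ps
  rw [e]
  have m0 : 0 ≤ (m : ℝ) * r := by positivity
  have i0 : 0 ≤ (i : ℝ) * r := by positivity
  rw [abs_le] at *
  push_cast
  constructor <;> linarith [h1.1, h1.2, h2.1, h2.2, h3.1, h3.2, h4.1, h4.2]

lemma cr_lip (Γ : Vt n → ℝ) (r : ℝ) (hr : 0 ≤ r) (h : En Γ ≤ r ^ 2) (y : Vt n) (c : Dir) :
    |Γ (y + cr n c) - Γ y| ≤ 2 * r := by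
  have L := pot_lip Γ r hr h
  have o1 : ∀ x, |Γ (x + (1, 0)) - Γ x| ≤ r := fun x => by simpa [dv, ax] using L x (true, true) 1
  have o2 : ∀ x, |Γ (x + (0, 1)) - Γ x| ≤ r := fun x => by simpa [dv, ax] using L x (false, true) 1
  rcases c with ⟨a, s⟩
  cases a <;> cases s
  · simp [cr]; positivity
  · have := o2 y
    simp only [cr, Bool.false_eq_true, if_false, if_true, zero_add]; linarith
  · have := o1 y
    simp only [cr, Bool.false_eq_true, if_false, if_true, add_zero]; linarith
  · have h1 := o1 y
    have h2 := o2 (y + (1, 0))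
    simp only [cr, if_true, ← add_assoc]
    rw [abs_le] at *
    constructor <;> linarith [h1.1, h1.2, h2.1, h2.2]

/-- integration by parts for height differences -/
lemma ibp_diff (hn : 2 ≤ n) (Γ : Vt n → ℝ) (p q : Vt n) :
    - Sm (fun h => ((h p : ℝ) - h q) * Yy (ps Γ) h) = ∑ k ∈ Finset.range (n + 1), ∑ δ : Dir,
      wt k * Sm (fun h : Cfg n => Uu h 0 δ k) *
        (2 * ∑ i ∈ Finset.range (k + 1), (ps Γ (p - i • dv n δ) δ k - ps Γ (q - i • dv n δ) δ k)) := by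
  rw [Sm_ibp hn (ps Γ) (ps_symm Γ) _ (sh_diff p q), neg_neg]
  refine Finset.sum_congr rfl fun k hk => ?_
  rw [Finset.sum_comm]
  refine Finset.sum_congr rfl fun δ _ => ?_
  rcases Nat.lt_or_ge n (k + 2) with hk | hk
  · simp [Uu_large (show n ≤ k + 1 by omega), Sm]
  have e1 : ∀ z, Sm (fun h : Cfg n => (((((h + Tw z δ k) p : ℤ) : ℝ) - ((h + Tw z δ k) q : ℤ)) - ((h p : ℝ) - h q)) * Uu h z δ k) =
      ((Tw z δ k p : ℝ) - Tw z δ k q) * Sm (fun h : Cfg n => Uu h 0 δ k) := by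
    intro z
    rw [← Sm_Uu z, ← Sm_mul_left]
    refine Sm_congr fun h _ => ?_
    simp only [Pi.add_apply]; push_cast; ring
  have e2 : ∀ y : Vt n, ∑ z, ps Γ z δ k * (Tw z δ k y : ℝ) = 2 * ∑ i ∈ Finset.range (k + 1), ps Γ (y - i • dv n δ) δ k := by
    intro y
    have inj : Set.InjOn (fun i : ℕ => y - i • dv n δ) (Finset.range (k + 1)) := by
      intro i hi j hj hij
      simp only [Finset.coe_range, Set.mem_Iio] at hi hj
      have hij' : i • dv n δ = j • dv n δ := by simpa using hij
      rcases lt_trichotomy i j with h | h | h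
      · exact absurd (by rw [hij']) ((frame_dir n δ).ne_along h (by omega) 0)
      · exact h
      · exact absurd (by rw [hij']) ((frame_dir n δ).ne_along h (by omega) 0)
    rw [← Finset.sum_image (f := fun z => ps Γ z δ k) inj, Finset.mul_sum]
    refine (Finset.sum_subset (Finset.subset_univ (Finset.image (fun i : ℕ => y - i • dv n δ) (Finset.range (k + 1))))
      (f := fun z => ps Γ z δ k * (Tw z δ k y : ℝ)) ?_).symm.trans ?_
    · intro z _ hz
      rw [Tw_not_mem]; simp
      intro i hi he
      exact hz (Finset.mem_image.2 ⟨i, Finset.mem_range.2 (by omega), by rw [he]; simp⟩)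
    · refine Finset.sum_congr rfl fun z hz => ?_
      obtain ⟨i, hi, rfl⟩ := Finset.mem_image.1 hz
      have := Tw_mem (y - i • dv n δ) δ k i (by have := Finset.mem_range.1 hi; omega)
      rw [sub_add_cancel] at this
      rw [this]; push_cast; ring
  simp only [e1]
  rw [Finset.sum_sub_distrib, mul_sub, ← e2, ← e2, ← Finset.sum_sub_distrib, Finset.mul_sum]
  refine Finset.sum_congr rfl fun z _ => ?_
  ring
end psi

section fin
variable {n : ℕ} [NeZero n]

lemma wt_nonneg (k : ℕ) : 0 ≤ wt k := by unfold wt; split_ifs <;> norm_num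
lemma wt_le (k : ℕ) : wt k ≤ 2 := by unfold wt; split_ifs <;> norm_num

lemma Uk_nonneg (δ : Dir) (k : ℕ) : 0 ≤ Sm (fun h : Cfg n => Uu h 0 δ k) :=
  Sm_nonneg fun h _ => Uu_nonneg _ _ _ _

lemma Uk_le (hn : Even n) (h4 : 4 ≤ n) (δ : Dir) (k : ℕ) :
    Sm (fun h : Cfg n => Uu h 0 δ k) ≤ 2 * rho ^ k * Nn n := by
  refine (Uu_tail hn h4 0 δ k).trans ?_
  have := Nn_nonneg n
  have : rho ^ (2 * k) ≤ rho ^ k := pow_le_pow_of_le_one rho_pos.le rho_lt.le (by omega)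
  gcongr

lemma ps_two (Γ : Vt n → ℝ) {u v : Vt n} (hΓ : IsPot u v Γ) (r : ℝ) (hr : 0 ≤ r) (h : En Γ = r ^ 2) (c δ : Dir)
    (k i : ℕ) (hi : i ≤ k) :
    |ps Γ (u + cr n c - i • dv n δ) δ k - ps Γ (v + cr n c - i • dv n δ) δ k - r ^ 2| ≤ 2 * (k + 4) * r := by
  have a1 := ps_lip Γ r hr h.le (u + cr n c) δ k i hi
  have a2 := ps_lip Γ r hr h.le (v + cr n c) δ k i hi
  have b1 := cr_lip Γ r hr h.le u c
  have b2 := cr_lip Γ r hr h.le v c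
  have e := hΓ.en
  rw [abs_le] at *
  constructor <;> linarith [a1.1, a1.2, a2.1, a2.2, b1.1, b1.2, b2.1, b2.2]

lemma up_bound (hn : Even n) (h4 : 4 ≤ n) (Γ : Vt n → ℝ) {u v : Vt n} (hΓ : IsPot u v Γ) (r : ℝ) (hr : 0 ≤ r)
    (h : En Γ = r ^ 2) (c : Dir) :
    - Sm (fun h => ((h (u + cr n c) : ℝ) - h (v + cr n c)) * Yy (ps Γ) h) ≤ 288 * Kg 2 * Nn n * (r ^ 2 + 1) := by
  rw [ibp_diff (by omega)]
  have hN := Nn_nonneg n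
  have hrho := rho_pos
  have key : ∀ k ∈ Finset.range (n + 1), ∑ δ : Dir,
      wt k * Sm (fun h : Cfg n => Uu h 0 δ k) * (2 * ∑ i ∈ Finset.range (k + 1),
        (ps Γ (u + cr n c - i • dv n δ) δ k - ps Γ (v + cr n c - i • dv n δ) δ k)) ≤
      (288 * Nn n * (r ^ 2 + 1)) * (((k : ℝ) + 1) ^ 2 * rho ^ k) := by
    intro k _
    have t : ∀ δ : Dir, wt k * Sm (fun h : Cfg n => Uu h 0 δ k) * (2 * ∑ i ∈ Finset.range (k + 1),
        (ps Γ (u + cr n c - i • dv n δ) δ k - ps Γ (v + cr n c - i • dv n δ) δ k)) ≤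
        (72 * Nn n * (r ^ 2 + 1)) * (((k : ℝ) + 1) ^ 2 * rho ^ k) := by
      intro δ
      have s : ∑ i ∈ Finset.range (k + 1), (ps Γ (u + cr n c - i • dv n δ) δ k - ps Γ (v + cr n c - i • dv n δ) δ k) ≤
          ((k : ℝ) + 1) * (9 * (k + 1) * (r ^ 2 + 1)) := by
        have := Finset.sum_le_card_nsmul (Finset.range (k + 1)) (fun i : ℕ => ps Γ (u + cr n c - i • dv n δ) δ k - ps Γ (v + cr n c - i • dv n δ) δ k)
          (9 * ((k : ℝ) + 1) * (r ^ 2 + 1)) (fun i hi => by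
            have := (abs_le.1 (ps_two Γ hΓ r hr h c δ k i (by have := Finset.mem_range.1 hi; omega))).2
            have k0 : (0 : ℝ) ≤ k := Nat.cast_nonneg k
            have : 2 * ((k : ℝ) + 4) * r ≤ ((k : ℝ) + 4) * (r ^ 2 + 1) := by nlinarith [sq_nonneg (r - 1)]
            have : ((k : ℝ) + 5) * (r ^ 2 + 1) ≤ 9 * ((k : ℝ) + 1) * (r ^ 2 + 1) := by
              gcongr; linarith
            nlinarith)
        simpa using this
      have hW := wt_nonneg k
      have hW2 := wt_le k
      have hU := Uk_nonneg (n := n) δ k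
      have hU2 := Uk_le hn h4 δ k
      calc _ ≤ wt k * Sm (fun h : Cfg n => Uu h 0 δ k) * (2 * (((k : ℝ) + 1) * (9 * (k + 1) * (r ^ 2 + 1)))) := by gcongr
        _ ≤ 2 * (2 * rho ^ k * Nn n) * (2 * (((k : ℝ) + 1) * (9 * (k + 1) * (r ^ 2 + 1)))) := by gcongr
        _ = _ := by ring
    rw [sum_dir]
    linarith [t (true, true), t (true, false), t (false, true), t (false, false)]
  refine (Finset.sum_le_sum key).trans ?_
  rw [← Finset.mul_sum]
  refine (mul_le_mul_of_nonneg_left (geo_sum 2 (n + 1)) (by positivity)).trans (le_of_eq ?_)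
  ring

noncomputable def CL : ℝ := 1024 + 512 * Kg 3
lemma CL_pos : 0 < CL := by unfold CL; have := Kg_nonneg 3; positivity

lemma lo_bound (hn : Even n) (h4 : 4 ≤ n) (Γ : Vt n → ℝ) {u v : Vt n} (hΓ : IsPot u v Γ) (r : ℝ) (hr : 0 ≤ r)
    (h : En Γ = r ^ 2) :
    Nn n * (r ^ 2 / 2 - CL) ≤ - Sm (fun h => ((h u : ℝ) - h v) * Yy (ps Γ) h) := by
  have hN := Nn_nonneg n
  have hrho := rho_pos
  have P := fun δ k i hi => ps_two Γ hΓ r hr h (false, false) δ k i hi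
  have c0 : cr n (false, false) = 0 := by simp [cr]
  simp only [c0, add_zero] at P
  rw [ibp_diff (by omega)]
  have k0 : Nn n * (r ^ 2 / 2 - 512) ≤ ∑ δ : Dir,
      wt 0 * Sm (fun h : Cfg n => Uu h 0 δ 0) * (2 * ∑ i ∈ Finset.range (0 + 1),
        (ps Γ (u - i • dv n δ) δ 0 - ps Γ (v - i • dv n δ) δ 0)) := by
    have t : ∀ δ : Dir, Nn n * (r ^ 2 / 8 - 128) ≤ wt 0 * Sm (fun h : Cfg n => Uu h 0 δ 0) * (2 * ∑ i ∈ Finset.range (0 + 1),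
        (ps Γ (u - i • dv n δ) δ 0 - ps Γ (v - i • dv n δ) δ 0)) := by
      intro δ
      have a := (abs_le.1 (P δ 0 0 le_rfl)).1
      rw [Finset.sum_range_one]
      simp only [Uu_zero, Sm_Mn, wt, if_true, one_mul]
      have m := m1_lower (n := n) (by omega)
      have m2 : m1 n ≤ Nn n := by
        have := Sm_mono (F := fun h : Cfg n => ind (Mn h 0)) (G := fun _ => (1 : ℝ)) (fun h _ => ind_le_one _)
        rw [Sm_const, mul_one] at this; exact this
      have a2 : r ^ 2 / 2 - 32 ≤ ps Γ (u - 0 • dv n δ) δ 0 - ps Γ (v - 0 • dv n δ) δ 0 := by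
        push_cast at a
        nlinarith [sq_nonneg (r - 8)]
      have m0 : 0 ≤ m1 n := by linarith
      calc Nn n * (r ^ 2 / 8 - 128) ≤ m1 n * (2 * (r ^ 2 / 2 - 32)) := by nlinarith [sq_nonneg r]
        _ ≤ _ := by gcongr
    rw [sum_dir]
    linarith [t (true, true), t (true, false), t (false, true), t (false, false)]
  have key : ∀ k ∈ Finset.range n, - (512 * Nn n) * (((k + 1 : ℕ) + 1 : ℝ) ^ 3 * rho ^ (k + 1)) ≤ ∑ δ : Dir,
      wt (k + 1) * Sm (fun h : Cfg n => Uu h 0 δ (k + 1)) * (2 * ∑ i ∈ Finset.range (k + 1 + 1),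
        (ps Γ (u - i • dv n δ) δ (k + 1) - ps Γ (v - i • dv n δ) δ (k + 1))) := by
    intro k _
    generalize k + 1 = k
    have t : ∀ δ : Dir, - (128 * Nn n) * (((k : ℝ) + 1) ^ 3 * rho ^ k) ≤
        wt k * Sm (fun h : Cfg n => Uu h 0 δ k) * (2 * ∑ i ∈ Finset.range (k + 1),
        (ps Γ (u - i • dv n δ) δ k - ps Γ (v - i • dv n δ) δ k)) := by
      intro δ
      have s : ((k : ℝ) + 1) * (- (16 * (k + 1) ^ 2)) ≤ ∑ i ∈ Finset.range (k + 1), (ps Γ (u - i • dv n δ) δ k - ps Γ (v - i • dv n δ) δ k) := by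
        have := Finset.card_nsmul_le_sum (Finset.range (k + 1)) (fun i : ℕ => ps Γ (u - i • dv n δ) δ k - ps Γ (v - i • dv n δ) δ k)
          (- (16 * ((k : ℝ) + 1) ^ 2)) (fun i hi => by
            have := (abs_le.1 (P δ k i (by have := Finset.mem_range.1 hi; omega))).1
            have k0 : (0 : ℝ) ≤ k := Nat.cast_nonneg k
            nlinarith [sq_nonneg (r - (k + 4))])
        simpa using this
      have hW := wt_nonneg k
      have hW2 := wt_le k
      have hU := Uk_nonneg (n := n) δ k
      have hU2 := Uk_le hn h4 δ k
      have : wt k * Sm (fun h : Cfg n => Uu h 0 δ k) * (2 * (((k : ℝ) + 1) * (16 * (k + 1) ^ 2))) ≤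
          2 * (2 * rho ^ k * Nn n) * (2 * (((k : ℝ) + 1) * (16 * (k + 1) ^ 2))) := by gcongr
      calc _ = - (2 * (2 * rho ^ k * Nn n) * (2 * (((k : ℝ) + 1) * (16 * (k + 1) ^ 2)))) := by ring
        _ ≤ - (wt k * Sm (fun h : Cfg n => Uu h 0 δ k) * (2 * (((k : ℝ) + 1) * (16 * (k + 1) ^ 2)))) := neg_le_neg this
        _ = wt k * Sm (fun h : Cfg n => Uu h 0 δ k) * (2 * (((k : ℝ) + 1) * (- (16 * (k + 1) ^ 2)))) := by ring
        _ ≤ _ := by gcongr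
    rw [sum_dir]
    linarith [t (true, true), t (true, false), t (false, true), t (false, false)]
  rw [Finset.sum_range_succ']
  have S := Finset.sum_le_sum key
  rw [← Finset.mul_sum] at S
  have g := geo_sum 3 (n + 1)
  rw [Finset.sum_range_succ'] at g
  simp only [Nat.cast_zero, zero_add, one_pow, pow_zero, mul_one] at g
  have g2 : 512 * Nn n * ∑ k ∈ Finset.range n, ((((k + 1 : ℕ) : ℝ) + 1) ^ 3 * rho ^ (k + 1)) ≤ 512 * Nn n * Kg 3 := by
    gcongr; linarith
  unfold CL
  linarith

noncomputable def C1 : ℝ := 288 * Kg 2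
lemma C1_nonneg : 0 ≤ C1 := by unfold C1; have := Kg_nonneg 2; positivity

lemma Xb_sq (hn : Even n) (h4 : 4 ≤ n) (Γ : Vt n → ℝ) {u v : Vt n} (hΓ : IsPot u v Γ) :
    Sm (fun h => Xb u v h ^ 2) ≤ (2 * C1 + CE) * Nn n * (En Γ + 1) := by
  have hN := Nn_nonneg n
  obtain ⟨r, hr, h⟩ : ∃ r : ℝ, 0 ≤ r ∧ En Γ = r ^ 2 := ⟨√(En Γ), Real.sqrt_nonneg _, (Real.sq_sqrt (En_nonneg Γ)).symm⟩
  have U : - Sm (fun h => Xb u v h * Yy (ps Γ) h) ≤ C1 * Nn n * (En Γ + 1) := by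
    have e : Sm (fun h => Xb u v h * Yy (ps Γ) h) = 1 / 4 * ∑ c : Dir, Sm (fun h => ((h (u + cr n c) : ℝ) - h (v + cr n c)) * Yy (ps Γ) h) := by
      rw [← Sm_sum, ← Sm_mul_left]
      refine Sm_congr fun h _ => ?_
      unfold Xb; rw [mul_assoc, Finset.sum_mul]
    rw [e, sum_dir, h]
    have t := up_bound hn h4 Γ hΓ r hr h
    unfold C1
    linarith [t (true, true), t (true, false), t (false, true), t (false, false)]
  have e : Sm (fun h => Xb u v h ^ 2) = - Sm (fun h => Xb u v h * Yy (ps Γ) h) -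
      Sm (fun h => Xb u v h * Er (bb Γ true) (bb Γ false) h) := by
    rw [← Sm_neg, ← Sm_sub]
    refine Sm_congr fun h hh => ?_
    rw [Yy_decomp Γ hΓ (mem_Om.1 hh).1]; ring
  have E1 : - Sm (fun h => Xb u v h * Er (bb Γ true) (bb Γ false) h) ≤
      1 / 2 * Sm (fun h => Xb u v h ^ 2) + 1 / 2 * Sm (fun h => Er (bb Γ true) (bb Γ false) h ^ 2) := by
    rw [← Sm_neg, ← Sm_mul_left, ← Sm_mul_left, ← Sm_add]
    refine Sm_mono fun h _ => ?_
    nlinarith [sq_nonneg (Xb u v h + Er (bb Γ true) (bb Γ false) h)]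
  have E2 := Er_bound hn h4 (bb Γ true) (bb Γ false)
  have hC := CE_nonneg
  have E3 : CE * Nn n * (∑ x, bb Γ true x ^ 2 + ∑ x, bb Γ false x ^ 2) ≤ CE * Nn n * (En Γ + 1) := by
    exact mul_le_mul_of_nonneg_left (by linarith [sum_bb Γ]) (by positivity)
  linarith

lemma Y_sq (hn : Even n) (h4 : 4 ≤ n) (Γ : Vt n → ℝ) {u v : Vt n} (hΓ : IsPot u v Γ) :
    Sm (fun h => Yy (ps Γ) h ^ 2) ≤ 4 * (C1 + CE) * Nn n * (En Γ + 1) := by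
  have hN := Nn_nonneg n
  have hC := CE_nonneg
  have E2 := Er_bound hn h4 (bb Γ true) (bb Γ false)
  have E3 : CE * Nn n * (∑ x, bb Γ true x ^ 2 + ∑ x, bb Γ false x ^ 2) ≤ CE * Nn n * (En Γ + 1) := by
    exact mul_le_mul_of_nonneg_left (by linarith [sum_bb Γ]) (by positivity)
  have A := Xb_sq hn h4 Γ hΓ
  have : Sm (fun h => Yy (ps Γ) h ^ 2) ≤ 2 * Sm (fun h => Xb u v h ^ 2) + 2 * Sm (fun h => Er (bb Γ true) (bb Γ false) h ^ 2) := by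
    rw [← Sm_mul_left, ← Sm_mul_left, ← Sm_add]
    refine Sm_mono fun h hh => ?_
    rw [Yy_decomp Γ hΓ (mem_Om.1 hh).1]
    nlinarith [sq_nonneg (Xb u v h - Er (bb Γ true) (bb Γ false) h)]
  linarith

lemma cr_step {h : Cfg n} (hh : IsHom h) (y : Vt n) (c : Dir) : |((h (y + cr n c) : ℝ)) - h y| ≤ 2 := by
  have L : ∀ x δ, |((h (x + dv n δ) : ℝ)) - h x| ≤ 1 := by
    intro x δ
    rcases hh.abs_step (frame_dir n δ) x with h1 | h1 <;> rw [h1] <;> push_cast <;> simp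
  have o1 : ∀ x, |((h (x + (1, 0)) : ℝ)) - h x| ≤ 1 := fun x => by simpa [dv, ax] using L x (true, true)
  have o2 : ∀ x, |((h (x + (0, 1)) : ℝ)) - h x| ≤ 1 := fun x => by simpa [dv, ax] using L x (false, true)
  rcases c with ⟨a, s⟩
  cases a <;> cases s
  · simp [cr]
  · have := o2 y
    simp only [cr, Bool.false_eq_true, if_false, if_true, zero_add]; linarith
  · have := o1 y
    simp only [cr, Bool.false_eq_true, if_false, if_true, add_zero]; linarith
  · have h1 := o1 y
    have h2 := o2 (y + (1, 0))
    simp only [cr, if_true, ← add_assoc]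
    rw [abs_le] at *
    constructor <;> linarith [h1.1, h1.2, h2.1, h2.2]

lemma X_sq_upper (hn : Even n) (h4 : 4 ≤ n) (Γ : Vt n → ℝ) {u v : Vt n} (hΓ : IsPot u v Γ) :
    Sm (fun h => ((h u : ℝ) - h v) ^ 2) ≤ (4 * C1 + 2 * CE + 32) * Nn n * (En Γ + 1) := by
  have hN := Nn_nonneg n
  have hE := En_nonneg Γ
  have A := Xb_sq hn h4 Γ hΓ
  have : Sm (fun h => ((h u : ℝ) - h v) ^ 2) ≤ 2 * Sm (fun h => Xb u v h ^ 2) + Nn n * 32 := by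
    rw [← Sm_mul_left, ← Sm_const, ← Sm_add]
    refine Sm_mono fun h hh => ?_
    have D : |Xb u v h - ((h u : ℝ) - h v)| ≤ 4 := by
      have a := cr_step (mem_Om.1 hh).1 u
      have b := cr_step (mem_Om.1 hh).1 v
      have a' := fun c => abs_le.1 (a c)
      have b' := fun c => abs_le.1 (b c)
      unfold Xb; rw [sum_dir, abs_le]
      constructor <;> linarith [(a' (true, true)).1, (a' (true, false)).1, (a' (false, true)).1, (a' (false, false)).1,
        (a' (true, true)).2, (a' (true, false)).2, (a' (false, true)).2, (a' (false, false)).2,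
        (b' (true, true)).1, (b' (true, false)).1, (b' (false, true)).1, (b' (false, false)).1,
        (b' (true, true)).2, (b' (true, false)).2, (b' (false, true)).2, (b' (false, false)).2]
    have D2 := sq_le_sq' (abs_le.1 D).1 (abs_le.1 D).2
    nlinarith [sq_nonneg (Xb u v h + (Xb u v h - ((h u : ℝ) - h v)))]
  nlinarith

lemma X_sq_small (hn : 2 ≤ n) {u v : Vt n} (huv : u ≠ v) :
    Nn n / 8 ≤ Sm (fun h => ((h u : ℝ) - h v) ^ 2) := by
  have m := m1_lower hn
  have T := Sm_tower hn u (true, true) 0 (fun h => ((h u : ℝ) - h v) ^ 2) ((sh_diff u v).comp (fun t => t ^ 2))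
  have t1 : Tw u (true, true) 0 u = 2 := by simpa using Tw_mem u (true, true) 0 0 le_rfl
  have t2 : Tw u (true, true) 0 v = 0 := Tw_not_mem _ _ _ _ (fun i hi he => by
    obtain rfl : i = 0 := by omega
    apply huv; simpa using he.symm)
  simp only [zero_smul, add_zero, Uu_zero, Pi.add_apply, t1, t2] at T
  have a : Sm (fun h : Cfg n => ((h u : ℝ) - h v) ^ 2 * ind (Mn h u)) + Sm (fun h : Cfg n => ((h u : ℝ) - h v) ^ 2 * ind (Mn (-h) u)) ≤
      Sm (fun h => ((h u : ℝ) - h v) ^ 2) := by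
    rw [← Sm_add]
    refine Sm_mono fun h _ => ?_
    have : ind (Mn h u) + ind (Mn (-h) u) ≤ 1 := by
      by_cases h1 : Mn h u
      · rw [ind_false (P := Mn (-h) u), ind_true h1]; norm_num
        intro h2
        have f := (frame_dir n (true, true)).adjd u
        have q1 := h1 _ f
        have q2 := h2 _ f
        simp only [Pi.neg_apply] at q2
        omega
      · rw [ind_false h1, zero_add]; exact ind_le_one _
    nlinarith [sq_nonneg ((h u : ℝ) - h v)]
  have T' : Sm (fun h : Cfg n => ((h u : ℝ) - h v) ^ 2 * ind (Mn (-h) u)) =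
    Sm (fun h : Cfg n => ((((h u + 2 : ℤ)) : ℝ) - h v) ^ 2 * ind (Mn h u)) := by
    have e : ∀ h : Cfg n, Uu (-h) u (dneg (true, true)) 0 = ind (Mn (-h) u) := fun h => Uu_zero _ _ _
    simpa using T
  rw [T'] at a
  refine m.trans (le_trans ?_ a)
  rw [← Sm_Mn u, ← Sm_add]
  refine Sm_mono fun h _ => ?_
  have := ind_nonneg (Mn h u)
  push_cast
  nlinarith [sq_nonneg ((h u : ℝ) - h v + 1)]
end fin

section cone
variable {n : ℕ} [NeZero n]

lemma abel_w (g : ℕ → ℝ) (m : ℕ) : ∑ l ∈ Finset.range m, ((l : ℝ) + 1) * (g (l + 1) - g l) =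
    m * g m - ∑ l ∈ Finset.range m, g l := by
  induction m with
  | zero => simp
  | succ m ih => rw [Finset.sum_range_succ, ih, Finset.sum_range_succ]; push_cast; ring

lemma cone_step (f g : ℕ → ℝ) (i : ℕ) :
    ((∑ l ∈ Finset.range (i + 1), f l) / (i + 1) - (∑ l ∈ Finset.range (i + 2), g l) / (i + 2)) ^ 2 ≤
      2 / ((i : ℝ) + 1) * ∑ l ∈ Finset.range (i + 1), ((g l - f l) ^ 2 + (g (l + 1) - g l) ^ 2) := by
  set m : ℝ := (i : ℝ) + 1 with hm
  have hm0 : 0 < m := by positivity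
  have e : (∑ l ∈ Finset.range (i + 1), f l) / (i + 1) - (∑ l ∈ Finset.range (i + 2), g l) / (i + 2) =
      1 / m * ∑ l ∈ Finset.range (i + 1), ((f l - g l) - (((l : ℝ) + 1) / (m + 1)) * (g (l + 1) - g l)) := by
    have A := abel_w g (i + 1)
    have : ∑ l ∈ Finset.range (i + 1), ((f l - g l) - (((l : ℝ) + 1) / (m + 1)) * (g (l + 1) - g l)) =
        ∑ l ∈ Finset.range (i + 1), f l - ∑ l ∈ Finset.range (i + 1), g l - 1 / (m + 1) *
          (m * g (i + 1) - ∑ l ∈ Finset.range (i + 1), g l) := by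
      have hc : ((i + 1 : ℕ) : ℝ) = m := by push_cast; rfl
      rw [hc] at A
      rw [← A, Finset.sum_sub_distrib, Finset.sum_sub_distrib, Finset.mul_sum]
      congr 1
      refine Finset.sum_congr rfl fun l _ => ?_
      ring
    rw [this, show i + 2 = i + 1 + 1 by rfl, Finset.sum_range_succ g (i + 1)]
    have : (i : ℝ) + 2 = m + 1 := by rw [hm]; ring
    rw [this, ← hm]
    field_simp
    ring
  rw [e, mul_pow]
  have cs := sq_sum_le_card_mul_sum_sq (s := Finset.range (i + 1))
    (f := fun l => (f l - g l) - (((l : ℝ) + 1) / (m + 1)) * (g (l + 1) - g l))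
  rw [Finset.card_range] at cs
  have b : ∑ l ∈ Finset.range (i + 1), ((f l - g l) - (((l : ℝ) + 1) / (m + 1)) * (g (l + 1) - g l)) ^ 2 ≤
      ∑ l ∈ Finset.range (i + 1), 2 * ((g l - f l) ^ 2 + (g (l + 1) - g l) ^ 2) := by
    refine Finset.sum_le_sum fun l hl => ?_
    have hl' : (l : ℝ) + 1 ≤ m + 1 := by
      have : l < i + 1 := Finset.mem_range.1 hl
      have : (l : ℝ) ≤ i := by exact_mod_cast (by omega : l ≤ i)
      linarith
    have ht : ((l : ℝ) + 1) / (m + 1) ≤ 1 := (div_le_one (by positivity)).2 hl'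
    have ht0 : 0 ≤ ((l : ℝ) + 1) / (m + 1) := by positivity
    set t := ((l : ℝ) + 1) / (m + 1)
    have t2 : t ^ 2 ≤ 1 := by nlinarith
    have : (t * (g (l + 1) - g l)) ^ 2 ≤ (g (l + 1) - g l) ^ 2 := by
      rw [mul_pow]; nlinarith [sq_nonneg (g (l + 1) - g l)]
    nlinarith [sq_nonneg ((f l - g l) + t * (g (l + 1) - g l))]
  rw [← Finset.mul_sum] at b
  have hc : ((i + 1 : ℕ) : ℝ) = m := by push_cast; rfl
  rw [hc] at cs
  calc _ ≤ (1 / m) ^ 2 * (m * (2 * ∑ l ∈ Finset.range (i + 1), ((g l - f l) ^ 2 + (g (l + 1) - g l) ^ 2))) := by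
        gcongr; exact cs.trans (by gcongr)
    _ = _ := by field_simp

lemma cone_inj {d q : Vt n} (fr : Frame n d q) (t : ℕ) (ht : t ≤ n) (a : Vt n) (F : Vt n → ℝ) (hF : ∀ x, 0 ≤ F x) :
    ∑ i ∈ Finset.range t, ∑ l ∈ Finset.range (i + 1), F (a + i • d + l • q) ≤ ∑ x, F x := by
  have h1 : ∑ i ∈ Finset.range t, ∑ l ∈ Finset.range (i + 1), F (a + i • d + l • q) ≤
      ∑ i ∈ Finset.range t, ∑ l ∈ Finset.range t, F (a + i • d + l • q) := by
    refine Finset.sum_le_sum fun i hi => ?_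
    refine Finset.sum_le_sum_of_subset_of_nonneg ?_ fun _ _ _ => hF _
    exact Finset.range_subset_range.2 (by have := Finset.mem_range.1 hi; omega)
  refine h1.trans ?_
  rw [← Finset.sum_product']
  have inj : Set.InjOn (fun p : ℕ × ℕ => a + p.1 • d + p.2 • q) (Finset.range t ×ˢ Finset.range t : Finset (ℕ × ℕ)) := by
    rintro ⟨i, l⟩ hp ⟨i', l'⟩ hp' he
    simp only [Finset.coe_product, Finset.coe_range, Set.mem_prod, Set.mem_Iio] at hp hp'
    simp only at he
    have := fr.indep ((i : ℤ) - i') ((l : ℤ) - l') (by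
      rw [sub_smul, sub_smul]; simp only [natCast_zsmul]
      have : i • d + l • q = i' • d + l' • q := by
        rw [add_assoc, add_assoc] at he; exact add_left_cancel he
      rw [show i • d - i' • d + (l • q - l' • q) = (i • d + l • q) - (i' • d + l' • q) by abel, this, sub_self])
    have a1 := Int.eq_zero_of_abs_lt_dvd this.1 (by rw [abs_lt]; omega)
    have a2 := Int.eq_zero_of_abs_lt_dvd this.2 (by rw [abs_lt]; omega)
    ext <;> simp <;> omega
  rw [← Finset.sum_image (f := F) inj]
  exact Finset.sum_le_sum_of_subset_of_nonneg (Finset.subset_univ _) fun _ _ _ => hF _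

noncomputable def Hm (t : ℕ) : ℝ := ∑ i ∈ Finset.range t, 1 / ((i : ℝ) + 1)

noncomputable def Mc (φ : Vt n → ℝ) (a d q : Vt n) (i : ℕ) : ℝ :=
  (∑ l ∈ Finset.range (i + 1), φ (a + i • d + l • q)) / (i + 1)

lemma dir_sum_le (φ : Vt n → ℝ) (δ : Dir) :
    ∑ x, (φ (x + dv n δ) - φ x) ^ 2 + ∑ x, (φ (x + qv n δ) - φ x) ^ 2 ≤ En φ := by
  have neg : ∀ a : Bool, ∑ x, (φ (x - ax n a) - φ x) ^ 2 = ∑ x, (φ (x + ax n a) - φ x) ^ 2 := by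
    intro a
    rw [← Equiv.sum_comp (Equiv.addRight (ax n a))]
    refine Finset.sum_congr rfl fun x _ => ?_
    simp only [Equiv.coe_addRight, add_sub_cancel_right]; ring
  have e : ∑ x, (φ (x + dv n δ) - φ x) ^ 2 = ∑ x, (φ (x + ax n δ.1) - φ x) ^ 2 := by
    rcases δ with ⟨a, s⟩
    cases s
    · rw [← neg]; simp [dv, sub_eq_add_neg]
    · simp [dv]
  rw [e, En_eq]
  rcases δ with ⟨a, s⟩
  cases a
  · simp only [qv, ax, Bool.not_false, if_true, Bool.false_eq_true, if_false]; linarith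
  · simp only [qv, ax, Bool.not_true, if_true, Bool.false_eq_true, if_false]; linarith

lemma cone_bound (φ : Vt n → ℝ) (δ : Dir) (t : ℕ) (ht : t ≤ n) (a : Vt n) :
    (φ a - Mc φ a (dv n δ) (qv n δ) t) ^ 2 ≤ 2 * Hm t * En φ := by
  set d := dv n δ with hd
  set q := qv n δ with hq
  have fr : Frame n d q := frame_dir n δ
  have st : ∀ i : ℕ, (Mc φ a d q i - Mc φ a d q (i + 1)) ^ 2 ≤ 2 / ((i : ℝ) + 1) * ∑ l ∈ Finset.range (i + 1),
      ((φ (a + i • d + l • q + d) - φ (a + i • d + l • q)) ^ 2 +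
       (φ (a + d + i • d + l • q + q) - φ (a + d + i • d + l • q)) ^ 2) := by
    intro i
    have := cone_step (fun l => φ (a + i • d + l • q)) (fun l => φ (a + (i + 1) • d + l • q)) i
    unfold Mc
    have c : (((i + 1 : ℕ) : ℝ) + 1) = (i : ℝ) + 2 := by push_cast; ring
    rw [c]
    refine this.trans (le_of_eq ?_)
    congr 1
    refine Finset.sum_congr rfl fun l _ => ?_
    have e1 : a + (i + 1) • d + l • q = a + i • d + l • q + d := by rw [add_smul, one_smul]; abel
    have e2 : a + d + i • d + l • q = a + i • d + l • q + d := by abel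
    have e3 : a + (i + 1) • d + (l + 1) • q = a + i • d + l • q + d + q := by
      rw [add_smul, one_smul, add_smul, one_smul]; abel
    simp only [e1, e2, e3]
  have M0 : Mc φ a d q 0 = φ a := by simp [Mc]
  rw [← M0, ← Finset.sum_range_sub' (fun i => Mc φ a d q i) t]
  have cs := Finset.sum_sq_le_sum_mul_sum_of_sq_le_mul (Finset.range t)
    (r := fun i => Mc φ a d q i - Mc φ a d q (i + 1)) (f := fun i => 2 / ((i : ℝ) + 1))
    (g := fun i => ∑ l ∈ Finset.range (i + 1),
      ((φ (a + i • d + l • q + d) - φ (a + i • d + l • q)) ^ 2 +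
       (φ (a + d + i • d + l • q + q) - φ (a + d + i • d + l • q)) ^ 2)) (fun i _ => by positivity)
    (fun i _ => Finset.sum_nonneg fun _ _ => by positivity) (fun i _ => st i)
  refine cs.trans ?_
  have h1 : ∑ i ∈ Finset.range t, 2 / ((i : ℝ) + 1) = 2 * Hm t := by
    unfold Hm; rw [Finset.mul_sum]; refine Finset.sum_congr rfl fun i _ => by ring
  rw [h1]
  have H0 : 0 ≤ Hm t := Finset.sum_nonneg fun _ _ => by positivity
  refine mul_le_mul_of_nonneg_left ?_ (by positivity)
  simp only [Finset.sum_add_distrib]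
  refine le_trans (add_le_add ?_ ?_) (dir_sum_le φ δ)
  · exact cone_inj fr t ht a (fun x => (φ (x + d) - φ x) ^ 2) fun _ => sq_nonneg _
  · exact cone_inj fr t ht (a + d) (fun x => (φ (x + q) - φ x) ^ 2) fun _ => sq_nonneg _

lemma Hm_mono {s t : ℕ} (h : s ≤ t) : Hm s ≤ Hm t :=
  Finset.sum_le_sum_of_subset_of_nonneg (Finset.range_subset_range.2 h) fun _ _ _ => by positivity

lemma Hm_log (t : ℕ) : Hm t ≤ 1 + Real.log t := by
  have := harmonic_le_one_add_log t
  unfold Hm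
  rw [harmonic] at this
  push_cast at this
  simpa [one_div] using this

lemma line_bound (φ : Vt n → ℝ) (δ : Dir) (m : ℕ) (hm : m ≤ n) (a : Vt n) :
    (φ (a + m • dv n δ) - φ a) ^ 2 ≤ (16 * Hm m + 2) * En φ := by
  have hE := En_nonneg φ
  have H0 : 0 ≤ Hm m := Finset.sum_nonneg fun _ _ => by positivity
  have ev : ∀ t : ℕ, 2 * t ≤ m → (φ (a + (2 * t) • dv n δ) - φ a) ^ 2 ≤ 8 * Hm m * En φ := by
    intro t ht
    have c1 := cone_bound φ δ t (by omega) a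
    have c2 := cone_bound φ (dneg δ) t (by omega) (a + (2 * t) • dv n δ)
    have e : Mc φ (a + (2 * t) • dv n δ) (dv n (dneg δ)) (qv n (dneg δ)) t = Mc φ a (dv n δ) (qv n δ) t := by
      unfold Mc
      rw [qv_dneg, dv_dneg]
      congr 1
      refine Finset.sum_congr rfl fun l _ => ?_
      congr 2
      rw [smul_neg, two_mul, add_smul]; abel
    rw [e] at c2
    have hH : Hm t * En φ ≤ Hm m * En φ := mul_le_mul_of_nonneg_right (Hm_mono (by omega)) hE
    nlinarith [sq_nonneg ((φ a - Mc φ a (dv n δ) (qv n δ) t) + (φ (a + (2 * t) • dv n δ) - Mc φ a (dv n δ) (qv n δ) t))]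
  rcases Nat.even_or_odd' m with ⟨t, ht | ht⟩
  · have := ev t (by omega)
    rw [ht] at this ⊢
    have h0 : 0 ≤ Hm (2 * t) * En φ := mul_nonneg (by rw [← ht]; exact H0) hE
    nlinarith
  · have h1 := ev t (by omega)
    have h2 := grad_le φ (a + (2 * t) • dv n δ) δ
    have e : a + m • dv n δ = a + (2 * t) • dv n δ + dv n δ := by rw [ht, add_smul, one_smul]; abel
    rw [e]
    nlinarith [sq_nonneg ((φ (a + (2 * t) • dv n δ + dv n δ) - φ (a + (2 * t) • dv n δ)) - (φ (a + (2 * t) • dv n δ) - φ a))]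
end cone

section logest
variable {n : ℕ} [NeZero n]

lemma zdist_eq (x y : ZMod n) : zdist n x y = (x - y).valMinAbs.natAbs := by
  rw [ZMod.valMinAbs_natAbs_eq_min, zdist, show y - x = -(x - y) by ring, ZMod.neg_val]
  split_ifs with h
  · rw [h]; simp
  · rfl

lemma vma_one : (1 : ZMod n).valMinAbs.natAbs ≤ 1 := by
  rw [ZMod.valMinAbs_natAbs_eq_min]
  refine (min_le_left _ _).trans ?_
  rcases Nat.lt_or_ge 1 n with h | h
  · haveI : Fact (1 < n) := ⟨h⟩
    rw [ZMod.val_one]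
  · have := ZMod.val_lt (1 : ZMod n); omega

lemma zdist_step (x y : ZMod n) : zdist n (x + 1) y ≤ zdist n x y + 1 ∧ zdist n x y ≤ zdist n (x + 1) y + 1 := by
  have key : ∀ a : ZMod n, ∀ b : ZMod n, b.valMinAbs.natAbs ≤ 1 → (a + b).valMinAbs.natAbs ≤ a.valMinAbs.natAbs + 1 := by
    intro a b hb
    have h1 := ZMod.natAbs_valMinAbs_add_le a b
    have h2 := Int.natAbs_add_le a.valMinAbs b.valMinAbs
    omega
  rw [zdist_eq, zdist_eq]
  constructor
  · have := key (x - y) 1 vma_one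
    rwa [show x - y + 1 = x + 1 - y by ring] at this
  · have := key (x + 1 - y) (-1) (by rw [ZMod.natAbs_valMinAbs_neg]; exact vma_one)
    rwa [show x + 1 - y + -1 = x - y by ring] at this

lemma log_step (p q : ℕ) (h1 : p ≤ q + 1) (h2 : q ≤ p + 1) :
    (Real.log (1 + p) - Real.log (1 + q)) ^ 2 ≤ 4 / (1 + (q : ℝ)) ^ 2 := by
  have hp : (0 : ℝ) < 1 + p := by positivity
  have hq : (0 : ℝ) < 1 + q := by positivity
  have h1' : (p : ℝ) ≤ q + 1 := by exact_mod_cast h1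
  have h2' : (q : ℝ) ≤ p + 1 := by exact_mod_cast h2
  have a1 : Real.log (1 + p) - Real.log (1 + q) ≤ 2 / (1 + q) := by
    rw [← Real.log_div hp.ne' hq.ne']
    refine (Real.log_le_sub_one_of_pos (by positivity)).trans ?_
    rw [div_sub_one hq.ne']
    gcongr
    linarith
  have a2 : -(2 / (1 + (q : ℝ))) ≤ Real.log (1 + p) - Real.log (1 + q) := by
    have : Real.log (1 + q) - Real.log (1 + p) ≤ 2 / (1 + q) := by
      rw [← Real.log_div hq.ne' hp.ne']
      refine (Real.log_le_sub_one_of_pos (by positivity)).trans ?_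
      rw [div_sub_one hp.ne', div_le_div_iff₀ hp hq]
      have : (0 : ℝ) ≤ p := by positivity
      nlinarith
    linarith
  have := sq_le_sq' a2 a1
  rw [div_pow] at this
  norm_num at this
  exact this

lemma zd_sum (f : ℕ → ℝ) (hf : ∀ i, 0 ≤ f i) (b : ZMod n) :
    ∑ a : ZMod n, f (zdist n a b) ≤ 2 * ∑ i ∈ Finset.range n, f i := by
  have e0 : ∑ a : ZMod n, f a.val = ∑ i ∈ Finset.range n, f i := by
    rw [zsum]
    refine Finset.sum_congr rfl fun t ht => ?_
    rw [ZMod.val_natCast_of_lt (Finset.mem_range.1 ht)]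
  have e1 : ∑ a : ZMod n, f (a - b).val = ∑ i ∈ Finset.range n, f i := by
    rw [← e0]; exact Equiv.sum_comp (Equiv.subRight b) (fun a : ZMod n => f a.val)
  have e2 : ∑ a : ZMod n, f (b - a).val = ∑ i ∈ Finset.range n, f i := by
    rw [← e0]; exact Equiv.sum_comp (Equiv.subLeft b) (fun a : ZMod n => f a.val)
  calc _ ≤ ∑ a : ZMod n, (f (a - b).val + f (b - a).val) := by
        refine Finset.sum_le_sum fun a _ => ?_
        unfold zdist
        rcases min_choice (a - b).val (b - a).val with h | h <;> rw [h]
        · linarith [hf (b - a).val]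
        · linarith [hf (a - b).val]
    _ = _ := by rw [Finset.sum_add_distrib, e1, e2]; ring

lemma inv_sq_sum (i m : ℕ) : ∑ j ∈ Finset.range m, 1 / (1 + (i : ℝ) + j) ^ 2 ≤ 2 / (1 + (i : ℝ)) - 2 / (1 + (i : ℝ) + m) := by
  induction m with
  | zero => simp
  | succ m ih =>
    rw [Finset.sum_range_succ]
    have : 1 / (1 + (i : ℝ) + m) ^ 2 ≤ 2 / (1 + (i : ℝ) + m) - 2 / (1 + (i : ℝ) + (m + 1 : ℕ)) := by
      push_cast
      have hk : (0 : ℝ) ≤ i + m := by positivity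
      set k : ℝ := i + m
      rw [show 1 + (i : ℝ) + m = 1 + k by simp only [k]; ring, show 1 + (i : ℝ) + (m + 1) = 2 + k by simp only [k]; ring]
      rw [div_sub_div _ _ (by positivity) (by positivity), div_le_div_iff₀ (by positivity) (by positivity)]
      nlinarith [mul_nonneg hk hk, mul_nonneg hk (mul_nonneg hk hk)]
    linarith

lemma tor_sum (d : ℕ) (v : Vt n) :
    ∑ x : Vt n, (if torusDist n x v ≤ d then 1 / (1 + (torusDist n x v : ℝ)) ^ 2 else 0) ≤ 8 * Hm (d + 1) := by
  set G : ℕ → ℕ → ℝ := fun i j => if i ≤ d then 1 / (1 + (i : ℝ) + j) ^ 2 else 0 with hG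
  have G0 : ∀ i j, 0 ≤ G i j := by
    intro i j; simp only [hG]; split_ifs <;> positivity
  calc _ ≤ ∑ x : Vt n, G (zdist n x.1 v.1) (zdist n x.2 v.2) := by
        refine Finset.sum_le_sum fun x _ => ?_
        simp only [hG, torusDist]
        push_cast
        by_cases h : zdist n x.1 v.1 + zdist n x.2 v.2 ≤ d
        · rw [if_pos h, if_pos (by omega), add_assoc]
        · rw [if_neg h]; split_ifs <;> positivity
    _ = ∑ a : ZMod n, ∑ b : ZMod n, G (zdist n a v.1) (zdist n b v.2) := by
        rw [Fintype.sum_prod_type]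
    _ ≤ ∑ a : ZMod n, 2 * ∑ j ∈ Finset.range n, G (zdist n a v.1) j :=
        Finset.sum_le_sum fun a _ => zd_sum (fun j => G (zdist n a v.1) j) (G0 _) v.2
    _ ≤ 2 * ∑ i ∈ Finset.range n, 2 * ∑ j ∈ Finset.range n, G i j :=
        zd_sum (fun i => 2 * ∑ j ∈ Finset.range n, G i j)
          (fun i => mul_nonneg two_pos.le (Finset.sum_nonneg fun j _ => G0 i j)) v.1
    _ ≤ 2 * ∑ i ∈ Finset.range n, (if i ≤ d then 4 * (1 / ((i : ℝ) + 1)) else 0) := by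
        refine mul_le_mul_of_nonneg_left (Finset.sum_le_sum fun i _ => ?_) two_pos.le
        simp only [hG]
        split_ifs
        · have := inv_sq_sum i n
          have h2 : (0 : ℝ) ≤ 2 / (1 + (i : ℝ) + n) := by positivity
          have h3 : 2 / (1 + (i : ℝ)) = 2 * (1 / ((i : ℝ) + 1)) := by rw [add_comm]; ring
          linarith
        · simp
    _ = 2 * ∑ i ∈ (Finset.range n).filter (· ≤ d), 4 * (1 / ((i : ℝ) + 1)) := by
        rw [Finset.sum_filter]
    _ ≤ 2 * ∑ i ∈ Finset.range (d + 1), 4 * (1 / ((i : ℝ) + 1)) := by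
        refine mul_le_mul_of_nonneg_left (Finset.sum_le_sum_of_subset_of_nonneg ?_ fun i _ _ => by positivity) two_pos.le
        intro i hi
        have := (Finset.mem_filter.1 hi).2
        exact Finset.mem_range.2 (by omega)
    _ = _ := by rw [← Finset.mul_sum, Hm]; ring

lemma zdist_self (x : ZMod n) : zdist n x x = 0 := by simp [zdist]

lemma pot_lower (u v : Vt n) (hd : 2 ≤ torusDist n u v) {Γ : Vt n → ℝ} (hΓ : IsPot u v Γ) :
    Real.log (torusDist n u v) ≤ 128 * En Γ := by
  set d := torusDist n u v with hdd
  set φ : Vt n → ℝ := fun x => Real.log (1 + (min (torusDist n x v) d : ℕ)) with hφ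
  have hv : φ v = 0 := by
    simp [hφ, torusDist, zdist_self]
  have hu : φ u = Real.log (1 + d) := by
    simp only [hφ]; rw [← hdd, min_self]
  have step : ∀ x e : Vt n, torusDist n (x + e) v ≤ torusDist n x v + 1 → torusDist n x v ≤ torusDist n (x + e) v + 1 →
      (φ (x + e) - φ x) ^ 2 ≤ 4 * (if torusDist n x v ≤ d then 1 / (1 + (torusDist n x v : ℝ)) ^ 2 else 0) := by
    intro x e h1 h2
    simp only [hφ]
    by_cases h : torusDist n x v ≤ d
    · rw [if_pos h]
      refine (log_step _ _ (by omega) (by omega)).trans (le_of_eq ?_)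
      rw [min_eq_left h]; ring
    · rw [if_neg h, min_eq_right (by omega : d ≤ torusDist n x v), min_eq_right (by omega : d ≤ torusDist n (x + e) v)]
      simp
  have hE : En φ ≤ 64 * Hm (d + 1) := by
    rw [En_eq]
    have t := tor_sum d v
    have s1 : ∑ x, (φ (x + (1, 0)) - φ x) ^ 2 ≤ 4 * (8 * Hm (d + 1)) := by
      refine le_trans (Finset.sum_le_sum fun x _ => step x (1, 0) ?_ ?_) ?_
      · have := zdist_step x.1 v.1
        simp only [torusDist, Prod.fst_add, Prod.snd_add, add_zero]; omega
      · have := zdist_step x.1 v.1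
        simp only [torusDist, Prod.fst_add, Prod.snd_add, add_zero]; omega
      · rw [← Finset.mul_sum]; linarith
    have s2 : ∑ x, (φ (x + (0, 1)) - φ x) ^ 2 ≤ 4 * (8 * Hm (d + 1)) := by
      refine le_trans (Finset.sum_le_sum fun x _ => step x (0, 1) ?_ ?_) ?_
      · have := zdist_step x.2 v.2
        simp only [torusDist, Prod.fst_add, Prod.snd_add, add_zero]; omega
      · have := zdist_step x.2 v.2
        simp only [torusDist, Prod.fst_add, Prod.snd_add, add_zero]; omega
      · rw [← Finset.mul_sum]; linarith
    linarith
  have hH := Hm_log (d + 1)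
  have D := hΓ.dir φ
  rw [hu, hv, sub_zero] at D
  have hd' : (2 : ℝ) ≤ d := by exact_mod_cast hd
  have L1 : 1 ≤ Real.log (1 + d) := by
    rw [Real.le_log_iff_exp_le (by positivity)]
    have := Real.exp_one_lt_d9
    linarith
  push_cast at hH
  rw [add_comm (d : ℝ) 1] at hH
  have hE2 : En φ ≤ 128 * Real.log (1 + d) := by linarith
  have mono : Real.log d ≤ Real.log (1 + d) := Real.log_le_log (by positivity) (by linarith)
  have := mul_le_mul_of_nonneg_left hE2 (En_nonneg Γ)
  have : Real.log (1 + d) ≤ 128 * En Γ := by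
    by_contra hc
    push Not at hc
    nlinarith
  linarith

/-- a coordinate displacement as a multiple of a unit step -/
lemma zd_steps (x y : ZMod n) : ∃ s : Bool, x = y + (zdist n x y : ℕ) • (if s then (1 : ZMod n) else -1) := by
  unfold zdist
  rcases min_choice (x - y).val (y - x).val with h | h <;> rw [h]
  · refine ⟨true, ?_⟩
    simp
  · refine ⟨false, ?_⟩
    simp

lemma zdist_le (x y : ZMod n) : zdist n x y ≤ n :=
  (min_le_left _ _).trans (ZMod.val_lt _).le

lemma pot_upper (u v : Vt n) (hd : 2 ≤ torusDist n u v) {Γ : Vt n → ℝ} (hΓ : IsPot u v Γ) :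
    En Γ ≤ 300 * Real.log (torusDist n u v) := by
  obtain ⟨s, hs⟩ := zd_steps u.1 v.1
  obtain ⟨s', hs'⟩ := zd_steps u.2 v.2
  set d := torusDist n u v with hdd
  have hd' : (2 : ℝ) ≤ d := by exact_mod_cast hd
  have hij : d = zdist n u.1 v.1 + zdist n u.2 v.2 := rfl
  set i := zdist n u.1 v.1
  set j := zdist n u.2 v.2
  have H : ∀ m ≤ d, Hm m ≤ 1 + Real.log d := fun m hm => (Hm_mono hm).trans (Hm_log d)
  have e : u = v + i • dv n (true, s) + j • dv n (false, s') := by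
    ext
    · rw [hs]; cases s <;> cases s' <;> simp [dv, ax]
    · rw [hs']; cases s <;> cases s' <;> simp [dv, ax]
  have b1 := line_bound Γ (true, s) i (zdist_le _ _) v
  have b2 := line_bound Γ (false, s') j (zdist_le _ _) (v + i • dv n (true, s))
  rw [← e] at b2
  have h1 := H i (by omega)
  have h2 := H j (by omega)
  have E0 := En_nonneg Γ
  have q1 := mul_le_mul_of_nonneg_right h1 E0
  have q2 := mul_le_mul_of_nonneg_right h2 E0
  have hen := hΓ.en
  set w := Γ (v + i • dv n (true, s))
  have sq : (En Γ) ^ 2 ≤ 4 * (18 + 16 * Real.log d) * En Γ := by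
    rw [← hen]
    rw [hen]
    have : (Γ u - Γ v) ^ 2 ≤ 2 * (Γ u - w) ^ 2 + 2 * (w - Γ v) ^ 2 := by nlinarith [sq_nonneg (Γ u - w - (w - Γ v))]
    rw [hen] at this
    nlinarith
  have L : (0.69 : ℝ) ≤ Real.log d := by
    have := Real.log_le_log two_pos hd'
    have := Real.log_two_gt_d9
    linarith
  by_contra hc
  push Not at hc
  nlinarith

end logest

section final
variable {n : ℕ} [NeZero n]

lemma expec_eq (F : Cfg n → ℝ) : expec (THom n) F = Sm F / Nn n := by
  unfold expec Sm Nn Om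
  rw [finsum_mem_eq_finite_toFinset_sum F (finite_THom n), Nat.card_coe_set_eq,
    Set.ncard_eq_toFinset_card (THom n) (finite_THom n)]

noncomputable def Kl : ℝ := 4 * (C1 + CE) + 1
noncomputable def Ku : ℝ := 4 * C1 + 2 * CE + 32

lemma final_lower (hn : Even n) (h4 : 4 ≤ n) (u v : Vt n) (hd : 2 ≤ torusDist n u v) :
    1 / (4096 * Kl * (4 * CL + 1)) * Real.log (torusDist n u v) * Nn n ≤ Sm (fun h : Cfg n => ((h u : ℝ) - h v) ^ 2) := by
  obtain ⟨Γ, hΓ'⟩ := exists_pot u v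
  have hΓ : IsPot u v Γ := hΓ'
  have hl := pot_lower u v hd hΓ
  have hR := En_nonneg Γ
  have hN := Nn_pos hn
  have hC := CL_pos
  have hK : 1 ≤ Kl := by unfold Kl; linarith [C1_nonneg, CE_nonneg]
  set S := Sm (fun h : Cfg n => ((h u : ℝ) - h v) ^ 2) with hS
  have hS0 : 0 ≤ S := Finset.sum_nonneg fun _ _ => sq_nonneg _
  set L := Real.log (torusDist n u v)
  have hL : 0 ≤ L := Real.log_natCast_nonneg _
  rw [mul_comm (1 / _) L, mul_one_div, div_mul_eq_mul_div, div_le_iff₀ (by positivity)]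
  by_cases hbig : 4 * CL + 1 ≤ En Γ
  · have lo := lo_bound hn h4 Γ hΓ (Real.sqrt (En Γ)) (Real.sqrt_nonneg _) (Real.sq_sqrt hR).symm
    rw [Real.sq_sqrt hR] at lo
    have ys := Y_sq hn h4 Γ hΓ
    have cs := Sm_cs (fun h : Cfg n => (h u : ℝ) - h v) (fun h : Cfg n => Yy (ps Γ) h)
    rw [← hS] at cs
    set R := En Γ
    set Z := Sm (fun h : Cfg n => ((h u : ℝ) - h v) * Yy (ps Γ) h)
    set Y2 := Sm (fun h : Cfg n => Yy (ps Γ) h ^ 2)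
    have z1 : Nn n * R / 4 ≤ -Z := by nlinarith
    have z2 : (Nn n * R / 4) ^ 2 ≤ Z ^ 2 := by
      rw [← neg_sq Z]; exact pow_le_pow_left₀ (by positivity) z1 2
    have y2 : Y2 ≤ Kl * Nn n * (2 * R) := by
      have a0 : 0 ≤ 4 * (C1 + CE) := by linarith [C1_nonneg, CE_nonneg]
      calc Y2 ≤ 4 * (C1 + CE) * Nn n * (R + 1) := ys
        _ ≤ Kl * Nn n * (2 * R) := by
          unfold Kl
          gcongr
          · linarith
          · linarith
    have z3 : (Nn n * R / 4) ^ 2 ≤ S * (Kl * Nn n * (2 * R)) := z2.trans (cs.trans (mul_le_mul_of_nonneg_left y2 hS0))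
    have Rp : 0 < R := by linarith
    have z4 : Nn n * R ≤ 32 * Kl * S := by
      have : 0 < Nn n * R := by positivity
      by_contra hc
      push Not at hc
      nlinarith [mul_lt_mul_of_pos_left hc this]
    have : L * Nn n ≤ 128 * (32 * Kl * S) := by
      calc L * Nn n ≤ 128 * R * Nn n := mul_le_mul_of_nonneg_right hl hN.le
        _ = 128 * (Nn n * R) := by ring
        _ ≤ _ := by linarith
    have k : 0 ≤ S * Kl * CL := by positivity
    nlinarith
  · push Not at hbig
    have huv : u ≠ v := by
      rintro rfl; simp [torusDist, zdist_self] at hd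
    have sm := X_sq_small (by omega : 2 ≤ n) huv
    rw [← hS] at sm
    have h1 : L ≤ 128 * (4 * CL + 1) := by linarith
    calc L * Nn n ≤ 128 * (4 * CL + 1) * (8 * S) := by
          apply mul_le_mul h1 (by linarith) hN.le (by positivity)
      _ ≤ S * (4096 * Kl * (4 * CL + 1)) := by
          have : 0 ≤ S * (4 * CL + 1) := by positivity
          nlinarith

lemma final_upper (hn : Even n) (h4 : 4 ≤ n) (u v : Vt n) (hd : 2 ≤ torusDist n u v) :
    Sm (fun h : Cfg n => ((h u : ℝ) - h v) ^ 2) ≤ 302 * Ku * Real.log (torusDist n u v) * Nn n := by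
  obtain ⟨Γ, hΓ'⟩ := exists_pot u v
  have hΓ : IsPot u v Γ := hΓ'
  have hl := pot_upper u v hd hΓ
  have hN := Nn_pos hn
  have hd' : (2 : ℝ) ≤ torusDist n u v := by exact_mod_cast hd
  have L : (0.69 : ℝ) ≤ Real.log (torusDist n u v) := by
    have := Real.log_le_log two_pos hd'
    have := Real.log_two_gt_d9
    linarith
  have hK : 0 ≤ Ku := by unfold Ku; linarith [C1_nonneg, CE_nonneg]
  have x := X_sq_upper hn h4 Γ hΓ
  calc _ ≤ Ku * Nn n * (En Γ + 1) := x
    _ ≤ Ku * Nn n * (302 * Real.log (torusDist n u v)) := by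
        apply mul_le_mul_of_nonneg_left (by linarith) (by positivity)
    _ = _ := by ring

lemma small_dist (h2 : n = 2) (u v : Vt n) : torusDist n u v ≤ 2 := by
  have a := ZMod.val_lt (u.1 - v.1)
  have b := ZMod.val_lt (u.2 - v.2)
  simp only [torusDist, zdist]
  omega

lemma small_upper (h2 : n = 2) (u v : Vt n) :
    Sm (fun h : Cfg n => ((h u : ℝ) - h v) ^ 2) ≤ 16 * Nn n := by
  have hb : ∀ h : Cfg n, h ∈ Om n → ∀ u : Vt n, |h u| ≤ 2 := by
    intro h hh u
    have hh' := mem_Om.1 hh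
    have := (isHom_nat (mem_THom.1 hh').1 u.1.val u.2.val).1
    rw [(mem_THom.1 hh').2, ZMod.natCast_zmod_val, ZMod.natCast_zmod_val, sub_zero] at this
    have a := ZMod.val_lt u.1
    have b := ZMod.val_lt u.2
    have e : ((u.1, u.2) : Vt n) = u := rfl
    rw [e] at this
    omega
  unfold Sm Nn
  rw [mul_comm, ← nsmul_eq_mul]
  refine Finset.sum_le_card_nsmul _ _ _ fun h hh => ?_
  have a := abs_le.1 (hb h hh u)
  have b := abs_le.1 (hb h hh v)
  have : ((h u : ℝ) - h v) ^ 2 = (((h u - h v) ^ 2 : ℤ) : ℝ) := by push_cast; ring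
  show ((h u : ℝ) - h v) ^ 2 ≤ 16
  rw [this]
  have : (h u - h v) ^ 2 ≤ 16 := by nlinarith
  exact_mod_cast this

end final

/-- The height function of square ice on the torus has logarithmic variance. -/
theorem torus_variance_log :
    ∃ c C : ℝ, 0 < c ∧ 0 < C ∧
      ∀ n : ℕ, 2 ≤ n → Even n →
        ∀ u v : ZMod n × ZMod n, 2 ≤ torusDist n u v →
          c * Real.log (torusDist n u v) ≤
              expec (THom n) (fun h => ((h u - h v : ℤ) : ℝ) ^ 2) ∧
            expec (THom n) (fun h => ((h u - h v : ℤ) : ℝ) ^ 2) ≤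
              C * Real.log (torusDist n u v) := by
  have hC := CL_pos
  have hK : 1 ≤ Kl := by unfold Kl; linarith [C1_nonneg, CE_nonneg]
  have hU : 32 ≤ Ku := by unfold Ku; linarith [C1_nonneg, CE_nonneg]
  refine ⟨1 / (4096 * Kl * (4 * CL + 1)), 302 * Ku, by positivity, by positivity, ?_⟩
  intro n h2 hn u v hd
  haveI : NeZero n := ⟨by omega⟩
  have hN := Nn_pos hn
  have e : expec (THom n) (fun h => ((h u - h v : ℤ) : ℝ) ^ 2) = Sm (fun h : Cfg n => ((h u : ℝ) - h v) ^ 2) / Nn n := by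
    rw [← expec_eq]
    simp only [Int.cast_sub]
  rw [e, le_div_iff₀ hN, div_le_iff₀ hN]
  rcases Nat.lt_or_ge n 4 with h4 | h4
  · have n2 : n = 2 := by
      obtain ⟨k, hk⟩ := hn; omega
    have huv : u ≠ v := by
      rintro rfl; simp [torusDist, zdist_self] at hd
    have d2 : torusDist n u v = 2 := le_antisymm (small_dist n2 u v) hd
    have sm := X_sq_small h2 huv
    have up := small_upper n2 u v
    rw [d2]
    have l1 := Real.log_two_gt_d9
    have l2 := Real.log_two_lt_d9
    push_cast
    constructor
    · refine le_trans ?_ sm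
      have c8 : 1 / (4096 * Kl * (4 * CL + 1)) ≤ 1 / 8 := by
        apply one_div_le_one_div_of_le (by norm_num)
        have : 0 ≤ Kl * CL := by positivity
        nlinarith
      have : 1 / (4096 * Kl * (4 * CL + 1)) * Real.log 2 ≤ 1 / 8 * 1 :=
        mul_le_mul c8 (by linarith) (by linarith) (by norm_num)
      nlinarith
    · refine up.trans (mul_le_mul_of_nonneg_right ?_ hN.le)
      nlinarith
  · exact ⟨final_lower hn h4 u v hd, final_upper hn h4 u v hd⟩

end SquareIceTorus
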